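/- Let R be a Hecke operator on V and assume the quantum integers [k]_q = 1 + q + ⋯ + q^{k−1} are nonzero in K for every integer k ≥ 1. Then the dimension sequence (λ_n)_{n≥0} of the quadratic algebra Λ is totally positive (a Pólya frequency sequence): for every r ≥ 1 and all strictly increasing tuples of natural numbers i_1 < ⋯ < i_r and j_1 < ⋯ < j_r, the minor det((λ_{i_s − j_t}))_{1≤s,t≤r} is nonnegative, where λ_k := 0 for k < 0. (Lemma 2.3) -/

import Mathlib

open TensorProduct

/-- The Yang–Baxter equation for an operator `R` on `V ⊗ V`, stated on `(V ⊗ V) ⊗ V`: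
`(R ⊗ 1)(1 ⊗ R)(R ⊗ 1) = (1 ⊗ R)(R ⊗ 1)(1 ⊗ R)`, where `1 ⊗ R` is transported along
the associator. -/
def YangBaxter (K : Type*) [Field K] (V : Type*) [AddCommGroup V] [Module K V]
    (R : V ⊗[K] V →ₗ[K] V ⊗[K] V) : Prop :=
  let R₁ : (V ⊗[K] V) ⊗[K] V →ₗ[K] (V ⊗[K] V) ⊗[K] V := LinearMap.rTensor V R
  let R₂ : (V ⊗[K] V) ⊗[K] V →ₗ[K] (V ⊗[K] V) ⊗[K] V :=
    (TensorProduct.assoc K V V V).symm.toLinearMap ∘ₗ LinearMap.lTensor V R ∘ₗ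
      (TensorProduct.assoc K V V V).toLinearMap
  R₁ ∘ₗ R₂ ∘ₗ R₁ = R₂ ∘ₗ R₁ ∘ₗ R₂

/-- A Hecke operator on `V` for the parameter `q`: the Yang–Baxter equation together
with the Hecke equation `(R + 1)(R − q) = 0`. -/
def IsHecke (K : Type*) [Field K] (V : Type*) [AddCommGroup V] [Module K V]
    (q : K) (R : V ⊗[K] V →ₗ[K] V ⊗[K] V) : Prop :=
  YangBaxter K V R ∧ (R + LinearMap.id) ∘ₗ (R - q • LinearMap.id) = 0

/-- The multiplication map `V ⊗ V → T(V)` of the tensor algebra. -/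
noncomputable def quadMul (K : Type*) [Field K] (V : Type*) [AddCommGroup V] [Module K V] :
    V ⊗[K] V →ₗ[K] TensorAlgebra K V :=
  LinearMap.mul' K (TensorAlgebra K V) ∘ₗ
    TensorProduct.map (TensorAlgebra.ι K) (TensorAlgebra.ι K)

/-- The relation on `T(V)` identifying the image of `W ⊆ V ⊗ V` with zero; quotienting
by (the two-sided ideal generated by) it yields the quadratic algebra `T(V)/⟨W⟩`. -/
def quadRel (K : Type*) [Field K] (V : Type*) [AddCommGroup V] [Module K V]
    (W : Submodule K (V ⊗[K] V)) : TensorAlgebra K V → TensorAlgebra K V → Prop :=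
  fun a b => b = 0 ∧ ∃ w ∈ W, a = quadMul K V w

/-- The dimension of the `n`-th homogeneous component of the quadratic algebra
`T(V)/⟨W⟩`, realised as the image of the degree-`n` component of `T(V)` in the
quotient algebra. -/
noncomputable def quadDim (K : Type*) [Field K] (V : Type*) [AddCommGroup V] [Module K V]
    (W : Submodule K (V ⊗[K] V)) (n : ℕ) : ℕ :=
  Module.finrank K
    (Submodule.map (RingQuot.mkAlgHom K (quadRel K V W)).toLinearMap
      (LinearMap.range (TensorAlgebra.ι K (M := V)) ^ n))

/-- `λ_n`, the dimension of the `n`-th homogeneous component of `Λ = T(V)/⟨Im(R+1)⟩`. -/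
noncomputable def lambdaDim (K : Type*) [Field K] (V : Type*) [AddCommGroup V] [Module K V]
    (R : V ⊗[K] V →ₗ[K] V ⊗[K] V) (n : ℕ) : ℕ :=
  quadDim K V (LinearMap.range (R + LinearMap.id)) n

/-- `s_n`, the dimension of the `n`-th homogeneous component of `S = T(V)/⟨Im(R−q)⟩`. -/
noncomputable def sDim (K : Type*) [Field K] (V : Type*) [AddCommGroup V] [Module K V]
    (q : K) (R : V ⊗[K] V →ₗ[K] V ⊗[K] V) (n : ℕ) : ℕ :=
  quadDim K V (LinearMap.range (R - q • LinearMap.id)) n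

/-- Extension of a sequence by `0` on negative indices. -/
noncomputable def seqExt (a : ℕ → ℝ) (k : ℤ) : ℝ := if 0 ≤ k then a k.toNat else 0

/-- A sequence is totally positive (a Pólya frequency sequence) if every minor of the
associated infinite Toeplitz matrix `‖a_{i−j}‖` is nonnegative. -/
def IsTotallyPositive (a : ℕ → ℝ) : Prop :=
  ∀ r : ℕ, 0 < r → ∀ i j : Fin r → ℕ, StrictMono i → StrictMono j →
    0 ≤ (Matrix.of fun s t => seqExt a ((i s : ℤ) - (j t : ℤ))).det

/-- A PP-sequence: a totally positive sequence all of whose minors with `j_s ≤ i_s`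
for all `s` are strictly positive. -/
def IsPP (a : ℕ → ℝ) : Prop :=
  IsTotallyPositive a ∧
    ∀ r : ℕ, 0 < r → ∀ i j : Fin r → ℕ, StrictMono i → StrictMono j →
      (∀ s, j s ≤ i s) →
      0 < (Matrix.of fun s t => seqExt a ((i s : ℤ) - (j t : ℤ))).det

set_option linter.unusedSectionVars false
set_option linter.unusedSimpArgs false
namespace HeckeTP

section Hecke
variable {K : Type*} [Field K] {A : Type*} [Ring A] [Algebra K A]

/-- quantum integer -/
def qi (q : K) (n : ℕ) : K := ∑ i ∈ Finset.range n, q ^ i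

@[simp] lemma qi_zero (q : K) : qi q 0 = 0 := by simp [qi]
@[simp] lemma qi_one (q : K) : qi q 1 = 1 := by simp [qi]
lemma qi_succ (q : K) (n : ℕ) : qi q (n+1) = qi q n + q ^ n := by simp [qi, Finset.sum_range_succ]
lemma qi_succ' (q : K) (n : ℕ) : qi q (n+1) = 1 + q * qi q n := by
  simp [qi, Finset.sum_range_succ', Finset.mul_sum, pow_succ']; ring
lemma qi_mul (q : K) (n : ℕ) : (q - 1) * qi q n = q ^ n - 1 := by
  unfold qi; rw [mul_comm]; exact geom_sum_mul q n
lemma qi_add (q : K) (m n : ℕ) : qi q (m + n) = qi q m + q ^ m * qi q n := by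
  simp [qi, Finset.sum_range_add, Finset.mul_sum, pow_add]

structure HRel (q : K) (T : ℕ → A) (N : ℕ) : Prop where
  quad : ∀ i, T i * T i = (q - 1) • T i + q • (1 : A)
  comm : ∀ i j, i + 2 ≤ j → T i * T j = T j * T i
  braid : ∀ i, i + 2 < N → T i * T (i+1) * T i = T (i+1) * T i * T (i+1)

def sh (s : ℕ) (T : ℕ → A) : ℕ → A := fun i => T (s + i)

lemma sh_sh (s t : ℕ) (T : ℕ → A) : sh s (sh t T) = sh (t + s) T := by
  funext i; simp [sh, add_assoc]
@[simp] lemma sh_zero (T : ℕ → A) : sh 0 T = T := by funext i; simp [sh]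

lemma HRel.shift {q : K} {T : ℕ → A} {N s M : ℕ} (h : HRel q T N) (hM : s + M ≤ N) :
    HRel q (sh s T) M where
  quad i := h.quad _
  comm i j hij := h.comm _ _ (by omega)
  braid i hi := h.braid (s + i) (by omega)

lemma HRel.mono {q : K} {T : ℕ → A} {N M : ℕ} (h : HRel q T N) (hM : M ≤ N) :
    HRel q T M := ⟨h.quad, h.comm, fun i hi => h.braid i (by omega)⟩

def opT (T : ℕ → A) : ℕ → Aᵐᵒᵖ := fun i => MulOpposite.op (T i)

lemma HRel.op {q : K} {T : ℕ → A} {N : ℕ} (h : HRel q T N) : HRel q (opT T) N where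
  quad i := by
    simp only [opT, ← MulOpposite.op_mul, h.quad]; simp
  comm i j hij := by
    simp only [opT, ← MulOpposite.op_mul, h.comm i j hij]
  braid i hi := by
    simp only [opT, ← MulOpposite.op_mul, ← mul_assoc, h.braid i hi]

/-- antisymmetrizer -/
noncomputable def E (q : K) (T : ℕ → A) : ℕ → A
  | 0 => 1
  | 1 => 1
  | n+2 => (qi q (n+2))⁻¹ • (q^(n+1) • E q T (n+1) - qi q (n+1) • (E q T (n+1) * T n * E q T (n+1)))

variable {q : K} {T : ℕ → A} {N : ℕ}

@[simp] lemma E_zero : E q T 0 = 1 := rfl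
@[simp] lemma E_one : E q T 1 = 1 := rfl
lemma E_two (n : ℕ) : E q T (n+2) = (qi q (n+2))⁻¹ • (q^(n+1) • E q T (n+1) - qi q (n+1) • (E q T (n+1) * T n * E q T (n+1))) := rfl

lemma E_op (n : ℕ) : E q (opT T) n = MulOpposite.op (E q T n) := by
  induction n with
  | zero => rfl
  | succ n ih =>
    cases n with
    | zero => rfl
    | succ n =>
      rw [E_two, E_two, ih]
      simp only [opT, ← MulOpposite.op_mul, ← MulOpposite.op_smul, ← MulOpposite.op_sub, mul_assoc]

lemma E_two' (hq : ∀ k, 1 ≤ k → qi q k ≠ 0) (n : ℕ) : qi q (n+2) • E q T (n+2) = (q^(n+1) • E q T (n+1) - qi q (n+1) • (E q T (n+1) * T n * E q T (n+1))) := by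
  rw [E_two, smul_smul, mul_inv_cancel₀ (hq _ (by omega)), one_smul]

lemma E_mem (S : Subalgebra K A) (n : ℕ) (hT : ∀ i, i + 1 < n → T i ∈ S) : E q T n ∈ S := by
  induction n with
  | zero => exact S.one_mem
  | succ n ih =>
    cases n with
    | zero => exact S.one_mem
    | succ n =>
      have := ih (fun i hi => hT i (by omega))
      rw [E_two]
      exact S.smul_mem (S.sub_mem (S.smul_mem this _) (S.smul_mem (S.mul_mem (S.mul_mem this (hT _ (by omega))) this) _)) _

lemma E_commute (n : ℕ) (y : A) (h : ∀ i, i + 1 < n → Commute (T i) y) : Commute (E q T n) y := by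
  have := E_mem (q := q) (T := T) (Subalgebra.centralizer K {y}) n (fun i hi => by
    rw [Subalgebra.mem_centralizer_iff]; rintro g rfl; exact (h i hi).symm)
  rw [Subalgebra.mem_centralizer_iff] at this
  exact (this y rfl).symm

lemma E_mul_of (hq : ∀ k, 1 ≤ k → qi q k ≠ 0) (n : ℕ) (x : A) (h : ∀ i, i + 1 < n → T i * x = -x) :
    E q T n * x = x := by
  induction n with
  | zero => simp
  | succ n ih =>
    cases n with
    | zero => simp
    | succ n =>
      have h1 := ih (fun i hi => h i (by omega))
      have h2 := h n (by omega)
      rw [E_two, smul_mul_assoc, inv_smul_eq_iff₀ (hq _ (by omega)), sub_mul, smul_mul_assoc,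
        smul_mul_assoc, mul_assoc, mul_assoc, h1, h2, mul_neg, h1, qi_succ q (n+1)]
      module

lemma mul_E_of (hq : ∀ k, 1 ≤ k → qi q k ≠ 0) (n : ℕ) (x : A) (h : ∀ i, i + 1 < n → x * T i = -x) :
    x * E q T n = x := by
  have := E_mul_of (T := opT T) hq n (MulOpposite.op x) (fun i hi => by
    simp only [opT, ← MulOpposite.op_mul, h i hi, MulOpposite.op_neg])
  rw [E_op, ← MulOpposite.op_mul] at this
  exact MulOpposite.op_injective this

lemma HRel.E_abs_aux (hq : ∀ k, 1 ≤ k → qi q k ≠ 0) (n : ℕ) :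
    ∀ {A : Type _} [Ring A] [Algebra K A] {T : ℕ → A} {N : ℕ} (_ : HRel q T N) (_ : n ≤ N),
    (∀ j, j + 1 < n → T j * E q T n = - E q T n) := by
  induction n with
  | zero => intros; omega
  | succ n ih =>
    intro A _ _ T N h hn j hj
    obtain _ | n := n
    · omega
    rcases Nat.lt_or_ge j n with hjn | hjn
    · have h1 := ih h (by omega) j (by omega)
      rw [E_two]
      simp only [mul_smul_comm, mul_sub, ← mul_assoc, h1, neg_mul]
      module
    · obtain rfl : j = n := by omega
      have key : T j * (qi q (j+2) • E q T (j+2)) = - (qi q (j+2) • E q T (j+2)) := by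
        rw [E_two' hq]
        obtain _ | n := j
        · simp [mul_sub, mul_smul_comm, h.quad]; module
        · have c : Commute (E q T (n+1)) (T (n+1)) :=
            E_commute _ _ (fun i hi => h.comm _ _ (by omega))
          have a1 : E q T (n+1) * E q T (n+2) = E q T (n+2) :=
            E_mul_of hq _ _ (fun i hi => ih h (by omega) i (by omega))
          have a2 := ih h (by omega) n (by omega)
          have e1 : qi q (n+2) • (E q T (n+2) * T (n+1) * E q T (n+2)) =
              q^(n+1) • (T (n+1) * E q T (n+2)) - qi q (n+1) • (E q T (n+1) * T n * T (n+1) * E q T (n+2)) := by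
            calc _ = (qi q (n+2) • E q T (n+2)) * T (n+1) * E q T (n+2) := by simp
              _ = q^(n+1) • (E q T (n+1) * T (n+1) * E q T (n+2)) - qi q (n+1) • (E q T (n+1) * T n * (E q T (n+1) * T (n+1)) * E q T (n+2)) := by
                rw [E_two' hq]; simp only [sub_mul, smul_mul_assoc, mul_assoc]
              _ = q^(n+1) • (T (n+1) * (E q T (n+1) * E q T (n+2))) - qi q (n+1) • (E q T (n+1) * T n * T (n+1) * (E q T (n+1) * E q T (n+2))) := by
                rw [c.eq]; simp only [mul_assoc]
              _ = _ := by rw [a1]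
          have e2 : T (n+1) * (E q T (n+1) * T n * T (n+1) * E q T (n+2)) = 
             - (E q T (n+1) * T n * T (n+1) * E q T (n+2)) := by
            calc _ = (T (n+1) * E q T (n+1)) * T n * T (n+1) * E q T (n+2) := by simp only [mul_assoc]
              _ = E q T (n+1) * (T (n+1) * T n * T (n+1)) * E q T (n+2) := by rw [← c.eq]; simp only [mul_assoc]
              _ = E q T (n+1) * (T n * T (n+1)) * (T n * E q T (n+2)) := by
                rw [← h.braid n (by omega)]; simp only [mul_assoc]
              _ = _ := by rw [a2]; simp only [mul_neg, mul_assoc]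
          rw [e1, mul_sub, mul_sub, mul_smul_comm, mul_smul_comm, mul_smul_comm, e2, ← mul_assoc, h.quad,
            add_mul, smul_mul_assoc, smul_mul_assoc, one_mul]
          module
      rw [mul_smul_comm, ← smul_neg] at key
      exact smul_right_injective _ (hq (j+2) (by omega)) key

lemma HRel.T_E (h : HRel q T N) (hq : ∀ k, 1 ≤ k → qi q k ≠ 0) {n : ℕ} (hn : n ≤ N) {j : ℕ} (hj : j + 1 < n) :
    T j * E q T n = - E q T n := HRel.E_abs_aux hq n h hn j hj

lemma HRel.E_T (h : HRel q T N) (hq : ∀ k, 1 ≤ k → qi q k ≠ 0) {n : ℕ} (hn : n ≤ N) {j : ℕ} (hj : j + 1 < n) :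
    E q T n * T j = - E q T n := by
  have := h.op.T_E hq hn hj
  rw [E_op, opT, ← MulOpposite.op_mul] at this
  exact MulOpposite.op_injective this

lemma HRel.E_idem (h : HRel q T N) (hq : ∀ k, 1 ≤ k → qi q k ≠ 0) {n : ℕ} (hn : n ≤ N) :
    E q T n * E q T n = E q T n := E_mul_of hq _ _ fun _ hi => h.T_E hq hn hi

end Hecke
end HeckeTP

set_option linter.unusedSectionVars false
set_option linter.unusedSimpArgs false
namespace HeckeTP

section Hecke2
variable {K : Type*} [Field K] {A : Type*} [Ring A] [Algebra K A]
variable {q : K} {T : ℕ → A} {N : ℕ}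

/-- reversal of generators -/
def rv (n : ℕ) (T : ℕ → A) : ℕ → A := fun i => if i ≤ n then T (n - i) else -1

lemma HRel.rev (h : HRel q T N) {n : ℕ} (hn : n + 2 ≤ N) : HRel q (rv n T) (n+2) where
  quad i := by
    unfold rv
    split_ifs
    · exact h.quad _
    · simp; module
  comm i j hij := by
    unfold rv
    split_ifs with h1 h2 h2
    · exact (h.comm _ _ (by omega)).symm
    all_goals simp
  braid i hi := by
    unfold rv
    rw [if_pos (by omega), if_pos (by omega)]
    have := h.braid (n - (i+1)) (by omega)
    rw [show n - (i+1) + 1 = n - i by omega] at this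
    exact this.symm

lemma E_eq_E {T' : ℕ → A} (hq : ∀ k, 1 ≤ k → qi q k ≠ 0) (n m : ℕ)
    (h1 : ∀ i, i + 1 < n → T i * E q T' m = - E q T' m)
    (h2 : ∀ i, i + 1 < m → E q T n * T' i = - E q T n) : E q T n = E q T' m := by
  rw [← E_mul_of hq n _ h1, mul_E_of hq m _ h2]

lemma HRel.E_left (h : HRel q T N) (hq : ∀ k, 1 ≤ k → qi q k ≠ 0) {n : ℕ} (hn : n + 2 ≤ N) :
    qi q (n+2) • E q T (n+2) = (q^(n+1) • E q (sh 1 T) (n+1) -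
      qi q (n+1) • (E q (sh 1 T) (n+1) * T 0 * E q (sh 1 T) (n+1))) := by
  have hr := h.rev hn
  have h1 : E q (rv n T) (n+2) = E q T (n+2) := by
    apply E_eq_E hq
    · intro i hi
      rw [rv, if_pos (by omega)]
      exact h.T_E hq hn (by omega)
    · intro i hi
      have := hr.E_T hq (n := n+2) (j := n - i) le_rfl (by omega)
      rwa [rv, if_pos (by omega), show n - (n - i) = i by omega] at this
  have h2 : E q (rv n T) (n+1) = E q (sh 1 T) (n+1) := by
    apply E_eq_E hq
    · intro i hi
      rw [rv, if_pos (by omega)]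
      have := (h.shift (s := 1) (M := n+1) (by omega)).T_E hq (n := n+1) le_rfl (j := n - 1 - i) (by omega)
      rwa [sh, show 1 + (n - 1 - i) = n - i by omega] at this
    · intro i hi
      have := hr.E_T hq (n := n+1) (j := n - (i+1)) (by omega) (by omega)
      rwa [rv, if_pos (by omega), show n - (n - (i+1)) = 1 + i by omega] at this
  have := E_two' (T := rv n T) hq n
  rw [h1, h2, rv, if_pos le_rfl, Nat.sub_self] at this
  exact this

/-- inverse of a generator -/
noncomputable def Ti (q : K) (T : ℕ → A) (i : ℕ) : A := q⁻¹ • (T i - (q - 1) • (1 : A))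

lemma HRel.T_Ti (h : HRel q T N) (hq0 : q ≠ 0) (i : ℕ) : T i * Ti q T i = 1 := by
  rw [Ti, mul_smul_comm, mul_sub, h.quad, mul_smul_comm, mul_one, add_sub_cancel_left, smul_smul,
    inv_mul_cancel₀ hq0, one_smul]

lemma HRel.Ti_T (h : HRel q T N) (hq0 : q ≠ 0) (i : ℕ) : Ti q T i * T i = 1 := by
  rw [Ti, smul_mul_assoc, sub_mul, h.quad, smul_mul_assoc, one_mul, add_sub_cancel_left, smul_smul,
    inv_mul_cancel₀ hq0, one_smul]

noncomputable def HRel.unit (h : HRel q T N) (hq0 : q ≠ 0) (i : ℕ) : Aˣ :=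
  ⟨T i, Ti q T i, h.T_Ti hq0 i, h.Ti_T hq0 i⟩

/-- elements cyclic for a functional -/
def cyc (τ : A →ₗ[K] K) : Subalgebra K A where
  carrier := {y | ∀ x, τ (x * y) = τ (y * x)}
  mul_mem' := by
    intro a b ha hb x
    rw [← mul_assoc, hb, ← mul_assoc, ha, mul_assoc]
  add_mem' := by
    intro a b ha hb x
    rw [mul_add, add_mul, map_add, map_add, ha, hb]
  algebraMap_mem' := by
    intro r x
    rw [Algebra.commutes]

lemma mem_cyc {τ : A →ₗ[K] K} {y : A} : y ∈ cyc τ ↔ ∀ x, τ (x * y) = τ (y * x) := Iff.rfl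

lemma Ti_mem (S : Subalgebra K A) {i : ℕ} (h : T i ∈ S) : Ti q T i ∈ S :=
  S.smul_mem (S.sub_mem h (S.smul_mem S.one_mem _)) _

lemma Ti_commute {i : ℕ} {y : A} (h : Commute (T i) y) : Commute (Ti q T i) y := by
  unfold Ti
  exact Commute.smul_left (Commute.sub_left h (Commute.smul_left (Commute.one_left _) _)) _

/-- Yd m n = T_{m+n-1} ... T_m -/
def Yd (T : ℕ → A) (m : ℕ) : ℕ → A
  | 0 => 1
  | n+1 => T (m+n) * Yd T m n

/-- the inverse -/
noncomputable def Ydi (q : K) (T : ℕ → A) (m : ℕ) : ℕ → A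
  | 0 => 1
  | n+1 => Ydi q T m n * Ti q T (m+n)

lemma Yd_succ_left (m n : ℕ) : Yd T m (n+1) = Yd T (m+1) n * T m := by
  induction n with
  | zero => simp [Yd]
  | succ n ih =>
    rw [Yd, ih, Yd, mul_assoc]
    congr 2; ring

lemma Ydi_succ_left (m n : ℕ) : Ydi q T m (n+1) = Ti q T m * Ydi q T (m+1) n := by
  induction n with
  | zero => simp [Ydi]
  | succ n ih =>
    rw [Ydi, ih, Ydi, mul_assoc]
    congr 3; ring

lemma HRel.Yd_Ydi (h : HRel q T N) (hq0 : q ≠ 0) (m n : ℕ) : Yd T m n * Ydi q T m n = 1 := by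
  induction n with
  | zero => simp [Yd, Ydi]
  | succ n ih =>
    rw [Yd, Ydi, mul_assoc, ← mul_assoc (Yd T m n), ih, one_mul, h.T_Ti hq0]

lemma HRel.Ydi_Yd (h : HRel q T N) (hq0 : q ≠ 0) (m n : ℕ) : Ydi q T m n * Yd T m n = 1 := by
  induction n with
  | zero => simp [Yd, Ydi]
  | succ n ih =>
    rw [Yd, Ydi, mul_assoc, ← mul_assoc (Ti q T _), h.Ti_T hq0, one_mul, ih]

lemma Yd_mem (S : Subalgebra K A) (m n : ℕ) (h : ∀ i, m ≤ i → i < m + n → T i ∈ S) : Yd T m n ∈ S := by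
  induction n with
  | zero => exact S.one_mem
  | succ n ih => exact S.mul_mem (h _ (by omega) (by omega)) (ih fun i h1 h2 => h i h1 (by omega))

lemma Ydi_mem (S : Subalgebra K A) (m n : ℕ) (h : ∀ i, m ≤ i → i < m + n → T i ∈ S) : Ydi q T m n ∈ S := by
  induction n with
  | zero => exact S.one_mem
  | succ n ih => exact S.mul_mem (ih fun i h1 h2 => h i h1 (by omega)) (Ti_mem S (h _ (by omega) (by omega))) 

lemma mem_cent {x y : A} : x ∈ Subalgebra.centralizer K {y} ↔ Commute x y := by
  rw [Subalgebra.mem_centralizer_iff]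
  constructor
  · intro h; exact (h y rfl).symm
  · rintro h g rfl; exact h.symm

lemma Yd_commute (m n : ℕ) {y : A} (h : ∀ i, m ≤ i → i < m + n → Commute (T i) y) : Commute (Yd T m n) y :=
  by
  induction n with
  | zero => exact Commute.one_left _
  | succ n ih => exact (h _ (by omega) (by omega)).mul_left (ih fun i h1 h2 => h i h1 (by omega))

lemma Ydi_commute (m n : ℕ) {y : A} (h : ∀ i, m ≤ i → i < m + n → Commute (T i) y) : Commute (Ydi q T m n) y :=
  mem_cent.1 (Ydi_mem (K := K) _ m n fun i h1 h2 => mem_cent.2 (h i h1 h2))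

/-- T_j Yd(m,n) = Yd(m,n) T_{j+1} -/
lemma HRel.T_Yd (h : HRel q T N) {m n j : ℕ} (hmj : m ≤ j) (hj : j + 1 < m + n) (hN : m + n < N) :
    T j * Yd T m n = Yd T m n * T (j+1) := by
  induction n with
  | zero => omega
  | succ n ih =>
    rcases Nat.lt_or_ge (j+1) (m+n) with h1 | h1
    · rw [Yd, ← mul_assoc, h.comm j (m+n) (by omega), mul_assoc, ih h1 (by omega), mul_assoc]
    · obtain _ | n := n
      · omega
      obtain rfl : j = m + n := by omega
      have c : Commute (Yd T m n) (T (m+n+1)) :=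
        Yd_commute _ _ fun i h1 h2 => h.comm _ _ (by omega)
      rw [Yd, Yd, ← add_assoc]
      calc T (m+n) * (T (m+n+1) * (T (m+n) * Yd T m n)) = (T (m+n) * T (m+n+1) * T (m+n)) * Yd T m n := by simp only [mul_assoc]
        _ = T (m+n+1) * T (m+n) * (T (m+n+1) * Yd T m n) := by rw [h.braid _ (by omega)]; simp only [mul_assoc]
        _ = _ := by rw [← c.eq]; simp only [mul_assoc]

/-- T_{m+n} Yd(m,n) Yd(m+1,n) = Yd(m,n) Yd(m+1,n) T_m -/
lemma HRel.T_Yd_Yd (h : HRel q T N) {m n : ℕ} (hN : m + n + 1 < N) :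
    T (m+n) * Yd T m n * Yd T (m+1) n = Yd T m n * Yd T (m+1) n * T m := by
  induction n with
  | zero => simp [Yd]
  | succ n ih =>
    have c : Commute (Yd T m n) (T (m+n+1)) :=
        Yd_commute _ _ fun i h1 h2 => h.comm _ _ (by omega)
    have c' : Commute (Yd T m n) (T (m+1+n)) := by rwa [show m+1+n = m+n+1 by ring]
    calc T (m+(n+1)) * Yd T m (n+1) * Yd T (m+1) (n+1)
        = T (m+n+1) * T (m+n) * (Yd T m n * T (m+n+1)) * Yd T (m+1) n := by
          rw [Yd, Yd]; simp only [← mul_assoc, ← add_assoc, show m+1+n = m+n+1 by ring]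
      _ = (T (m+n+1) * T (m+n) * T (m+n+1)) * Yd T m n * Yd T (m+1) n := by
          rw [c.eq]; simp only [mul_assoc]
      _ = T (m+n) * T (m+n+1) * (T (m+n) * Yd T m n * Yd T (m+1) n) := by
          rw [← h.braid _ (by omega)]; simp only [mul_assoc]
      _ = T (m+n) * (T (m+1+n) * Yd T m n) * Yd T (m+1) n * T m := by
          rw [ih (by omega), show m+1+n = m+n+1 by ring]; simp only [mul_assoc]
      _ = _ := by
          rw [← c'.eq, Yd, Yd]; simp only [mul_assoc]

/-- block swap: moves. Bs a b = Yd 0 a * Yd 1 a * ... * Yd (b-1) a -/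
def Bs (T : ℕ → A) (a : ℕ) : ℕ → A
  | 0 => 1
  | b+1 => Bs T a b * Yd T b a

noncomputable def Bsi (q : K) (T : ℕ → A) (a : ℕ) : ℕ → A
  | 0 => 1
  | b+1 => Ydi q T b a * Bsi q T a b

lemma Bs_mem (S : Subalgebra K A) (a b : ℕ) (h : ∀ i, i + 1 < a + b → T i ∈ S) : Bs T a b ∈ S := by
  induction b with
  | zero => exact S.one_mem
  | succ b ih =>
    exact S.mul_mem (ih fun i hi => h i (by omega)) (Yd_mem S _ _ fun i h1 h2 => h i (by omega))

lemma Bsi_mem (S : Subalgebra K A) (a b : ℕ) (h : ∀ i, i + 1 < a + b → T i ∈ S) : Bsi q T a b ∈ S := by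
  induction b with
  | zero => exact S.one_mem
  | succ b ih =>
    exact S.mul_mem (Ydi_mem S _ _ fun i h1 h2 => h i (by omega)) (ih fun i hi => h i (by omega))

lemma HRel.Bs_Bsi (h : HRel q T N) (hq0 : q ≠ 0) (a b : ℕ) : Bs T a b * Bsi q T a b = 1 := by
  induction b with
  | zero => simp [Bs, Bsi]
  | succ n ih =>
    rw [Bs, Bsi, mul_assoc, ← mul_assoc (Yd T _ _), h.Yd_Ydi hq0, one_mul, ih]

lemma HRel.Bsi_Bs (h : HRel q T N) (hq0 : q ≠ 0) (a b : ℕ) : Bsi q T a b * Bs T a b = 1 := by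
  induction b with
  | zero => simp [Bs, Bsi]
  | succ n ih =>
    rw [Bs, Bsi, mul_assoc, ← mul_assoc (Bsi q T _ _), ih, one_mul, h.Ydi_Yd hq0]

/-- T_i B = B T_{i+b} for i+1<a -/
lemma HRel.T_Bs_lo (h : HRel q T N) {a b i : ℕ} (hN : a + b ≤ N) (hi : i + 1 < a) :
    T i * Bs T a b = Bs T a b * T (b + i) := by
  induction b with
  | zero => simp [Bs]
  | succ b ih =>
    rw [Bs, ← mul_assoc, ih (by omega), mul_assoc, h.T_Yd (by omega) (by omega) (by omega), mul_assoc]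
    congr 3; ring

/-- T_{a+i} B = B T_i for i+1<b -/
lemma HRel.T_Bs_hi (h : HRel q T N) {a b i : ℕ} (hN : a + b ≤ N) (hi : i + 1 < b) :
    T (a + i) * Bs T a b = Bs T a b * T i := by
  have c : ∀ b' ≤ i, Commute (Bs T a b') (T (a+i)) := by
    intro b' hb'
    refine mem_cent.1 (Bs_mem (K := K) _ a b' fun j hj => mem_cent.2 (h.comm _ _ (by omega)))
  induction b with
  | zero => omega
  | succ b ih =>
    rcases Nat.lt_or_ge (i+1) b with h1 | h1
    · have c : Commute (Yd T b a) (T i) := Yd_commute _ _ fun j h1 h2 => (h.comm i j (by omega)).symm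
      rw [Bs, ← mul_assoc, ih (by omega) h1, mul_assoc, ← c.eq, mul_assoc]
    · obtain rfl : b = i + 1 := by omega
      rw [Bs, Bs, ← mul_assoc, ← mul_assoc, ← (c i le_rfl).eq]
      have := h.T_Yd_Yd (m := i) (n := a) (by omega)
      rw [add_comm i a] at this
      simp only [mul_assoc] at this ⊢
      rw [this]

lemma E_intertwine {T' : ℕ → A} (n : ℕ) (B : A) (h : ∀ i, i + 1 < n → T i * B = B * T' i) :
    E q T n * B = B * E q T' n := by
  induction n with
  | zero => simp
  | succ n ih =>
    obtain _ | n := n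
    · simp
    have h1 := ih fun i hi => h i (by omega)
    have h2 := h n (by omega)
    rw [E_two, E_two]
    simp only [smul_mul_assoc, sub_mul, mul_smul_comm, mul_sub]
    rw [h1, mul_assoc (E q T (n+1) * T n), h1, ← mul_assoc, mul_assoc (E q T (n+1)), h2, ← mul_assoc, h1]
    simp only [mul_assoc]

lemma HRel.E_Bs (h : HRel q T N) {a b : ℕ} (hN : a + b ≤ N) :
    E q T a * E q (sh a T) b * Bs T a b = Bs T a b * (E q T b * E q (sh b T) a) := by
  have h1 : E q T a * Bs T a b = Bs T a b * E q (sh b T) a :=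
    E_intertwine _ _ fun i hi => h.T_Bs_lo hN hi
  have h2 : E q (sh a T) b * Bs T a b = Bs T a b * E q T b :=
    E_intertwine _ _ fun i hi => h.T_Bs_hi hN hi
  have c : Commute (E q T b) (E q (sh b T) a) := by
    refine E_commute _ _ fun i hi => (E_commute _ _ fun j hj => (h.comm _ _ ?_).symm).symm
    omega
  rw [mul_assoc, h2, ← mul_assoc, h1, mul_assoc, ← c.eq]

end Hecke2
end HeckeTP

set_option linter.unusedSectionVars false
set_option linter.unusedSimpArgs false
namespace HeckeTP

section Hecke3
variable {K : Type*} [Field K] {A : Type*} [Ring A] [Algebra K A]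
variable {q : K} {T : ℕ → A} {L : ℕ → A} {N : ℕ}

/-- degenerate/affine Hecke type relations -/
structure Loc (q : K) (T L : ℕ → A) (M : ℕ) : Prop where
  rel : HRel q T M
  lrec : ∀ j, j + 1 < M → L (j+1) = q⁻¹ • (T j + T j * L j * T j)
  com : ∀ i j, i + 1 < M → j < M → j ≠ i → j ≠ i + 1 → Commute (T i) (L j)

def X (q : K) (L : ℕ → A) (j : ℕ) : A := 1 + (q - 1) • L j

lemma Loc.X_com (h : Loc q T L N) {i j : ℕ} (h1 : i + 1 < N) (h2 : j < N) (h3 : j ≠ i) (h4 : j ≠ i + 1) :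
    Commute (T i) (X q L j) :=
  (Commute.one_right _).add_right ((h.com i j h1 h2 h3 h4).smul_right _)

lemma Loc.X_succ (h : Loc q T L N) (hq0 : q ≠ 0) {j : ℕ} (hj : j + 1 < N) :
    q • X q L (j+1) = T j * X q L j * T j := by
  simp only [X, h.lrec j hj, mul_add, add_mul, mul_one, h.rel.quad, smul_add, smul_smul, mul_smul_comm, smul_mul_assoc]
  have : q * ((q - 1) * q⁻¹) = q - 1 := by field_simp
  rw [this]
  module

lemma Loc.X_T (h : Loc q T L N) (hq0 : q ≠ 0) {j : ℕ} (hj : j + 1 < N) :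
    X q L (j+1) * T j = (q-1) • X q L (j+1) + T j * X q L j := by
  apply smul_right_injective _ hq0
  simp only
  rw [← smul_mul_assoc, h.X_succ hq0 hj, smul_add, smul_comm, h.X_succ hq0 hj, mul_assoc _ (T j) (T j), h.rel.quad]
  simp only [mul_add, mul_smul_comm, mul_one]

/-- T_j X_j = q X_{j+1} T_j⁻¹ -/
lemma Loc.T_X (h : Loc q T L N) (hq0 : q ≠ 0) {j : ℕ} (hj : j + 1 < N) :
    T j * X q L j = q • (X q L (j+1) * Ti q T j) := by
  rw [← smul_mul_assoc, h.X_succ hq0 hj, mul_assoc _ (T j), h.rel.T_Ti hq0, mul_one]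

lemma Loc.L_succ (h : Loc q T L N) (hq0 : q ≠ 0) {j : ℕ} (hj : j + 1 < N) :
    L (j+1) = T j * L j * Ti q T j + q⁻¹ • (T j * X q L j) := by
  rw [h.lrec j hj, Ti, X]
  simp only [mul_smul_comm, mul_sub, mul_add, mul_one, smul_add, smul_sub]
  abel

lemma HRel.E_Ti (h : HRel q T N) (hq0 : q ≠ 0) (hq : ∀ k, 1 ≤ k → qi q k ≠ 0) {n : ℕ} (hn : n ≤ N) {j : ℕ} (hj : j + 1 < n) :
    E q T n * Ti q T j = - E q T n := by
  have := congrArg (· * Ti q T j) (h.E_T hq hn hj)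
  simp only [mul_assoc, h.T_Ti hq0, mul_one, neg_mul] at this
  exact (neg_eq_iff_eq_neg.mpr this).symm

lemma HRel.Ti_E (h : HRel q T N) (hq0 : q ≠ 0) (hq : ∀ k, 1 ≤ k → qi q k ≠ 0) {n : ℕ} (hn : n ≤ N) {j : ℕ} (hj : j + 1 < n) :
    Ti q T j * E q T n = - E q T n := by
  have := congrArg (Ti q T j * ·) (h.T_E hq hn hj)
  simp only [← mul_assoc, h.Ti_T hq0, one_mul, mul_neg] at this
  exact (neg_eq_iff_eq_neg.mpr this).symm

variable {τ : A →ₗ[K] K}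

lemma E_mem_cyc {n : ℕ} (hτ : ∀ i, i + 1 < n → T i ∈ cyc τ) : E q T n ∈ cyc τ := E_mem _ _ hτ

/-- within a block -/
lemma Loc.block (h : Loc q T L N) (hq0 : q ≠ 0) (hq : ∀ k, 1 ≤ k → qi q k ≠ 0)
    (hτ : ∀ i, i + 1 < N → T i ∈ cyc τ) {a : ℕ} (ha : a ≤ N) {Q : A}
    (hQ : ∀ i, i + 1 < a → Commute (T i) Q) {j : ℕ} (hj : j + 1 < a) :
    τ (L (j+1) * E q T a * Q) = q⁻¹ * (τ (L j * E q T a * Q) - τ (E q T a * Q)) := by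
  have e1 : T j * E q T a = - E q T a := h.rel.T_E hq ha hj
  have e2 : E q T a * T j = - E q T a := h.rel.E_T hq ha hj
  have e3 : E q T a * Q * T j = - (E q T a * Q) := by
    rw [mul_assoc, ← (hQ j hj).eq, ← mul_assoc, e2, neg_mul]
  have e4 : τ (T j * L j * E q T a * Q) = - τ (L j * E q T a * Q) := by
    rw [mul_assoc, mul_assoc, ← hτ j (by omega), mul_assoc, e3, mul_neg, map_neg, mul_assoc]
  rw [h.lrec j (by omega)]
  simp only [smul_mul_assoc, add_mul, map_smul, map_add]
  rw [e1, mul_assoc (T j * L j), e1, mul_neg, neg_mul, neg_mul, map_neg, map_neg, e4, smul_eq_mul]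
  ring

lemma Loc.blockX (h : Loc q T L N) (hq0 : q ≠ 0) (hq : ∀ k, 1 ≤ k → qi q k ≠ 0)
    (hτ : ∀ i, i + 1 < N → T i ∈ cyc τ) {a : ℕ} (ha : a ≤ N) {Q : A}
    (hQ : ∀ i, i + 1 < a → Commute (T i) Q) {j : ℕ} (hj : j + 1 < a) :
    τ (X q L (j+1) * E q T a * Q) = q⁻¹ * τ (X q L j * E q T a * Q) := by
  have := h.block hq0 hq hτ ha hQ hj
  simp only [X, add_mul, smul_mul_assoc, one_mul, map_add, map_smul, smul_eq_mul, this]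
  field_simp
  ring

lemma Loc.blockX' (h : Loc q T L N) (hq0 : q ≠ 0) (hq : ∀ k, 1 ≤ k → qi q k ≠ 0)
    (hτ : ∀ i, i + 1 < N → T i ∈ cyc τ) {a : ℕ} (ha : a ≤ N) {Q : A}
    (hQ : ∀ i, i + 1 < a → Commute (T i) Q) {j : ℕ} (hj : j < a) :
    τ (X q L j * E q T a * Q) = q⁻¹ ^ j * τ (X q L 0 * E q T a * Q) := by
  induction j with
  | zero => simp
  | succ j ih => rw [h.blockX hq0 hq hτ ha hQ hj, ih (by omega), pow_succ']; ring

/-- first expansion -/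
lemma Loc.exp1 (h : Loc q T L N) (hq0 : q ≠ 0) (hq : ∀ k, 1 ≤ k → qi q k ≠ 0)
    (hτ : ∀ i, i + 1 < N → T i ∈ cyc τ) {a : ℕ} (ha : a + 2 ≤ N) {Q : A}
    (hQ : ∀ i, i + 1 < a + 1 → Commute (T i) Q) :
    qi q (a+2) * τ (X q L (a+1) * E q T (a+2) * Q) = τ (X q L (a+1) * E q T (a+1) * Q)
      - qi q (a+1) * τ (T a * X q L a * E q T (a+1) * Q) := by
  set P := E q T (a+1) with hP
  have cX : Commute P (X q L (a+1)) := E_commute _ _ fun i hi => h.X_com (by omega) (by omega) (by omega) (by omega)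
  have cQ : Commute P Q := E_commute _ _ fun i hi => hQ i hi
  have iP : P * P = P := h.rel.E_idem hq (by omega)
  have tP : P ∈ cyc τ := E_mem_cyc fun i hi => hτ i (by omega)
  have e1 : qi q (a+2) * τ (X q L (a+1) * E q T (a+2) * Q) = τ (X q L (a+1) * (qi q (a+2) • E q T (a+2)) * Q) := by
    simp
  have e2 : τ (X q L (a+1) * (P * T a * P) * Q) = (q-1) * τ (X q L (a+1) * P * Q) + τ (T a * X q L a * P * Q) := by
    calc τ (X q L (a+1) * (P * T a * P) * Q) = τ (P * (X q L (a+1) * T a * P * Q)) := by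
          congr 1; simp only [← mul_assoc]; rw [cX.eq]
      _ = τ (X q L (a+1) * T a * (P * P) * Q) := by
          rw [← tP, mul_assoc _ Q P, ← cQ.eq]; simp only [mul_assoc]
      _ = _ := by
          rw [iP, h.X_T hq0 (by omega)]; simp only [add_mul, smul_mul_assoc, map_add, map_smul, smul_eq_mul]
  rw [e1, E_two' hq, ← hP, mul_sub, sub_mul, map_sub, mul_smul_comm, mul_smul_comm, smul_mul_assoc, smul_mul_assoc,
    map_smul, map_smul, e2, smul_eq_mul, smul_eq_mul]
  have := qi_mul q (a+1)
  linear_combination (-τ (X q L (a+1) * P * Q)) * this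

/-- second expansion, b = b'+1 -/
lemma Loc.exp2 (h : Loc q T L N) (hq0 : q ≠ 0) (hq : ∀ k, 1 ≤ k → qi q k ≠ 0)
    (hτ : ∀ i, i + 1 < N → T i ∈ cyc τ) {a b : ℕ} (ha : a + 2 + b ≤ N) :
    qi q (b+2) * τ (X q L a * E q T (a+1) * E q (sh a T) (b+2)) =
      q^(b+1) * τ (X q L a * E q T (a+1) * E q (sh (a+1) T) (b+1))
      - qi q (b+1) * τ (T a * X q L a * E q T (a+1) * E q (sh (a+1) T) (b+1)) := by
  set P := E q T (a+1) with hP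
  set Q := E q (sh (a+1) T) (b+1) with hQ
  have cX : Commute Q (X q L a) := E_commute _ _ fun i hi => h.X_com (by omega) (by omega) (by omega) (by omega)
  have cQ : Commute P Q := E_commute _ _ fun i hi => (E_commute _ _ fun j hj => (h.rel.comm _ _ (by omega)).symm).symm
  have hs := h.rel.shift (s := a+1) (M := b+1) (by omega)
  have iQ : Q * Q = Q := hs.E_idem hq (by omega)
  have tQ : Q ∈ cyc τ := E_mem_cyc fun i hi => hτ _ (by omega)
  have hs' := h.rel.shift (s := a) (M := b+2) (by omega)
  have e := hs'.E_left hq (n := b) le_rfl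
  rw [sh_sh, ← hQ] at e
  have e1 : qi q (b+2) * τ (X q L a * P * E q (sh a T) (b+2)) = τ (X q L a * P * (qi q (b+2) • E q (sh a T) (b+2))) := by
    simp
  have e2 : τ (X q L a * P * (Q * T a * Q)) = τ (T a * X q L a * P * Q) := by
    calc τ (X q L a * P * (Q * T a * Q)) = τ (Q * (X q L a * P * T a * Q)) := by
          congr 1; simp only [← mul_assoc]; rw [cX.eq, mul_assoc _ Q P, ← cQ.eq]; simp only [mul_assoc]
      _ = τ (X q L a * P * (T a * (Q * Q))) := by
          rw [← tQ]; simp only [mul_assoc]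
      _ = τ (T a * (Q * X q L a * P)) := by
        rw [iQ, ((cyc τ).mul_mem (hτ a (by omega)) tQ)]; simp only [mul_assoc]
      _ = _ := by
        rw [cX.eq, mul_assoc _ Q, ← cQ.eq]; simp only [mul_assoc]
  rw [e1, e, mul_sub, map_sub, mul_smul_comm, mul_smul_comm, map_smul, map_smul]
  rw [show sh a T 0 = T a from rfl, e2, smul_eq_mul, smul_eq_mul]

end Hecke3
end HeckeTP

set_option linter.unusedSectionVars false
set_option linter.unusedSimpArgs false
set_option linter.unusedVariables false
namespace HeckeTP

section Hecke4
variable {K : Type*} [Field K] {A : Type*} [Ring A] [Algebra K A]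
variable {q : K} {T : ℕ → A} {L : ℕ → A} {N : ℕ}
variable {τ : A →ₗ[K] K}

/-- auxiliary functional -/
noncomputable def Sh (q : K) (T L : ℕ → A) (τ : A →ₗ[K] K) (Z : A) : ℕ → K
  | 0 => 0
  | a+1 => τ (T a * X q L a * Z)

lemma Loc.exp1' (h : Loc q T L N) (hq0 : q ≠ 0) (hq : ∀ k, 1 ≤ k → qi q k ≠ 0)
    (hτ : ∀ i, i + 1 < N → T i ∈ cyc τ) {a : ℕ} (ha : a + 1 ≤ N) {Q : A}
    (hQ : ∀ i, i + 1 < a → Commute (T i) Q) :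
    qi q (a+1) * τ (X q L a * E q T (a+1) * Q) = τ (X q L a * E q T a * Q)
      - qi q a * Sh q T L τ (E q T a * Q) a := by
  obtain _ | a := a
  · simp
  · rw [h.exp1 hq0 hq hτ ha hQ, Sh, ← mul_assoc _ _ Q]

lemma Loc.exp2' (h : Loc q T L N) (hq0 : q ≠ 0) (hq : ∀ k, 1 ≤ k → qi q k ≠ 0)
    (hτ : ∀ i, i + 1 < N → T i ∈ cyc τ) {a b : ℕ} (ha : a + 1 + b ≤ N) :
    qi q (b+1) * τ (X q L a * E q T (a+1) * E q (sh a T) (b+1)) =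
      q^b * τ (X q L a * E q T (a+1) * E q (sh (a+1) T) b)
      - qi q b * Sh q T L τ (E q T (a+1) * E q (sh (a+1) T) b) (a+1) := by
  obtain _ | b := b
  · simp
  · rw [h.exp2 hq0 hq hτ (by omega), Sh, ← mul_assoc]

lemma Ti_intertwine {T' : ℕ → A} {i j : ℕ} {B : A} (h : T i * B = B * T' j) :
    Ti q T i * B = B * Ti q T' j := by
  simp only [Ti, smul_mul_assoc, sub_mul, one_mul, h, mul_smul_comm, mul_sub, mul_one]

lemma Loc.telC (h : Loc q T L N) (hq0 : q ≠ 0) {a : ℕ} (ha : a < N)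
    (hτ : ∀ i, i + 1 < N → T i ∈ cyc τ) {Z : A} (hZ1 : ∀ i, i + 1 < a → Ti q T i * Z = -Z)
    (hZ2 : ∀ i, i + 1 < a → Z * Ti q T i = -Z) (d : ℕ) : ∀ (m : ℕ), m + d + 1 = a →
    τ (Yd T m (d+1) * X q L m * Ydi q T (m+1) d * Z) = q^d * Sh q T L τ Z a := by
  induction d with
  | zero =>
    rintro m rfl
    simp [Yd, Ydi, Sh]
  | succ d ih =>
    intro m hm
    have e1 : Ti q T m * Yd T m (d+2) = Yd T m (d+2) * Ti q T (m+1) :=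
      Ti_intertwine (h.rel.T_Yd (by omega) (by omega) (by omega))
    have c1 : Commute (Ti q T (m+1)) (X q L m) := Ti_commute (h.X_com (by omega) (by omega) (by omega) (by omega))
    have c2 : Commute (Ydi q T (m+2) d) (T m) := Ydi_commute _ _ fun i h1 h2 => (h.rel.comm _ _ (by omega)).symm
    have c3 : Commute (Ydi q T (m+2) d) (X q L m) := Ydi_commute _ _ fun i h1 h2 => h.X_com (by omega) (by omega) (by omega) (by omega)
    have c4 : Commute (Ydi q T (m+2) d) (X q L (m+1)) := Ydi_commute _ _ fun i h1 h2 => h.X_com (by omega) (by omega) (by omega) (by omega)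
    have tm : Ti q T m ∈ cyc τ := Ti_mem _ (hτ m (by omega))
    calc τ (Yd T m (d+2) * X q L m * Ydi q T (m+1) (d+1) * Z)
        = τ (Yd T m (d+2) * (X q L m * Ti q T (m+1)) * Ydi q T (m+2) d * Z) := by
          rw [Ydi_succ_left]; simp only [mul_assoc]
      _ = τ (Ti q T m * (Yd T m (d+2) * X q L m * Ydi q T (m+2) d * Z)) := by
          rw [← c1.eq, ← mul_assoc, ← e1]; simp only [mul_assoc]
      _ = - τ (Yd T m (d+2) * X q L m * Ydi q T (m+2) d * Z) := by
          rw [← tm, mul_assoc _ Z, hZ2 m (by omega), mul_neg, map_neg]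
      _ = - τ (Yd T (m+1) (d+1) * Ydi q T (m+2) d * (T m * X q L m) * Z) := by
          rw [Yd_succ_left]
          congr 2
          calc Yd T (m+1) (d+1) * T m * X q L m * Ydi q T (m+2) d * Z
              = Yd T (m+1) (d+1) * (T m * (X q L m * Ydi q T (m+2) d)) * Z := by simp only [mul_assoc]
            _ = Yd T (m+1) (d+1) * ((T m * Ydi q T (m+2) d) * X q L m) * Z := by rw [← c3.eq]; simp only [mul_assoc]
            _ = _ := by rw [← c2.eq]; simp only [mul_assoc]
      _ = q * τ (Yd T (m+1) (d+1) * X q L (m+1) * Ydi q T (m+2) d * Z) := by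
          rw [h.T_X hq0 (by omega)]
          simp only [mul_smul_comm, smul_mul_assoc, map_smul, smul_eq_mul]
          rw [mul_assoc _ _ Z, mul_assoc _ _ Z, hZ1 m (by omega), mul_neg, mul_neg, map_neg, mul_neg, neg_neg,
            mul_assoc (Yd T (m+1) (d+1)), ← mul_assoc _ _ Z, c4.eq]
          simp only [mul_assoc]
      _ = _ := by rw [ih (m+1) (by omega)]; ring

lemma Loc.tel (h : Loc q T L N) (hq0 : q ≠ 0) {a : ℕ} (ha : a < N)
    (hτ : ∀ i, i + 1 < N → T i ∈ cyc τ) {Z : A} (hZ1 : ∀ i, i + 1 < a → Ti q T i * Z = -Z)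
    (hZ2 : ∀ i, i + 1 < a → Z * Ti q T i = -Z) (d : ℕ) : ∀ (m : ℕ), m + d = a →
    τ (L a * Z) = τ (Yd T m d * L m * Ydi q T m d * Z) + q⁻¹ * qi q d * Sh q T L τ Z a := by
  induction d with
  | zero =>
    rintro m rfl
    simp [Yd, Ydi]
  | succ d ih =>
    intro m hm
    rw [ih (m+1) (by omega), qi_succ]
    have := h.telC hq0 ha hτ hZ1 hZ2 d m (by omega)
    have e : Yd T (m+1) d * L (m+1) * Ydi q T (m+1) d * Z = Yd T m (d+1) * L m * Ydi q T m (d+1) * Z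
        + q⁻¹ • (Yd T m (d+1) * X q L m * Ydi q T (m+1) d * Z) := by
      rw [h.L_succ hq0 (by omega), Yd_succ_left, Ydi_succ_left]
      simp only [mul_add, add_mul, mul_smul_comm, smul_mul_assoc, mul_assoc]
    rw [e, map_add, map_smul, this, smul_eq_mul]
    ring

lemma Loc.Bs_L (h : Loc q T L N) (hq0 : q ≠ 0) {a b : ℕ} (hN : a + b + 1 ≤ N) :
    Bs T a (b+1) * L 0 * Bsi q T a (b+1) = Yd T 0 a * L 0 * Ydi q T 0 a := by
  induction b with
  | zero => simp [Bs, Bsi]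
  | succ b ih =>
    rw [← ih (by omega), Bs, Bsi]
    have c : Commute (Yd T (b+1) a) (L 0) := Yd_commute _ _ fun i h1 h2 => h.com _ _ (by omega) (by omega) (by omega) (by omega)
    calc Bs T a (b+1) * Yd T (b+1) a * L 0 * (Ydi q T (b+1) a * Bsi q T a (b+1))
        = Bs T a (b+1) * (Yd T (b+1) a * L 0) * Ydi q T (b+1) a * Bsi q T a (b+1) := by simp only [mul_assoc]
      _ = Bs T a (b+1) * L 0 * (Yd T (b+1) a * Ydi q T (b+1) a) * Bsi q T a (b+1) := by rw [c.eq]; simp only [mul_assoc]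
      _ = _ := by rw [h.rel.Yd_Ydi hq0, mul_one]

/-- swap for functionals -/
lemma HRel.swapτ (h : HRel q T N) (hq0 : q ≠ 0) (hτ : ∀ i, i + 1 < N → T i ∈ cyc τ) {a b : ℕ} (hN : a + b ≤ N)
    (z : A) :
    τ (Bs T a b * z * Bsi q T a b * (E q T a * E q (sh a T) b)) = τ (z * (E q T b * E q (sh b T) a)) := by
  have e : E q T a * E q (sh a T) b = Bs T a b * (E q T b * E q (sh b T) a) * Bsi q T a b := by
    rw [← h.E_Bs hN, mul_assoc _ (Bs T a b), h.Bs_Bsi hq0, mul_one]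
  have t : Bs T a b ∈ cyc τ := Bs_mem _ _ _ fun i hi => hτ i (by omega)
  calc _ = τ (Bs T a b * (z * (Bsi q T a b * Bs T a b) * (E q T b * E q (sh b T) a) * Bsi q T a b)) := by
        rw [e]; simp only [mul_assoc]
    _ = τ (z * (E q T b * E q (sh b T) a) * (Bsi q T a b * Bs T a b)) := by
        rw [← t, h.Bsi_Bs hq0, mul_one, mul_assoc _ (Bsi q T a b), h.Bsi_Bs hq0]
    _ = _ := by rw [h.Bsi_Bs hq0, mul_one]

lemma HRel.swapτ' (h : HRel q T N) (hq0 : q ≠ 0) (hτ : ∀ i, i + 1 < N → T i ∈ cyc τ) {a b : ℕ} (hN : a + b ≤ N)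
    (z : A) (hz : ∀ i, i + 1 < a + b → Commute (T i) z) :
    τ (z * (E q T a * E q (sh a T) b)) = τ (z * (E q T b * E q (sh b T) a)) := by
  rw [← h.swapτ hq0 hτ hN]
  have c : Commute (Bs T a b) z := mem_cent.1 (Bs_mem (K := K) _ _ _ fun i hi => mem_cent.2 (hz i hi))
  rw [c.eq, mul_assoc z, h.Bs_Bsi hq0, mul_one]

/-- The key local relation. -/
lemma Loc.key (h : Loc q T L N) (hq0 : q ≠ 0) (hq : ∀ k, 1 ≤ k → qi q k ≠ 0)
    (hτ : ∀ i, i + 1 < N → T i ∈ cyc τ) {a b : ℕ} (hN : a + b + 1 ≤ N) :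
    qi q⁻¹ (b+1) * (τ (L a * (E q T a * E q (sh a T) (b+1))) - τ (L 0 * (E q T (b+1) * E q (sh (b+1) T) a)))
    - qi q⁻¹ b * (τ (L (a+1) * (E q T (a+1) * E q (sh (a+1) T) b)) - τ (L 0 * (E q T b * E q (sh b T) (a+1)))) 
    = qi q⁻¹ (b+1) * τ (X q L 0 * (E q T (b+1) * E q (sh (b+1) T) a))
    - qi q⁻¹ (a+1) * τ (X q L 0 * (E q T (a+1) * E q (sh (a+1) T) b)) := by
  have comm : ∀ a b, a + b ≤ N → ∀ i, i + 1 < a → Commute (T i) (E q (sh a T) b) := fun a b hab i hi =>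
    (E_commute _ _ fun j hj => (h.rel.comm _ _ (by omega)).symm).symm
  -- R2
  have R2 : ∀ a b, a + b + 1 ≤ N → τ (L a * (E q T a * E q (sh a T) (b+1))) =
      τ (L 0 * (E q T (b+1) * E q (sh (b+1) T) a)) + q⁻¹ * qi q a * Sh q T L τ (E q T a * E q (sh a T) (b+1)) a := by
    intro a b hab
    have := h.tel (a := a) hq0 (by omega) hτ (Z := E q T a * E q (sh a T) (b+1))
      (fun i hi => by rw [← mul_assoc, h.rel.Ti_E hq0 hq (by omega) hi, neg_mul])
      (fun i hi => by
        have c := Ti_commute (q := q) (comm a (b+1) (by omega) i hi)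
        rw [mul_assoc, ← c.eq, ← mul_assoc, h.rel.E_Ti hq0 hq (by omega) hi, neg_mul]) a 0 (by omega)
    rw [this, ← h.Bs_L hq0 hab, h.rel.swapτ hq0 hτ (by omega)]
  have R1a := h.exp1' hq0 hq hτ (a := a) (by omega) (Q := E q (sh a T) (b+1)) (comm a (b+1) (by omega))
  have R1b := h.exp2' hq0 hq hτ (a := a) (b := b) (by omega)
  have bx := h.blockX' hq0 hq hτ (a := a+1) (by omega) (comm (a+1) b (by omega)) (j := a) (by omega)
  have r2 := R2 a b hN
  have r2' : qi q b * τ (L (a+1) * (E q T (a+1) * E q (sh (a+1) T) b)) =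
      qi q b * τ (L 0 * (E q T b * E q (sh b T) (a+1))) + qi q b * (q⁻¹ * qi q (a+1) * Sh q T L τ (E q T (a+1) * E q (sh (a+1) T) b) (a+1)) := by
    obtain _ | b := b
    · simp
    · rw [← mul_add, R2 (a+1) b (by omega)]
  have g : τ (E q T a * E q (sh a T) (b+1)) = τ (E q T (b+1) * E q (sh (b+1) T) a) := by
    have := h.rel.swapτ' hq0 hτ (a := a) (b := b+1) (by omega) 1 (fun i _ => Commute.one_right _)
    simpa using this
  have pq : ∀ n, q ^ n * qi q⁻¹ n = q * qi q n := by
    intro n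
    induction n with
    | zero => simp
    | succ n ih =>
      have : q ^ n * (q⁻¹) ^ n = 1 := by rw [← mul_pow, mul_inv_cancel₀ hq0, one_pow]
      rw [qi_succ, qi_succ, pow_succ, mul_add, mul_add]
      linear_combination q * ih + q * this + q * qi_mul q n
  have pq1 := pq a
  have pq2 := pq b
  have pq3 := pq (a+1)
  have pq4 := pq (b+1)
  rw [bx] at R1b
  have X0 : ∀ z, τ (X q L 0 * z) = τ z + (q-1) * τ (L 0 * z) := by intro z; simp [X, add_mul]
  have Xa : ∀ z, τ (X q L a * z) = τ z + (q-1) * τ (L a * z) := by intro z; simp [X, add_mul]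
  simp only [mul_assoc] at R1a R1b r2 r2' g ⊢
  simp only [X0] at R1a R1b r2 r2' g ⊢
  rw [Xa (E q T a * _), r2, g] at R1a
  rw [r2]
  have qa : q⁻¹ ^ a * q ^ a = 1 := by rw [← mul_pow, inv_mul_cancel₀ hq0, one_pow]
  have qq : q⁻¹ * q = 1 := inv_mul_cancel₀ hq0
  generalize τ (E q T (b+1) * E q (sh (b+1) T) a) = g0 at *
  generalize τ (E q T (a+1) * E q (sh (a+1) T) b) = g1 at *
  generalize τ (L 0 * (E q T (b+1) * E q (sh (b+1) T) a)) = u0 at *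
  generalize τ (L 0 * (E q T (a+1) * E q (sh (a+1) T) b)) = u1 at *
  generalize τ (L 0 * (E q T b * E q (sh b T) (a+1))) = u2 at *
  generalize τ (L (a+1) * (E q T (a+1) * E q (sh (a+1) T) b)) = w2 at *
  generalize Sh q T L τ (E q T a * E q (sh a T) (b+1)) a = S0 at *
  generalize Sh q T L τ (E q T (a+1) * E q (sh (a+1) T) b) (a+1) = S1 at *
  generalize τ (X q L a * (E q T (a+1) * E q (sh a T) (b+1))) = y at *
  have Ha : qi q⁻¹ (a+1) = q * qi q (a+1) * q⁻¹^(a+1) := by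
    rw [← pq3, mul_comm (q^_), mul_assoc, ← mul_pow, mul_inv_cancel₀ hq0, one_pow, mul_one]
  have Hb : qi q⁻¹ (b+1) = q * qi q (b+1) * q⁻¹^(b+1) := by
    rw [← pq4, mul_comm (q^_), mul_assoc, ← mul_pow, mul_inv_cancel₀ hq0, one_pow, mul_one]
  have Hb' : qi q⁻¹ b = q * qi q b * q⁻¹^b := by
    rw [← pq2, mul_comm (q^_), mul_assoc, ← mul_pow, mul_inv_cancel₀ hq0, one_pow, mul_one]
  rw [Ha, Hb, Hb']
  have main : qi q (b+1) * ((g0 + (q-1) * (u0 + q⁻¹ * (qi q a * S0))) - qi q a * S0) = 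
     qi q (a+1) * (q ^ b * (q⁻¹^a * (g1 + (q-1)*u1)) - qi q b * S1) := by
    rw [← R1b]
    have e : g0 + (q-1) * (u0 + q⁻¹ * (qi q a * S0)) - qi q a * S0 = qi q (a+1) * y := by
      rw [R1a]
    rw [e]; ring
  have qb : q⁻¹ ^ b * q ^ b = 1 := by rw [← mul_pow, inv_mul_cancel₀ hq0, one_pow]
  rw [pow_succ, pow_succ]
  generalize q⁻¹ ^ a = pa at *
  generalize q⁻¹ ^ b = pb at *
  generalize q⁻¹ = p at *
  generalize qi q a = A0 at *
  generalize qi q (a+1) = A1 at *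
  generalize qi q b = B0 at *
  generalize qi q (b+1) = B1 at *
  linear_combination (-pb) * main + (-q * pb) * r2' + (B1*pb*p*A0*S0 - pb*B0*A1*S1 -
    B1*pb*(g0 + (q-1)*u0) + A1*pa*(g1+(q-1)*u1) + pb*B1*A0*S0) * qq - (A1*pa*(g1+(q-1)*u1)) * qb

end Hecke4
end HeckeTP

set_option linter.unusedSectionVars false
set_option linter.unusedSimpArgs false
set_option linter.unusedVariables false
namespace HeckeTP

section Hecke5
variable {K : Type*} [Field K] {A : Type*} [Ring A] [Algebra K A]
variable {q : K} {T : ℕ → A} {N : ℕ}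
variable {τ : A →ₗ[K] K}

/-- Jucys-Murphy elements -/
noncomputable def JM (q : K) (T : ℕ → A) : ℕ → A
  | 0 => 0
  | k+1 => q⁻¹ • (T k + T k * JM q T k * T k)

lemma JM_commute_hi (h : HRel q T N) {i j : ℕ} (hij : i < j) : Commute (T j) (JM q T i) := by
  induction i with
  | zero => exact Commute.zero_right _
  | succ i ih =>
    have c : Commute (T j) (T i) := (h.comm i j (by omega)).symm
    exact ((c.add_right ((c.mul_right (ih (by omega))).mul_right c))).smul_right _

lemma JM_commute_lo (h : HRel q T N) (hq0 : q ≠ 0) {i j : ℕ} (hij : j + 2 ≤ i) (hi : i < N) : Commute (T j) (JM q T i) := by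
  induction i with
  | zero => omega
  | succ i ih =>
    rcases Nat.lt_or_ge (j+2) (i+1) with h1 | h1
    · have c : Commute (T j) (T i) := (h.comm j i (by omega))
      exact ((c.add_right ((c.mul_right (ih (by omega) (by omega))).mul_right c))).smul_right _
    · obtain rfl : i = j + 1 := by omega
      have c := JM_commute_hi h (i := j) (j := j+1) (by omega)
      have b := h.braid j (by omega)
      rw [JM, JM]
      apply Commute.smul_right
      set L := JM q T j
      set a := T j
      set d := T (j+1)
      have hqd : a * a = (q-1) • a + q • (1:A) := h.quad j
      have e3 : Commute a (d * (a * L * a) * d) := by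
        show a * (d * (a * L * a) * d) = d * (a * L * a) * d * a
        calc a * (d * (a * L * a) * d) = (a * d * a) * L * a * d := by simp only [mul_assoc]
          _ = d * a * (d * L) * a * d := by rw [b]; simp only [mul_assoc]
          _ = d * a * L * (d * a * d) := by rw [c.eq]; simp only [mul_assoc]
          _ = _ := by rw [← b]; simp only [mul_assoc]
      have e2 : Commute a (d + q⁻¹ • (d * a * d)) := by
        show a * (d + q⁻¹ • (d * a * d)) = (d + q⁻¹ • (d * a * d)) * a
        rw [← b]
        have h1 : a * (a * d * a) = (q-1) • (a * d * a) + q • (d * a) := by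
          rw [← mul_assoc, ← mul_assoc, hqd]; simp [add_mul, mul_assoc]
        have h2 : (a * d * a) * a = (q-1) • (a * d * a) + q • (a * d) := by
          rw [mul_assoc _ a a, hqd]; simp [mul_add, mul_assoc]
        rw [mul_add, add_mul, mul_smul_comm, smul_mul_assoc, h1, h2, smul_add, smul_add, smul_smul _ q, smul_smul _ q, inv_mul_cancel₀ hq0]
        module
      have : d + d * (q⁻¹ • (a + a * L * a)) * d = (d + q⁻¹ • (d * a * d)) + q⁻¹ • (d * (a * L * a) * d) := by
        simp only [mul_add, add_mul, smul_add, mul_smul_comm, smul_mul_assoc]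
        abel
      rw [this]
      exact e2.add_right (e3.smul_right _)

lemma JM_add_commute (h : HRel q T N) (hq0 : q ≠ 0) (j : ℕ) : Commute (T j) (JM q T j + JM q T (j+1)) := by
  show T j * (JM q T j + JM q T (j+1)) = (JM q T j + JM q T (j+1)) * T j
  rw [JM]
  set L := JM q T j
  have h1 : T j * (T j * L * T j) = (q-1) • (T j * L * T j) + q • (L * T j) := by
    rw [← mul_assoc, ← mul_assoc, h.quad]; simp [add_mul, mul_assoc]
  have h2 : (T j * L * T j) * T j = (q-1) • (T j * L * T j) + q • (T j * L) := by
    rw [mul_assoc _ (T j) (T j), h.quad]; simp [mul_add, mul_assoc]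
  simp only [mul_add, add_mul, mul_smul_comm, smul_mul_assoc, h1, h2, smul_add, smul_smul, inv_mul_cancel₀ hq0]
  module

/-- sum of JM elements -/
noncomputable def Zs (q : K) (T : ℕ → A) (k : ℕ) : A := ∑ i ∈ Finset.range k, JM q T i

lemma Zs_commute (h : HRel q T N) (hq0 : q ≠ 0) {j k : ℕ} (hj : j + 1 < k) (hk : k ≤ N) : Commute (T j) (Zs q T k) := by
  induction k with
  | zero => omega
  | succ k ih =>
    rcases Nat.lt_or_ge (j+1) k with h1 | h1
    · rw [Zs, Finset.sum_range_succ]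
      exact (ih h1 (by omega)).add_right (JM_commute_lo h hq0 (by omega) (by omega))
    · obtain rfl : k = j + 1 := by omega
      rw [Zs, Finset.sum_range_succ, Finset.sum_range_succ, add_assoc]
      refine Commute.add_right ?_ (JM_add_commute h hq0 j)
      exact Commute.sum_right _ _ _ fun i hi => JM_commute_hi h (Finset.mem_range.1 hi)

lemma HRel.loc (h : HRel q T N) (hq0 : q ≠ 0) {s M : ℕ} (hM : s + M ≤ N) : Loc q (sh s T) (sh s (JM q T)) M where
  rel := h.shift hM
  lrec j hj := by
    show JM q T (s + (j+1)) = _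
    rw [← add_assoc, JM]; rfl
  com i j hi hj h1 h2 := by
    rcases Nat.lt_or_ge j i with h3 | h3
    · exact JM_commute_hi h (by omega)
    · exact JM_commute_lo h hq0 (by omega) (by omega)

/-- product of antisymmetrizers over consecutive blocks -/
noncomputable def El (q : K) : (ℕ → A) → List ℕ → A
  | _, [] => 1
  | T, a :: l => E q T a * El q (sh a T) l

lemma El_cons (a : ℕ) (l : List ℕ) : El q T (a :: l) = E q T a * El q (sh a T) l := rfl
@[simp] lemma El_nil : El q T [] = 1 := rfl

lemma El_append (l1 l2 : List ℕ) : El q T (l1 ++ l2) = El q T l1 * El q (sh l1.sum T) l2 := by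
  induction l1 generalizing T with
  | nil => simp
  | cons a l ih => rw [List.cons_append, El_cons, El_cons, ih, sh_sh, List.sum_cons, mul_assoc]

lemma El_mem (S : Subalgebra K A) (l : List ℕ) (hT : ∀ i, i + 1 < l.sum → T i ∈ S) : El q T l ∈ S := by
  induction l generalizing T with
  | nil => exact S.one_mem
  | cons a l ih =>
    rw [List.sum_cons] at hT
    exact S.mul_mem (E_mem S a fun i hi => hT i (by omega)) (ih fun i hi => hT _ (by omega))

lemma El_commute (l : List ℕ) {y : A} (h : ∀ i, i + 1 < l.sum → Commute (T i) y) : Commute (El q T l) y :=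
  mem_cent.1 (El_mem (K := K) _ _ fun i hi => mem_cent.2 (h i hi))

lemma El_comm_El (h : HRel q T N) (l1 l2 : List ℕ) {s t : ℕ} (hst : s + l1.sum ≤ t) :
    Commute (El q (sh s T) l1) (El q (sh t T) l2) :=
  El_commute _ fun i hi => (El_commute _ fun j hj => (h.comm _ _ (by omega)).symm).symm

lemma HRel.permτ (hq0 : q ≠ 0) {l l' : List ℕ} (hl : l.Perm l') :
    ∀ {T : ℕ → A} {N : ℕ} (h : HRel q T N) (hN : l.sum ≤ N) (hτ : ∀ i, i + 1 < l.sum → T i ∈ cyc τ) (z : A)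
    (hz : ∀ i, i + 1 < l.sum → Commute (T i) z), τ (z * El q T l) = τ (z * El q T l') := by
  induction hl with
  | nil => intros; rfl
  | cons a hl ih =>
    intro T N h hN hτ z hz
    rw [List.sum_cons] at hN hτ hz
    rw [El_cons, El_cons, ← mul_assoc, ← mul_assoc]
    refine ih (h.shift (s := a) hN) le_rfl (fun i hi => hτ _ (by omega)) _ (fun i hi => ?_)
    refine (hz _ (by omega)).mul_right (E_commute _ _ fun j hj => h.comm _ _ (by omega)).symm
  | swap b a l =>
    intro T N h hN hτ z hz
    rw [List.sum_cons, List.sum_cons] at hN hτ hz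
    simp only [El_cons, sh_sh]
    rw [add_comm b a]
    have comm : ∀ a b, Commute (E q T a * E q (sh a T) b) (El q (sh (a+b) T) l) := fun a b =>
      Commute.mul_left
        (E_commute _ _ fun i hi => (El_commute _ fun j hj => (h.comm _ _ (by omega)).symm).symm)
        (E_commute _ _ fun i hi => (El_commute _ fun j hj => (h.comm _ _ (by omega)).symm).symm)
    have c1 := comm a b
    have c2 := comm b a
    rw [add_comm b a] at c2
    rw [← mul_assoc (E q T a), ← mul_assoc (E q T b), c1.eq, c2.eq, ← mul_assoc z, ← mul_assoc z]
    have h' := h.mono (M := a + b) (by omega)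
    refine (h'.swapτ' hq0 (fun i hi => hτ i (by omega)) le_rfl _ (fun i hi => ?_))
    exact (hz i (by omega)).mul_right (El_commute _ fun j hj => (h.comm _ _ (by omega)).symm).symm
  | trans h1 h2 ih1 ih2 =>
    intro T N h hN hτ z hz
    rw [ih1 h hN hτ z hz]
    have := h1.sum_eq
    rw [this] at hN hτ hz
    exact ih2 h hN hτ z hz

/-- g -/
noncomputable def gl (q : K) (T : ℕ → A) (τ : A →ₗ[K] K) (l : List ℕ) : K := τ (El q T l)
/-- u -/
noncomputable def ul (q : K) (T : ℕ → A) (τ : A →ₗ[K] K) (l1 : List ℕ) (a : ℕ) (l2 : List ℕ) : K :=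
  τ (JM q T l1.sum * El q T (l1 ++ a :: l2))
noncomputable def utl (q : K) (T : ℕ → A) (τ : A →ₗ[K] K) (l1 : List ℕ) (a : ℕ) (l2 : List ℕ) : K :=
  (q - 1) * ul q T τ l1 a l2 + gl q T τ (l1 ++ a :: l2)

lemma HRel.gl_perm (h : HRel q T N) (hq0 : q ≠ 0) {l l' : List ℕ} (hl : l.Perm l') (hN : l.sum ≤ N)
    (hτ : ∀ i, i + 1 < l.sum → T i ∈ cyc τ) : gl q T τ l = gl q T τ l' := by
  have := HRel.permτ hq0 hl h hN hτ 1 (fun i _ => Commute.one_right _)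
  simpa [gl] using this

lemma HRel.ul_perm (h : HRel q T N) (hq0 : q ≠ 0) {l1 l1' l2 l2' : List ℕ} {a : ℕ} (ha : 1 ≤ a)
    (hl1 : l1.Perm l1') (hl2 : l2.Perm l2') (hN : (l1 ++ a :: l2).sum ≤ N)
    (hτ : ∀ i, i + 1 < (l1 ++ a :: l2).sum → T i ∈ cyc τ) : ul q T τ l1 a l2 = ul q T τ l1' a l2' := by
  rw [List.sum_append, List.sum_cons] at hN hτ
  unfold ul
  have s1 := hl1.sum_eq
  have s2 := hl2.sum_eq
  have e : ∀ l, Commute (El q T l1) (El q (sh l1.sum T) l) := fun l => by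
    simpa using El_comm_El (q := q) h l1 l (s := 0) (t := l1.sum) (by omega)
  have e' : ∀ l, Commute (El q T l1') (El q (sh l1'.sum T) l) := fun l => by
    simpa using El_comm_El (q := q) h l1' l (s := 0) (t := l1'.sum) (by omega)
  rw [El_append, El_append, (e _).eq, (e' _).eq, ← mul_assoc, ← mul_assoc]
  rw [HRel.permτ hq0 hl1 h (by omega) (fun i hi => hτ i (by omega)) _ (fun i hi => ?_), ← s1]
  · rw [mul_assoc, mul_assoc]
    have f := e' (a :: l2)
    have f' := e' (a :: l2')
    rw [← s1] at f f'
    rw [← f.eq, ← f'.eq, El_cons, El_cons, sh_sh, ← mul_assoc, ← mul_assoc, ← mul_assoc, ← mul_assoc]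
    refine HRel.permτ hq0 hl2 (h.shift (s := l1.sum + a) (M := l2.sum) (by omega)) le_rfl (fun i hi => hτ _ (by omega)) _ (fun i hi => ?_)
    refine Commute.mul_right (Commute.mul_right ?_ ?_) ?_
    · exact JM_commute_hi h (by omega)
    · exact (El_commute _ fun j hj => h.comm _ _ (by omega)).symm
    · exact (E_commute _ _ fun j hj => h.comm _ _ (by omega)).symm
  · refine Commute.mul_right ?_ ?_
    · exact JM_commute_lo h hq0 (by omega) (by omega)
    · exact (El_commute _ fun j hj => (h.comm _ _ (by omega)).symm).symm

lemma ul_zero_left (l1 l2 : List ℕ) (a : ℕ) : ul q T τ (l1 ++ [0]) a l2 = ul q T τ l1 a (0 :: l2) := by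
  unfold ul
  simp [El_append, El_cons, sh_sh]

lemma HRel.key_ul (h : HRel q T N) (hq0 : q ≠ 0) (hq : ∀ k, 1 ≤ k → qi q k ≠ 0) {l1 l2 : List ℕ} {a b : ℕ}
    (hN : l1.sum + (a + b + 1) + l2.sum ≤ N)
    (hτ : ∀ i, i + 1 < l1.sum + (a + b + 1) + l2.sum → T i ∈ cyc τ) :
    qi q⁻¹ (b+1) * (ul q T τ (l1 ++ [a]) (b+1) l2 - ul q T τ l1 (b+1) (a :: l2))
    - qi q⁻¹ b * (ul q T τ (l1 ++ [a+1]) b l2 - ul q T τ l1 b ((a+1) :: l2))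
    = qi q⁻¹ (b+1) * utl q T τ l1 (b+1) (a :: l2) - qi q⁻¹ (a+1) * utl q T τ l1 (a+1) (b :: l2) := by
  set s := l1.sum with hs
  set C := El q T l1 * El q (sh (s + (a+b+1)) T) l2 with hC
  have cT : ∀ i, i + 1 < a + b + 1 → Commute (sh s T i) C := fun i hi => by
    refine Commute.mul_right ?_ ?_
    · exact (El_commute _ fun j hj => h.comm _ _ (by omega)).symm
    · exact (El_commute _ fun j hj => (h.comm _ _ (by omega)).symm).symm
  have key := (h.loc hq0 (s := s) (M := a+b+1) (by omega)).key (τ := τ ∘ₗ LinearMap.mulRight K C) hq0 hq (fun i hi => ?_)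
    (a := a) (b := b) le_rfl
  · simp only [LinearMap.comp_apply, LinearMap.mulRight_apply, X, add_mul, one_mul, smul_mul_assoc, map_add, map_smul, smul_eq_mul] at key
    have main : ∀ (z : A) (x y : ℕ), x + y = a + b + 1 →
        z * (E q (sh s T) x * E q (sh x (sh s T)) y) * C = z * El q T (l1 ++ x :: y :: l2) := by
      intro z x y hxy
      rw [El_append, El_cons, El_cons, sh_sh, sh_sh, hC, ← hxy, mul_assoc, mul_assoc]
      have c : Commute (E q (sh s T) x * E q (sh (s+x) T) y) (El q T l1) :=
        Commute.mul_left
          (E_commute _ _ fun i hi => (El_commute _ fun j hj => (h.comm _ _ (by omega))).symm)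
          (E_commute _ _ fun i hi => (El_commute _ fun j hj => (h.comm _ _ (by omega))).symm)
      have c' := c.eq
      simp only [← mul_assoc] at c' ⊢
      rw [mul_assoc z, mul_assoc z, c']
      simp only [mul_assoc, ← hs, add_assoc]
    have main1 : ∀ (x y : ℕ), x + y = a + b + 1 →
        (E q (sh s T) x * E q (sh x (sh s T)) y) * C = El q T (l1 ++ x :: y :: l2) := fun x y hxy => by
      have := main 1 x y hxy
      simpa using this
    rw [main _ _ _ (by omega), main _ _ _ (by omega), main _ _ _ (by omega), main _ _ _ (by omega), main _ _ _ (by omega),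
      main1 _ _ (by omega), main1 _ _ (by omega)] at key
    simp only [ul, utl, gl, List.append_assoc, List.cons_append, List.nil_append, List.sum_append, List.sum_cons, List.sum_nil, add_zero]
    simp only [sh, add_zero, ← hs] at key ⊢
    rw [key]; ring
  · intro x
    simp only [LinearMap.comp_apply, LinearMap.mulRight_apply]
    rw [mul_assoc, (cT i hi).eq, ← mul_assoc]
    exact (hτ (s+i) (by omega) _).trans (by rw [← mul_assoc]; rfl)

/-- block contributions -/
lemma HRel.block_ul (h : HRel q T N) (hq0 : q ≠ 0) (hq : ∀ k, 1 ≤ k → qi q k ≠ 0) {l1 l2 : List ℕ} {a : ℕ}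
    (hN : l1.sum + a + l2.sum ≤ N)
    (hτ : ∀ i, i + 1 < l1.sum + a + l2.sum → T i ∈ cyc τ) {i : ℕ} (hi : i < a) :
    τ (JM q T (l1.sum + i) * El q T (l1 ++ a :: l2)) =
      q⁻¹ ^ i * ul q T τ l1 a l2 - q⁻¹ * qi q⁻¹ i * gl q T τ (l1 ++ a :: l2) := by
  induction i with
  | zero => simp [ul]
  | succ i ih =>
    have ih := ih (by omega)
    set s := l1.sum with hs
    have key := (h.loc hq0 (s := s) (M := a + l2.sum) (by omega)).block
      (τ := τ ∘ₗ LinearMap.mulRight K (El q T l1)) hq0 hq (fun j hj => ?_) (a := a) (by omega)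
      (Q := El q (sh (s+a) T) l2) (fun j hj => (El_commute _ fun k hk => (h.comm _ _ (by omega)).symm).symm) (j := i) (by omega)
    · have c : Commute (E q (sh s T) a * El q (sh (s+a) T) l2) (El q T l1) :=
        Commute.mul_left
          (E_commute _ _ fun i hi => (El_commute _ fun j hj => (h.comm _ _ (by omega))).symm)
          (El_commute _ fun i hi => (El_commute _ fun j hj => (h.comm _ _ (by omega))).symm)
      have e : El q T (l1 ++ a :: l2) = (E q (sh s T) a * El q (sh (s+a) T) l2) * El q T l1 := by
        rw [c.eq, El_append, El_cons, sh_sh]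
      simp only [LinearMap.comp_apply, LinearMap.mulRight_apply] at key
      rw [mul_assoc (sh s (JM q T) _), mul_assoc (sh s (JM q T) _), mul_assoc (sh s (JM q T) _), mul_assoc (sh s (JM q T) _), ← e] at key
      have k2 : τ (JM q T (s + (i+1)) * El q T (l1 ++ a :: l2)) = _ := key
      rw [k2]
      show q⁻¹ * (τ (JM q T (s + i) * El q T (l1 ++ a :: l2)) - _) = _
      rw [ih, qi_succ', pow_succ', gl]
      ring
    · intro x
      have c : Commute (sh s T j) (El q T l1) := (El_commute _ fun k hk => (h.comm _ _ (by omega))).symm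
      simp only [LinearMap.comp_apply, LinearMap.mulRight_apply]
      rw [mul_assoc, c.eq, ← mul_assoc]
      exact (hτ (s+j) (by omega) _).trans (by rw [← mul_assoc]; rfl)

lemma HRel.Zs_ul (h : HRel q T N) (hq0 : q ≠ 0) (hq : ∀ k, 1 ≤ k → qi q k ≠ 0) {l1 l2 : List ℕ} {a : ℕ}
    (hN : l1.sum + a + l2.sum ≤ N)
    (hτ : ∀ i, i + 1 < l1.sum + a + l2.sum → T i ∈ cyc τ) :
    τ (Zs q T (l1.sum + a) * El q T (l1 ++ a :: l2)) = τ (Zs q T l1.sum * El q T (l1 ++ a :: l2))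
      + qi q⁻¹ a * ul q T τ l1 a l2 - q⁻¹ * (∑ i ∈ Finset.range a, qi q⁻¹ i) * gl q T τ (l1 ++ a :: l2) := by
  have e : Zs q T (l1.sum + a) = Zs q T l1.sum + ∑ i ∈ Finset.range a, JM q T (l1.sum + i) := by
    rw [Zs, Finset.sum_range_add, Zs]
  rw [e, add_mul, map_add, Finset.sum_mul, map_sum, Finset.sum_congr rfl (fun i hi => h.block_ul hq0 hq hN hτ (Finset.mem_range.1 hi)),
    Finset.sum_sub_distrib, ← Finset.sum_mul, ← Finset.sum_mul, ← Finset.mul_sum]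
  rw [qi]; ring

end Hecke5
end HeckeTP

set_option linter.unusedSectionVars false
set_option linter.unusedSimpArgs false
set_option linter.unusedVariables false
namespace HeckeTP

section Hecke6
variable {K : Type*} [Field K] {A : Type*} [Ring A] [Algebra K A]
variable {q : K} {T : ℕ → A} {N : ℕ}
variable {τ : A →ₗ[K] K}

lemma HRel.Zs_perm (h : HRel q T N) (hq0 : q ≠ 0) {l1 l1' l2 l2' : List ℕ}
    (hl1 : l1.Perm l1') (hl2 : l2.Perm l2') (hN : (l1 ++ l2).sum ≤ N)
    (hτ : ∀ i, i + 1 < (l1 ++ l2).sum → T i ∈ cyc τ) :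
    τ (Zs q T l1.sum * El q T (l1 ++ l2)) = τ (Zs q T l1.sum * El q T (l1' ++ l2')) := by
  rw [List.sum_append] at hN hτ
  have s1 := hl1.sum_eq
  have s2 := hl2.sum_eq
  have e : ∀ l, Commute (El q T l1) (El q (sh l1.sum T) l) := fun l => by
    simpa using El_comm_El (q := q) h l1 l (s := 0) (t := l1.sum) (by omega)
  have e' : ∀ l, Commute (El q T l1') (El q (sh l1'.sum T) l) := fun l => by
    simpa using El_comm_El (q := q) h l1' l (s := 0) (t := l1'.sum) (by omega)
  rw [El_append, El_append, (e _).eq, (e' _).eq, ← mul_assoc, ← mul_assoc]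
  rw [HRel.permτ hq0 hl1 h (by omega) (fun i hi => hτ i (by omega)) _ (fun i hi => ?_), ← s1]
  · rw [mul_assoc, mul_assoc]
    have f := e' l2
    have f' := e' l2'
    rw [← s1] at f f'
    rw [← f.eq, ← f'.eq, ← mul_assoc, ← mul_assoc]
    refine HRel.permτ hq0 hl2 (h.shift (s := l1.sum) (M := l2.sum) (by omega)) le_rfl (fun i hi => hτ _ (by omega)) _ (fun i hi => ?_)
    refine Commute.mul_right ?_ ?_
    · exact Commute.sum_right _ _ _ fun j hj => JM_commute_hi h (by have := Finset.mem_range.1 hj; omega)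
    · exact (El_commute _ fun j hj => h.comm _ _ (by omega)).symm
  · refine Commute.mul_right ?_ ?_
    · exact Zs_commute h hq0 hi (by omega)
    · exact (El_commute _ fun j hj => (h.comm _ _ (by omega)).symm).symm

variable {ι : Type*} [Fintype ι] [DecidableEq ι]

noncomputable def tl (I : Finset ι) (α : ι → ℕ) : List ℕ := I.toList.map α

lemma tl_sum (I : Finset ι) (α : ι → ℕ) : (tl I α).sum = ∑ i ∈ I, α i := by
  rw [tl, Finset.sum_map_toList]

lemma tl_insert {I : Finset ι} {i : ι} (hi : i ∉ I) (α : ι → ℕ) : (tl (insert i I) α).Perm (α i :: tl I α) :=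
  (Finset.toList_insert hi).map α

lemma tl_insert' {I : Finset ι} {i : ι} (hi : i ∉ I) (α : ι → ℕ) : (tl (insert i I) α).Perm (tl I α ++ [α i]) :=
  (tl_insert hi α).trans (List.perm_append_singleton _ _).symm

lemma tl_congr {I : Finset ι} {α β : ι → ℕ} (h : ∀ i ∈ I, α i = β i) : tl I α = tl I β :=
  List.map_congr_left fun i hi => h i (Finset.mem_toList.1 hi)

lemma tl_compl {I : Finset ι} {i : ι} (hi : i ∉ I) (α : ι → ℕ) : (tl Iᶜ α).Perm (α i :: tl (insert i I)ᶜ α) := by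
  have : Iᶜ = insert i (insert i I)ᶜ := by
    ext x; by_cases hx : x = i <;> simp [hx, hi]
  rw [this]
  exact tl_insert (by simp) α

noncomputable def gI (q : K) (T : ℕ → A) (τ : A →ₗ[K] K) (α : ι → ℕ) : K := gl q T τ (tl Finset.univ α)
noncomputable def uI (q : K) (T : ℕ → A) (τ : A →ₗ[K] K) (I : Finset ι) (j : ι) (α : ι → ℕ) : K :=
  ul q T τ (tl I α) (α j) (tl (insert j I)ᶜ α)
noncomputable def zI (q : K) (T : ℕ → A) (τ : A →ₗ[K] K) (I : Finset ι) (α : ι → ℕ) : K :=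
  τ (Zs q T (tl I α).sum * El q T (tl I α ++ tl Iᶜ α))
noncomputable def utI (q : K) (T : ℕ → A) (τ : A →ₗ[K] K) (I : Finset ι) (j : ι) (α : ι → ℕ) : K :=
  (q - 1) * uI q T τ I j α + gI q T τ α

variable {k : ℕ}

lemma sum_split {I : Finset ι} {j : ι} (hj : j ∉ I) (α : ι → ℕ) :
    (tl I α).sum + α j + (tl (insert j I)ᶜ α).sum = ∑ i, α i := by
  simp only [tl_sum]
  rw [← Finset.sum_add_sum_compl (insert j I), Finset.sum_insert hj]; ring

lemma sum_split2 {I : Finset ι} {i j : ι} (hi : i ∉ I) (hj : j ∉ I) (hij : i ≠ j) (α : ι → ℕ) :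
    (tl I α).sum + (α i + α j) + (tl (insert i (insert j I))ᶜ α).sum = ∑ i, α i := by
  simp only [tl_sum]
  rw [← Finset.sum_add_sum_compl (insert i (insert j I)), Finset.sum_insert (by simp [hi, hij]), Finset.sum_insert hj]; ring

lemma HRel.uI_ins (h : HRel q T N) (hq0 : q ≠ 0) (hk : k ≤ N) (hτ : ∀ i, i + 1 < k → T i ∈ cyc τ)
    {I : Finset ι} {i j : ι} (hi : i ∉ I) (hj : j ∉ I) (hij : i ≠ j) {α : ι → ℕ} (hα : ∑ i, α i = k) (h1 : 1 ≤ α j) :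
    uI q T τ (insert i I) j α = ul q T τ (tl I α ++ [α i]) (α j) (tl (insert i (insert j I))ᶜ α) := by
  have := sum_split (I := insert i I) (j := j) (by simp [hj, hij.symm]) α
  rw [uI, h.ul_perm hq0 h1 (tl_insert' hi α) (List.Perm.refl _), Finset.insert_comm]
  · simp only [List.sum_append, List.sum_cons]; omega
  · intro m hm; simp only [List.sum_append, List.sum_cons] at hm; exact hτ m (by omega)

lemma HRel.uI_not (h : HRel q T N) (hq0 : q ≠ 0) (hk : k ≤ N) (hτ : ∀ i, i + 1 < k → T i ∈ cyc τ)
    {I : Finset ι} {i j : ι} (hi : i ∉ I) (hj : j ∉ I) (hij : i ≠ j) {α : ι → ℕ} (hα : ∑ i, α i = k) (h1 : 1 ≤ α j) :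
    uI q T τ I j α = ul q T τ (tl I α) (α j) (α i :: tl (insert i (insert j I))ᶜ α) := by
  have := sum_split hj α
  rw [uI, h.ul_perm hq0 h1 (List.Perm.refl _) (tl_compl (i := i) (by simp [hi, hij]) α)]
  · simp only [List.sum_append, List.sum_cons]; omega
  · intro m hm; simp only [List.sum_append, List.sum_cons] at hm; exact hτ m (by omega)

lemma HRel.gI_not (h : HRel q T N) (hq0 : q ≠ 0) (hk : k ≤ N) (hτ : ∀ i, i + 1 < k → T i ∈ cyc τ)
    {I : Finset ι} {j : ι} (hj : j ∉ I) {α : ι → ℕ} (hα : ∑ i, α i = k) :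
    gI q T τ α = gl q T τ (tl I α ++ α j :: tl (insert j I)ᶜ α) := by
  symm
  have := sum_split hj α
  apply h.gl_perm hq0
  · refine (List.Perm.append_left _ (tl_compl hj α).symm).trans ?_
    rw [tl, tl, ← List.map_append, tl]
    refine List.Perm.map _ ?_
    rw [List.perm_ext_iff_of_nodup]
    · simp; tauto
    · rw [List.nodup_append]
      refine ⟨Finset.nodup_toList _, Finset.nodup_toList _, ?_⟩
      intro a ha b hb hab
      simp at ha hb; subst hab; exact hb ha
    · exact Finset.nodup_toList _
  · simp only [List.sum_append, List.sum_cons]; omega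
  · intro m hm; simp only [List.sum_append, List.sum_cons] at hm; exact hτ m (by omega)

lemma HRel.key_uI (h : HRel q T N) (hq0 : q ≠ 0) (hq : ∀ k, 1 ≤ k → qi q k ≠ 0) (hk : k ≤ N)
    (hτ : ∀ i, i + 1 < k → T i ∈ cyc τ)
    {I : Finset ι} {i j : ι} (hi : i ∉ I) (hj : j ∉ I) (hij : i ≠ j) {α β : ι → ℕ} (hα : ∑ i, α i = k)
    (hi1 : β i = α i + 1) (hj1 : α j = β j + 1) (hαβ : ∀ m, m ≠ i → m ≠ j → α m = β m) :
    qi q⁻¹ (α j) * (uI q T τ (insert i I) j α - uI q T τ I j α)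
    - qi q⁻¹ (β j) * (uI q T τ (insert i I) j β - uI q T τ I j β)
    = qi q⁻¹ (α j) * utI q T τ I j α - qi q⁻¹ (β i) * utI q T τ I i β := by
  have sα := sum_split2 hi hj hij α
  have sβ := sum_split2 hi hj hij β
  have t1 : tl I α = tl I β := tl_congr fun m hm => hαβ m (by rintro rfl; exact hi hm) (by rintro rfl; exact hj hm)
  have t2 : tl (insert i (insert j I))ᶜ α = tl (insert i (insert j I))ᶜ β := tl_congr fun m hm => by
    simp at hm; exact hαβ m hm.1 hm.2.1
  have hβ : ∑ i, β i = k := by rw [← sβ, ← t1, ← t2]; omega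
  have e1 := h.uI_ins hq0 hk hτ hi hj hij hα (by omega)
  have e2 := h.uI_not hq0 hk hτ hi hj hij hα (by omega)
  have e3 : qi q⁻¹ (β j) * uI q T τ (insert i I) j β = qi q⁻¹ (β j) * ul q T τ (tl I β ++ [β i]) (β j) (tl (insert i (insert j I))ᶜ β) := by
    rcases Nat.eq_zero_or_pos (β j) with h0 | h0
    · simp [h0]
    · rw [h.uI_ins hq0 hk hτ hi hj hij hβ h0]
  have e4 : qi q⁻¹ (β j) * uI q T τ I j β = qi q⁻¹ (β j) * ul q T τ (tl I β) (β j) (β i :: tl (insert i (insert j I))ᶜ β) := by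
    rcases Nat.eq_zero_or_pos (β j) with h0 | h0
    · simp [h0]
    · rw [h.uI_not hq0 hk hτ hi hj hij hβ h0]
  have e5 := h.uI_not hq0 hk hτ hj hi hij.symm hβ (by omega)
  rw [Finset.insert_comm] at e5
  have p1 : gI q T τ α = gl q T τ (tl I α ++ α j :: α i :: tl (insert i (insert j I))ᶜ α) := by
    rw [h.gI_not hq0 hk hτ hj hα]
    apply h.gl_perm hq0
    · exact List.Perm.append_left _ (List.Perm.cons _ (tl_compl (by simp [hi, hij]) α))
    · have := sum_split hj α; simp only [List.sum_append, List.sum_cons]; omega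
    · have := sum_split hj α; intro m hm; simp only [List.sum_append, List.sum_cons] at hm; exact hτ m (by omega)
  have p2 : gI q T τ β = gl q T τ (tl I β ++ β i :: β j :: tl (insert i (insert j I))ᶜ β) := by
    rw [h.gI_not hq0 hk hτ hi hβ]
    apply h.gl_perm hq0
    · rw [Finset.insert_comm]
      exact List.Perm.append_left _ (List.Perm.cons _ (tl_compl (by simp [hj, hij.symm]) β))
    · have := sum_split hi β; simp only [List.sum_append, List.sum_cons]; omega
    · have := sum_split hi β; intro m hm; simp only [List.sum_append, List.sum_cons] at hm; exact hτ m (by omega)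
  have key := h.key_ul hq0 hq (τ := τ) (l1 := tl I α) (l2 := tl (insert i (insert j I))ᶜ α) (a := α i) (b := β j)
    (by omega) (fun m hm => hτ m (by omega))
  rw [mul_sub (qi q⁻¹ (β j)), e3, e4, utI, utI, e1, e2, e5, p1, p2, ← t1, ← t2, hi1, ← mul_sub, hj1]
  rw [utl, utl] at key
  exact key

lemma HRel.uI_zero (h : HRel q T N) (hq0 : q ≠ 0) (hk : k ≤ N) (hτ : ∀ i, i + 1 < k → T i ∈ cyc τ)
    {I : Finset ι} {i j : ι} (hi : i ∉ I) (hj : j ∉ I) (hij : i ≠ j) {α : ι → ℕ} (hα : ∑ i, α i = k) (h0 : α i = 0) :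
    qi q⁻¹ (α j) * uI q T τ (insert i I) j α = qi q⁻¹ (α j) * uI q T τ I j α := by
  rcases Nat.eq_zero_or_pos (α j) with h1 | h1
  · simp [h1]
  · rw [h.uI_ins hq0 hk hτ hi hj hij hα h1, h.uI_not hq0 hk hτ hi hj hij hα h1, h0, ul_zero_left]

lemma uI_empty (j : ι) (α : ι → ℕ) : uI q T τ ∅ j α = 0 := by
  simp [uI, ul, tl, JM]

lemma zI_empty (α : ι → ℕ) : zI q T τ ∅ α = 0 := by
  simp [zI, tl, Zs]

lemma zI_univ (α : ι → ℕ) : zI q T τ Finset.univ α = τ (Zs q T (∑ i, α i) * El q T (tl Finset.univ α)) := by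
  rw [zI, tl_sum]; simp [tl]

lemma HRel.zI_insert (h : HRel q T N) (hq0 : q ≠ 0) (hq : ∀ k, 1 ≤ k → qi q k ≠ 0) (hk : k ≤ N)
    (hτ : ∀ i, i + 1 < k → T i ∈ cyc τ) {I : Finset ι} {j : ι} (hj : j ∉ I) {α : ι → ℕ} (hα : ∑ i, α i = k) :
    zI q T τ (insert j I) α = zI q T τ I α + qi q⁻¹ (α j) * uI q T τ I j α
      - q⁻¹ * (∑ i ∈ Finset.range (α j), qi q⁻¹ i) * gI q T τ α := by
  have s := sum_split hj α
  have e1 : zI q T τ (insert j I) α = τ (Zs q T ((tl I α).sum + α j) * El q T (tl I α ++ α j :: tl (insert j I)ᶜ α)) := by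
    have s' : (tl (insert j I) α).sum = (tl I α).sum + α j := by
      rw [tl_sum, tl_sum, Finset.sum_insert hj, add_comm]
    rw [zI, h.Zs_perm hq0 (tl_insert' hj α) (List.Perm.refl _), s']
    · simp
    · simp only [List.sum_append, List.sum_cons]; omega
    · intro m hm; simp only [List.sum_append, List.sum_cons] at hm; exact hτ m (by omega)
  have e2 : zI q T τ I α = τ (Zs q T (tl I α).sum * El q T (tl I α ++ α j :: tl (insert j I)ᶜ α)) := by
    have s' : (tl Iᶜ α).sum = α j + (tl (insert j I)ᶜ α).sum := by
      rw [(tl_compl hj α).sum_eq, List.sum_cons]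
    rw [zI, h.Zs_perm hq0 (List.Perm.refl _) (tl_compl hj α)]
    · simp only [List.sum_append, List.sum_cons]; omega
    · intro m hm; simp only [List.sum_append, List.sum_cons] at hm; exact hτ m (by omega)
  rw [e1, e2, h.gI_not hq0 hk hτ hj hα, h.Zs_ul hq0 hq (by omega) (fun m hm => hτ m (by omega))]
  rfl

lemma HRel.gI_perm (h : HRel q T N) (hq0 : q ≠ 0) (hk : k ≤ N)
    (hτ : ∀ i, i + 1 < k → T i ∈ cyc τ) {α : ι → ℕ} (hα : ∑ i, α i = k) (σ : Equiv.Perm ι) :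
    gI q T τ (α ∘ σ) = gI q T τ α := by
  apply h.gl_perm hq0
  · rw [tl, ← List.map_map]
    refine List.Perm.map _ ?_
    rw [List.perm_ext_iff_of_nodup ((Finset.nodup_toList _).map σ.injective) (Finset.nodup_toList _)]
    intro a; simp; exact ⟨σ.symm a, by simp⟩
  · rw [tl_sum]; simp only [Function.comp_apply, Equiv.sum_comp σ α]; omega
  · rw [tl_sum]; simp only [Function.comp_apply, Equiv.sum_comp σ α]; intro m hm; exact hτ m (by omega)

end Hecke6
end HeckeTP

set_option linter.unusedSectionVars false
set_option linter.unusedSimpArgs false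
set_option linter.unusedVariables false
namespace HeckeTP

section HeckeB
variable {K : Type*} [Field K] {A : Type*} [Ring A] [Algebra K A]
variable {q : K} {T : ℕ → A} {N : ℕ}
variable {τ : A →ₗ[K] K}
variable {ι : Type*} [Fintype ι] [DecidableEq ι]
variable {k : ℕ}

open MvPowerSeries in
lemma coeff_X_mul' (i : ι) (φ : MvPowerSeries ι K) (m : ι →₀ ℕ) :
    coeff m (MvPowerSeries.X i * φ) = if 1 ≤ m i then coeff (m - Finsupp.single i 1 : ι →₀ ℕ) φ else 0 := by
  rw [MvPowerSeries.X, coeff_monomial_mul]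
  simp

/-- power series with given coefficients in total degree `k` -/
noncomputable def ps (k : ℕ) (φ : (ι → ℕ) → K) : MvPowerSeries ι K := fun m => if ∑ i, m i = k then φ m else 0

open MvPowerSeries in
lemma coeff_ps (φ : (ι → ℕ) → K) (m : ι →₀ ℕ) : coeff m (ps k φ) = if ∑ i, m i = k then φ m else 0 := rfl

noncomputable def Gs (q : K) (T : ℕ → A) (τ : A →ₗ[K] K) (k : ℕ) : MvPowerSeries ι K := ps k (gI q T τ)
noncomputable def Us (q : K) (T : ℕ → A) (τ : A →ₗ[K] K) (k : ℕ) (I : Finset ι) (j : ι) : MvPowerSeries ι K :=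
  ps k (fun m => qi q⁻¹ (m j) * uI q T τ I j m)
noncomputable def Ns (q : K) (T : ℕ → A) (τ : A →ₗ[K] K) (k : ℕ) (j : ι) : MvPowerSeries ι K :=
  ps k (fun m => qi q⁻¹ (m j) * gI q T τ m)
noncomputable def Zz (q : K) (T : ℕ → A) (τ : A →ₗ[K] K) (k : ℕ) (I : Finset ι) : MvPowerSeries ι K :=
  ps k (zI q T τ I)
noncomputable def Ms (q : K) (T : ℕ → A) (τ : A →ₗ[K] K) (k : ℕ) (j : ι) : MvPowerSeries ι K :=
  ps k (fun m => q⁻¹ * (∑ i ∈ Finset.range (m j), qi q⁻¹ i) * gI q T τ m)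

lemma sum_sub_single (m : ι →₀ ℕ) (i : ι) (h : 1 ≤ m i) : ∑ x, (m - Finsupp.single i 1 : ι →₀ ℕ) x + 1 = ∑ x, m x := by
  have : m = (m - Finsupp.single i 1 : ι →₀ ℕ) + Finsupp.single i 1 := by
    ext x; by_cases hx : i = x
    · subst hx; simp; omega
    · simp [Finsupp.single_apply, hx]
  conv_rhs => rw [this]
  simp [Finset.sum_add_distrib, Finsupp.single_apply]

open MvPowerSeries in
lemma HRel.Us_rec (h : HRel q T N) (hq0 : q ≠ 0) (hq : ∀ k, 1 ≤ k → qi q k ≠ 0) (hk : k ≤ N)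
    (hτ : ∀ i, i + 1 < k → T i ∈ cyc τ) {I : Finset ι} {i j : ι} (hi : i ∉ I) (hj : j ∉ I) (hij : i ≠ j) :
    (MvPowerSeries.X i - MvPowerSeries.X j) * (Us q T τ k (insert i I) j - Us q T τ k I j)
      = MvPowerSeries.X i * (C (q - 1) * Us q T τ k I j + Ns q T τ k j) - MvPowerSeries.X j * (C (q - 1) * Us q T τ k I i + Ns q T τ k i) := by
  generalize hc : q - 1 = c
  ext m
  rw [sub_mul, map_sub, map_sub]
  simp only [coeff_X_mul']
  simp only [map_add, map_sub, coeff_C_mul, Us, Ns, coeff_ps]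
  by_cases hs : ∑ x, m x = k + 1
  swap
  · have h1 : ∀ i, 1 ≤ m i → ¬ ∑ x, (m - Finsupp.single i 1 : ι →₀ ℕ) x = k := fun i hi h => by
      have := sum_sub_single m i hi; omega
    have e : ∀ (i) (y : K), (if 1 ≤ m i then (if ∑ x, (m - Finsupp.single i 1 : ι →₀ ℕ) x = k then y else 0) else 0) = 0 := by
      intro i y; split_ifs with ha hb
      · exact absurd hb (h1 i ha)
      · rfl
      · rfl
    have e1 : ∀ (i) (a b c d : K), (if 1 ≤ m i then (if ∑ x, (m - Finsupp.single i 1 : ι →₀ ℕ) x = k then a else b) - (if ∑ x, (m - Finsupp.single i 1 : ι →₀ ℕ) x = k then c else d) else 0) = (if 1 ≤ m i then b - d else 0) := by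
      intro i a b c d; split_ifs with ha hb
      · exact absurd hb (h1 i ha)
      · rfl
      · rfl
    have e2 : ∀ (i) (a b : K), (if 1 ≤ m i then c * (if ∑ x, (m - Finsupp.single i 1 : ι →₀ ℕ) x = k then a else 0) + (if ∑ x, (m - Finsupp.single i 1 : ι →₀ ℕ) x = k then b else 0) else 0) = 0 := by
      intro i a b; split_ifs with ha hb
      · exact absurd hb (h1 i ha)
      · simp
      · rfl
    rw [e1, e1, e2, e2]; simp
  have h1 : ∀ i, 1 ≤ m i → ∑ x, (m - Finsupp.single i 1 : ι →₀ ℕ) x = k := fun i hi => by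
      have := sum_sub_single m i hi; omega
  by_cases hi1 : 1 ≤ m i <;> by_cases hj1 : 1 ≤ m j
  · simp only [hi1, hj1, h1 i hi1, h1 j hj1, if_true]
    have key := h.key_uI hq0 hq hk hτ hi hj hij (α := ⇑(m - Finsupp.single i 1 : ι →₀ ℕ)) (β := ⇑(m - Finsupp.single j 1 : ι →₀ ℕ))
      (h1 i hi1) (by simp [hij, Finsupp.single_apply, hij.symm]; omega) (by simp [hij, Finsupp.single_apply]; omega)
      (fun x h1 h2 => by simp [Finsupp.single_apply, h1.symm, h2.symm])
    rw [utI, utI, hc] at key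
    linear_combination key
  · have hj0 : m j = 0 := by omega
    simp only [hi1, hj1, h1 i hi1, if_true, if_false]
    have : (m - Finsupp.single i 1 : ι →₀ ℕ) j = 0 := by simp [hj0]
    rw [this]; simp
  · have hi0 : m i = 0 := by omega
    simp only [hi1, hj1, h1 j hj1, if_true, if_false]
    have : (m - Finsupp.single j 1 : ι →₀ ℕ) i = 0 := by simp [hi0]
    rw [this, h.uI_zero hq0 hk hτ hi hj hij (h1 j hj1) this]; simp
  · simp [hi1, hj1]

lemma Us_empty (j : ι) : Us q T τ k ∅ j = 0 := by
  ext m; simp [Us, coeff_ps, uI_empty]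

lemma Zz_empty : Zz q T τ k (∅ : Finset ι) = 0 := by
  ext m; simp [Zz, coeff_ps, zI_empty]

lemma HRel.Zz_insert (h : HRel q T N) (hq0 : q ≠ 0) (hq : ∀ k, 1 ≤ k → qi q k ≠ 0) (hk : k ≤ N)
    (hτ : ∀ i, i + 1 < k → T i ∈ cyc τ) {I : Finset ι} {j : ι} (hj : j ∉ I) :
    Zz q T τ k (insert j I) = Zz q T τ k I + Us q T τ k I j - Ms q T τ k j := by
  ext m
  simp only [map_add, map_sub, Zz, Us, Ms, coeff_ps]
  split_ifs with hm
  · exact h.zI_insert hq0 hq hk hτ hj hm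
  · simp

end HeckeB
end HeckeTP

set_option linter.unusedSectionVars false
set_option linter.unusedSimpArgs false
set_option linter.unusedVariables false
namespace HeckeTP

section FieldRec
variable {F : Type*} [Field F] {ι : Type*} [DecidableEq ι]

noncomputable def Bq (c : F) (x : ι → F) (i j : ι) : F := (c * x i - x j) / (x i - x j)

lemma rec_U (c : F) (x : ι → F) (hx : Function.Injective x) (U : Finset ι → ι → F) (n : ι → F)
    (h0 : ∀ j, U ∅ j = n j)
    (hrec : ∀ I i j, i ∉ I → j ∉ I → i ≠ j → (x i - x j) * (U (insert i I) j - U I j) = (c - 1) * (x i * U I j - x j * U I i))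
    (I : Finset ι) : ∀ j, j ∉ I → U I j = (∏ i ∈ I, Bq c x i j) * n j
      - (c - 1) * ∑ i ∈ I, (x j / (x i - x j)) * (∏ k ∈ I.erase i, Bq c x k i) * n i := by
  induction I using Finset.induction_on with
  | empty => intro j _; simp [h0]
  | insert a I ha ih =>
    intro j hj
    have haj : a ≠ j := by rintro rfl; simp at hj
    have hjI : j ∉ I := fun h => hj (Finset.mem_insert_of_mem h)
    have hd : x a - x j ≠ 0 := sub_ne_zero.2 (hx.ne haj)
    have e : U (insert a I) j = Bq c x a j * U I j - (c - 1) * (x j / (x a - x j)) * U I a := by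
      have := hrec I a j ha hjI haj
      rw [Bq]; field_simp; linear_combination this
    rw [e, ih j hjI, ih a ha, Finset.prod_insert ha, Finset.sum_insert ha, Finset.erase_insert ha]
    have e2 : ∑ i ∈ I, x j / (x i - x j) * (∏ k ∈ (insert a I).erase i, Bq c x k i) * n i
       = ∑ i ∈ I, (Bq c x a j * (x j / (x i - x j) * (∏ k ∈ I.erase i, Bq c x k i) * n i)
          - (c - 1) * (x j / (x a - x j)) * (x a / (x i - x a) * (∏ k ∈ I.erase i, Bq c x k i) * n i)) := by
      refine Finset.sum_congr rfl fun i hi => ?_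
      have hia : i ≠ a := by rintro rfl; exact ha hi
      have hij : i ≠ j := by rintro rfl; exact hjI hi
      rw [Finset.erase_insert_of_ne hia.symm, Finset.prod_insert (by simp [ha])]
      have : Bq c x a i * (x j / (x i - x j)) = Bq c x a j * (x j / (x i - x j)) - (c - 1) * (x j / (x a - x j)) * (x a / (x i - x a)) := by
        have h1 : x i - x a ≠ 0 := sub_ne_zero.2 (hx.ne hia)
        have h1' : x a - x i ≠ 0 := sub_ne_zero.2 (hx.ne hia.symm)
        have h2 : x i - x j ≠ 0 := sub_ne_zero.2 (hx.ne hij)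
        rw [Bq, Bq, ← neg_sub (x a) (x i)]; field_simp; ring
      linear_combination (∏ k ∈ I.erase i, Bq c x k i) * n i * this
    rw [e2, Finset.sum_sub_distrib, ← Finset.mul_sum, ← Finset.mul_sum]
    ring

lemma rec_Z (c : F) (x : ι → F) (hx : Function.Injective x) (U : Finset ι → ι → F) (n : ι → F)
    (h0 : ∀ j, U ∅ j = n j)
    (hrec : ∀ I i j, i ∉ I → j ∉ I → i ≠ j → (x i - x j) * (U (insert i I) j - U I j) = (c - 1) * (x i * U I j - x j * U I i))
    (Z : Finset ι → F) (hZ0 : Z ∅ = 0) (hZ : ∀ I j, j ∉ I → Z (insert j I) = Z I + U I j)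
    (I : Finset ι) : Z I = ∑ j ∈ I, (∏ i ∈ I.erase j, Bq c x i j) * n j := by
  induction I using Finset.induction_on with
  | empty => simp [hZ0]
  | insert a I ha ih =>
    rw [hZ _ _ ha, ih, rec_U c x hx U n h0 hrec I a ha, Finset.sum_insert ha, Finset.erase_insert ha]
    have e2 : ∑ j ∈ I, (∏ i ∈ (insert a I).erase j, Bq c x i j) * n j
       = ∑ i ∈ I, ((∏ k ∈ I.erase i, Bq c x k i) * n i - (c - 1) * (x a / (x i - x a) * (∏ k ∈ I.erase i, Bq c x k i) * n i)) := by
      refine Finset.sum_congr rfl fun i hi => ?_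
      have hia : i ≠ a := by rintro rfl; exact ha hi
      rw [Finset.erase_insert_of_ne hia.symm, Finset.prod_insert (by simp [ha])]
      have : Bq c x a i = 1 - (c - 1) * (x a / (x i - x a)) := by
        have h1' : x a - x i ≠ 0 := sub_ne_zero.2 (hx.ne hia.symm)
        rw [Bq, ← neg_sub (x a) (x i)]; field_simp; ring
      rw [this]; ring
    rw [e2, Finset.sum_sub_distrib, ← Finset.mul_sum]
    ring

lemma rec_U1 (x : ι → F) (hx : Function.Injective x) (U : Finset ι → ι → F) (n : ι → F)
    (h0 : ∀ j, U ∅ j = 0)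
    (hrec : ∀ I i j, i ∉ I → j ∉ I → i ≠ j → (x i - x j) * (U (insert i I) j - U I j) = x i * n j - x j * n i)
    (I : Finset ι) : ∀ j, j ∉ I → U I j = ∑ i ∈ I, (x i * n j - x j * n i) / (x i - x j) := by
  induction I using Finset.induction_on with
  | empty => intro j _; simp [h0]
  | insert a I ha ih =>
    intro j hj
    have haj : a ≠ j := by rintro rfl; simp at hj
    have hjI : j ∉ I := fun h => hj (Finset.mem_insert_of_mem h)
    have hd : x a - x j ≠ 0 := sub_ne_zero.2 (hx.ne haj)
    rw [Finset.sum_insert ha, ← ih j hjI, ← hrec I a j ha hjI haj, mul_div_cancel_left₀ _ hd]; ring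

lemma rec_Z1 (x : ι → F) (hx : Function.Injective x) (U : Finset ι → ι → F) (n m : ι → F)
    (h0 : ∀ j, U ∅ j = 0)
    (hrec : ∀ I i j, i ∉ I → j ∉ I → i ≠ j → (x i - x j) * (U (insert i I) j - U I j) = x i * n j - x j * n i)
    (Z : Finset ι → F) (hZ0 : Z ∅ = 0) (hZ : ∀ I j, j ∉ I → Z (insert j I) = Z I + U I j - m j)
    (I : Finset ι) : Z I = ∑ j ∈ I, ((∑ i ∈ I.erase j, x i / (x i - x j)) * n j - m j) := by
  induction I using Finset.induction_on with
  | empty => simp [hZ0]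
  | insert a I ha ih =>
    rw [hZ _ _ ha, ih, rec_U1 x hx U n h0 hrec I a ha, Finset.sum_insert ha, Finset.erase_insert ha]
    have e2 : ∑ j ∈ I, ((∑ i ∈ (insert a I).erase j, x i / (x i - x j)) * n j - m j)
       = ∑ j ∈ I, ((∑ i ∈ I.erase j, x i / (x i - x j)) * n j - m j) + ∑ j ∈ I, x a / (x a - x j) * n j := by
      rw [← Finset.sum_add_distrib]
      refine Finset.sum_congr rfl fun i hi => ?_
      have hia : i ≠ a := by rintro rfl; exact ha hi
      rw [Finset.erase_insert_of_ne hia.symm, Finset.sum_insert (by simp [ha])]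
      ring
    have e3 : ∑ i ∈ I, (x i * n a - x a * n i) / (x i - x a) = (∑ i ∈ I, x i / (x i - x a)) * n a + ∑ j ∈ I, x a / (x a - x j) * n j := by
      rw [Finset.sum_mul, ← Finset.sum_add_distrib]
      refine Finset.sum_congr rfl fun i hi => ?_
      have hia : i ≠ a := by rintro rfl; exact ha hi
      have h1' : x a - x i ≠ 0 := sub_ne_zero.2 (hx.ne hia.symm)
      rw [← neg_sub (x a) (x i)]; field_simp; ring
    rw [e2, e3]
    ring

end FieldRec

section Vdm
open Matrix
variable {F : Type*} [CommRing F] {r : ℕ}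

lemma vdm_update (x : Fin r → F) (j : Fin r) (y : F) :
    (vandermonde (Function.update x j y)).det * ∏ i ∈ Finset.univ.erase j, (x i - x j)
      = (vandermonde x).det * ∏ i ∈ Finset.univ.erase j, (x i - y) := by
  have key : ∃ C : F, ∀ y, (vandermonde (Function.update x j y)).det = C * ∏ i ∈ Finset.univ.erase j, (x i - y) := by
    refine ⟨(∏ a ∈ Finset.univ.erase j, ∏ b ∈ (Finset.Ioi a).erase j, (x b - x a)) * ∏ b ∈ Finset.Iio j, (-1), fun y => ?_⟩
    have hs : Finset.univ.erase j = Finset.Iio j ∪ Finset.Ioi j := by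
      ext a; simp [lt_or_lt_iff_ne]
    have hdis : Disjoint (Finset.Iio j) (Finset.Ioi j) := by
      rw [Finset.disjoint_left]; intro a ha hb; simp at ha hb; exact absurd ha (not_lt.2 hb.le)
    have e1 : ∀ a ∈ Finset.univ.erase j, ∏ b ∈ Finset.Ioi a, (Function.update x j y b - Function.update x j y a)
        = (∏ b ∈ (Finset.Ioi a).erase j, (x b - x a)) * (if a ∈ Finset.Iio j then (-1) * (x a - y) else 1) := by
      intro a ha
      have haj : a ≠ j := by simpa using ha
      have e0 : ∏ b ∈ (Finset.Ioi a).erase j, (x b - x a) = ∏ b ∈ (Finset.Ioi a).erase j, (Function.update x j y b - Function.update x j y a) := by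
        refine Finset.prod_congr rfl fun b hb => ?_
        have hbj : b ≠ j := (Finset.mem_erase.1 hb).1
        rw [Function.update_of_ne haj, Function.update_of_ne hbj]
      rw [e0]
      by_cases h : a < j
      · rw [← Finset.prod_erase_mul (Finset.Ioi a) _ (a := j) (by simpa using h)]
        simp [h, Function.update_of_ne haj]
      · rw [Finset.erase_eq_of_notMem (by simpa using h)]; simp [h]
    rw [det_vandermonde, ← Finset.prod_erase_mul Finset.univ _ (Finset.mem_univ j), Finset.prod_congr rfl e1, Finset.prod_mul_distrib]
    have e2 : ∏ a ∈ Finset.univ.erase j, (if a ∈ Finset.Iio j then (-1) * (x a - y) else 1) = (∏ b ∈ Finset.Iio j, (-1)) * ∏ a ∈ Finset.Iio j, (x a - y) := by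
      rw [← Finset.prod_mul_distrib, hs, Finset.prod_ite_mem, Finset.union_inter_cancel_left]
    have e3 : ∏ b ∈ Finset.Ioi j, (Function.update x j y b - Function.update x j y j) = ∏ b ∈ Finset.Ioi j, (x b - y) := by
      refine Finset.prod_congr rfl fun b hb => ?_
      have : j < b := by simpa using hb
      rw [Function.update_self, Function.update_of_ne this.ne']
    rw [e2, e3, hs, Finset.prod_union hdis, Finset.prod_union hdis]; ring
  obtain ⟨C, hC⟩ := key
  have h1 := hC (x j)
  rw [Function.update_eq_self] at h1
  rw [hC y, h1]; ring

lemma vdm_deriv {F : Type*} [Field F] (x : Fin r → F) (hx : Function.Injective x) (j : Fin r) :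
    ∑ w : Equiv.Perm (Fin r), (Equiv.Perm.sign w : F) * (((w j : ℕ) : F) * ∏ i, x i ^ (w i : ℕ))
      = (vandermonde x).det * ∑ i ∈ Finset.univ.erase j, (1 - x i / (x i - x j)) := by
  open Polynomial in
  have h := congrArg (fun P => eval 1 (derivative P)) (vdm_update (fun i => (C (x i) : F[X])) j (Polynomial.X * C (x j)))
  have e : (vandermonde (Function.update (fun i => (C (x i) : F[X])) j (Polynomial.X * C (x j)))).det
      = ∑ w : Equiv.Perm (Fin r), C (Equiv.Perm.sign w : F) * (C (∏ i, x i ^ (w i : ℕ)) * Polynomial.X ^ (w j : ℕ)) := by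
    rw [← det_transpose, det_apply']
    refine Finset.sum_congr rfl fun w _ => ?_
    rw [← Polynomial.C_eq_intCast]
    congr 1
    · simp only [transpose_apply, vandermonde_apply]
      rw [← Finset.prod_erase_mul _ _ (Finset.mem_univ j), ← Finset.prod_erase_mul (Finset.univ) (fun i => x i ^ (w i : ℕ)) (Finset.mem_univ j)]
      rw [Function.update_self, Finset.prod_congr rfl (g := fun i => C (x i ^ (w i : ℕ)))]
      · rw [mul_pow, C_mul, ← map_prod, C_pow]; ring
      · intro i hi; rw [Function.update_of_ne (Finset.mem_erase.1 hi).1, C_pow]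
  have e2 : (vandermonde (fun i => (C (x i) : F[X]))).det = C (vandermonde x).det := by
    rw [RingHom.map_det]; congr 1; ext a b; simp [vandermonde_apply]
  have hd : ∀ i ∈ Finset.univ.erase j, x i - x j ≠ 0 := fun i hi => sub_ne_zero.2 (hx.ne (Finset.mem_erase.1 hi).1)
  rw [e, e2, ← Finset.prod_congr rfl (fun i _ => C_sub), ← map_prod] at h
  simp only [derivative_mul, derivative_C, derivative_sum, derivative_prod, eval_finsetSum, eval_add, eval_mul, eval_C, eval_sub, eval_pow, eval_X,
    derivative_X_pow, derivative_sub, derivative_X, eval_prod, eval_zero, eval_one, zero_mul, mul_zero, zero_add, add_zero, one_pow, mul_one, one_mul, zero_sub, eval_natCast, eval_neg] at h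
  have hP : ∏ i ∈ Finset.univ.erase j, (x i - x j) ≠ 0 := Finset.prod_ne_zero_iff.2 hd
  apply mul_right_cancel₀ hP
  rw [mul_assoc]
  have h3 : Polynomial.eval 1 (Polynomial.derivative (∏ i ∈ Finset.univ.erase j, (Polynomial.C (x i) - Polynomial.X * Polynomial.C (x j))))
      = (∑ i ∈ Finset.univ.erase j, (1 - x i / (x i - x j))) * ∏ i ∈ Finset.univ.erase j, (x i - x j) := by
    rw [Polynomial.derivative_prod_finset, Polynomial.eval_finsetSum, Finset.sum_mul]
    refine Finset.sum_congr rfl fun i hi => ?_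
    rw [← Finset.prod_erase_mul _ (fun i => x i - x j) hi]
    have := hd i hi
    simp [Polynomial.eval_prod]
    field_simp; ring
  rw [← h3, ← h]
  congr 1
  exact Finset.sum_congr rfl fun w _ => by ring

end Vdm
end HeckeTP

set_option linter.unusedSectionVars false
set_option linter.unusedSimpArgs false
set_option linter.unusedVariables false
namespace HeckeTP

section HeckeB3
variable {K : Type*} [Field K] {A : Type*} [Ring A] [Algebra K A]
variable {q : K} {T : ℕ → A} {N : ℕ}
variable {τ : A →ₗ[K] K}
variable {k r : ℕ}
open MvPowerSeries

/-- exponent vector of a permutation -/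
noncomputable def pm (w : Equiv.Perm (Fin r)) : Fin r →₀ ℕ := Finsupp.equivFunOnFinite.symm (fun i => (w i : ℕ))

@[simp] lemma pm_apply (w : Equiv.Perm (Fin r)) (i : Fin r) : pm w i = (w i : ℕ) := rfl

/-- Vandermonde determinant as a power series -/
noncomputable def Vs (K : Type*) [Field K] (r : ℕ) : MvPowerSeries (Fin r) K :=
  (Matrix.vandermonde (fun i => (MvPowerSeries.X i : MvPowerSeries (Fin r) K))).det

lemma prod_X_pow (w : Equiv.Perm (Fin r)) : ∏ i, (MvPowerSeries.X i : MvPowerSeries (Fin r) K) ^ (w i : ℕ) = monomial (pm w) 1 := by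
  have := MvPowerSeries.monomial_eq (σ := Fin r) (R := K) (pm w) (fun _ => 1)
  simp only [one_pow, one_smul, Finsupp.prod_fintype, implies_true, pow_zero, pm_apply] at this
  simpa using this.symm

lemma Vs_eq : Vs K r = ∑ w : Equiv.Perm (Fin r), C (Equiv.Perm.sign w : K) * monomial (pm w) 1 := by
  rw [Vs, ← Matrix.det_transpose, Matrix.det_apply']
  refine Finset.sum_congr rfl fun w _ => ?_
  congr 1
  · simp
  · rw [← prod_X_pow]; simp [Matrix.vandermonde_apply]

lemma coeff_Vs (m : Fin r →₀ ℕ) : coeff m (Vs K r) = ∑ w : Equiv.Perm (Fin r), (Equiv.Perm.sign w : K) * (if m = pm w then 1 else 0) := by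
  rw [Vs_eq, map_sum]
  refine Finset.sum_congr rfl fun w _ => ?_
  rw [coeff_C_mul, coeff_monomial]

lemma Vs_eig (f : (Fin r →₀ ℕ) → K) (c : K) (hf : ∀ w : Equiv.Perm (Fin r), f (pm w) = c) (m : Fin r →₀ ℕ) :
    f m * coeff m (Vs K r) = c * coeff m (Vs K r) := by
  rw [coeff_Vs, Finset.mul_sum, Finset.mul_sum]
  refine Finset.sum_congr rfl fun w _ => ?_
  split_ifs with h
  · rw [h, hf]
  · simp

/-- alternating sum -/
noncomputable def DD (φ : (Fin r → ℕ) → K) (ℓ : Fin r → ℕ) : K :=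
  ∑ w : Equiv.Perm (Fin r), (Equiv.Perm.sign w : K) * (if ∀ i, (w i : ℕ) ≤ ℓ i then φ (fun i => ℓ i - w i) else 0)

lemma sum_perm (w : Equiv.Perm (Fin r)) : ∑ i, (w i : ℕ) = ∑ i : Fin r, (i : ℕ) :=
  Equiv.sum_comp w (fun i : Fin r => (i : ℕ))

lemma coeff_Vs_mul (φ : (Fin r → ℕ) → K) (ℓ : Fin r →₀ ℕ) (hℓ : ∑ i, ℓ i = k + ∑ i : Fin r, (i : ℕ)) :
    coeff ℓ (Vs K r * ps k φ) = DD φ ℓ := by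
  rw [Vs_eq, Finset.sum_mul, map_sum, DD]
  refine Finset.sum_congr rfl fun w _ => ?_
  rw [mul_assoc, coeff_C_mul, coeff_monomial_mul]
  congr 1
  have h0 : (pm w ≤ ℓ) ↔ ∀ i, (w i : ℕ) ≤ ℓ i := Iff.rfl
  simp only [h0]
  split_ifs with h
  · rw [one_mul, coeff_ps, if_pos]
    · rfl
    · have : ∑ i, (ℓ - pm w) i + ∑ i, (w i : ℕ) = ∑ i, ℓ i := by
        rw [← Finset.sum_add_distrib]
        refine Finset.sum_congr rfl fun i _ => ?_
        have := h i
        simp; omega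
      rw [sum_perm] at this; omega
  · rfl

noncomputable def Tq (p : K) (j : Fin r) : MvPowerSeries (Fin r) K →+* MvPowerSeries (Fin r) K :=
  rescale (Function.update (fun _ => (1 : K)) j p)

lemma coeff_Tq (p : K) (j : Fin r) (φ : MvPowerSeries (Fin r) K) (m) : coeff m (Tq p j φ) = p ^ (m j) * coeff m φ := by
  rw [Tq, coeff_rescale, Finsupp.prod_fintype _ _ (by simp)]
  congr 1
  rw [Finset.prod_eq_single j]
  · simp
  · intro b _ hb; simp [hb]
  · simp

lemma Tq_X (p : K) (j : Fin r) (i : Fin r) : Tq p j (MvPowerSeries.X i) = Function.update (fun i => (MvPowerSeries.X i : MvPowerSeries (Fin r) K)) j (C p * MvPowerSeries.X j) i := by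
  ext m
  rw [coeff_Tq]
  by_cases h : i = j
  · subst h
    rw [Function.update_self, coeff_C_mul, coeff_X]
    split_ifs with h
    · simp [h]
    · simp
  · rw [Function.update_of_ne h, coeff_X]
    split_ifs with h
    · simp [h, Finsupp.single_apply, ‹¬ i = j›]
    · simp

lemma Tq_Vs (p : K) (j : Fin r) : Tq p j (Vs K r) = (Matrix.vandermonde (Function.update (fun i => (MvPowerSeries.X i : MvPowerSeries (Fin r) K)) j (C p * MvPowerSeries.X j))).det := by
  rw [Vs, RingHom.map_det]
  congr 1
  ext a b
  simp only [RingHom.mapMatrix_apply, Matrix.map_apply, Matrix.vandermonde_apply, map_pow, Tq_X]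

lemma sum_Tq_Vs (p : K) : ∑ j : Fin r, Tq p j (Vs K r) = C (∑ i : Fin r, p ^ (i : ℕ)) * Vs K r := by
  ext m
  rw [map_sum, coeff_C_mul, ← Vs_eig (fun m => ∑ i, p ^ (m i)), Finset.sum_mul]
  · simp only [coeff_Tq]
  · intro w; simp only [pm_apply]; exact Equiv.sum_comp w (fun i : Fin r => p ^ (i : ℕ))

noncomputable def Js (q : K) (T : ℕ → A) (τ : A →ₗ[K] K) (k : ℕ) (j : Fin r) : MvPowerSeries (Fin r) K :=
  ps k (fun m => (m j : K) * gI q T τ m)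

lemma Js_eq (hq0 : q ≠ 0) (j : Fin r) : C (q - 1) * Ms q T τ k j + Ns q T τ k j = Js q T τ k j := by
  generalize hc : q - 1 = c
  ext m
  rw [map_add, coeff_C_mul, Ms, Ns, Js, coeff_ps, coeff_ps, coeff_ps]
  split_ifs with h
  · rw [← mul_assoc, ← add_mul]
    congr 1
    have : ∀ a : ℕ, c * (q⁻¹ * ∑ i ∈ Finset.range a, qi q⁻¹ i) + qi q⁻¹ a = a := by
      intro a
      induction a with
      | zero => simp
      | succ a ih =>
        rw [Finset.sum_range_succ, qi_succ]; push_cast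
        have := qi_mul q⁻¹ a
        rw [← hc] at ih ⊢
        have e : (q - 1) * q⁻¹ = 1 - q⁻¹ := by field_simp
        linear_combination ih - this + qi q⁻¹ a * e
    exact this _
  · simp

lemma Ns_eq (j : Fin r) : C (1 - q⁻¹) * Ns q T τ k j = Gs q T τ k - Tq q⁻¹ j (Gs q T τ k) := by
  generalize hc : 1 - q⁻¹ = c
  ext m
  rw [map_sub, coeff_C_mul, coeff_Tq, Ns, Gs, coeff_ps, coeff_ps]
  split_ifs with h
  · have := qi_mul q⁻¹ (m j)
    rw [← hc]; linear_combination - gI q T τ m * this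
  · simp

lemma HRel.Zt_eq (h : HRel q T N) (hq0 : q ≠ 0) (hq : ∀ k, 1 ≤ k → qi q k ≠ 0) (hk : k ≤ N)
    (hτ : ∀ i, i + 1 < k → T i ∈ cyc τ) :
    C (1 - q⁻¹) * (Vs K r * (C (q - 1) * Zz q T τ k (Finset.univ : Finset (Fin r)) + ∑ j, Js q T τ k j))
     = C (q ^ (r - 1)) * ∑ j : Fin r, Tq q⁻¹ j (Vs K r) * (Gs q T τ k - Tq q⁻¹ j (Gs q T τ k)) := by
  have inj : Function.Injective (algebraMap (MvPowerSeries (Fin r) K) (FractionRing (MvPowerSeries (Fin r) K))) :=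
    IsFractionRing.injective _ _
  set φ := algebraMap (MvPowerSeries (Fin r) K) (FractionRing (MvPowerSeries (Fin r) K)) with hφ
  apply inj
  have hx : Function.Injective (fun i : Fin r => φ (MvPowerSeries.X i)) := fun a b hab => by
    have := inj hab; exact (MvPowerSeries.X_inj (R := K)).1 this
  have key := rec_Z (φ (C q)) (fun i => φ (MvPowerSeries.X i)) hx (fun I j => φ (C (q-1) * Us q T τ k I j + Ns q T τ k j))
    (fun j => φ (Ns q T τ k j)) (fun j => by simp [Us_empty]) (fun I i j hi hj hij => by
      have := congrArg φ (h.Us_rec hq0 hq hk hτ hi hj hij)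
      simp only [map_sub, map_mul, map_add, map_one] at this ⊢
      linear_combination (φ (C q) - 1) * this)
    (fun I => φ (C (q - 1) * Zz q T τ k I + ∑ j ∈ I, Js q T τ k j)) (by simp [Zz_empty]) (fun I j hj => by
      rw [h.Zz_insert hq0 hq hk hτ hj, Finset.sum_insert hj, ← Js_eq hq0 j, ← map_add]
      congr 1; ring) Finset.univ
  have hxne : ∀ j : Fin r, ∏ i ∈ Finset.univ.erase j, (φ (MvPowerSeries.X i) - φ (MvPowerSeries.X j)) ≠ 0 := fun j =>
    Finset.prod_ne_zero_iff.2 fun i hi => sub_ne_zero.2 (hx.ne (Finset.mem_erase.1 hi).1)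
  have hB : ∀ j : Fin r, φ (Vs K r) * ∏ i ∈ Finset.univ.erase j, Bq (φ (C q)) (fun i => φ (MvPowerSeries.X i)) i j
      = φ (C (q ^ (r - 1))) * φ (Tq q⁻¹ j (Vs K r)) := by
    intro j
    have hv := congrArg φ (vdm_update (fun i => (MvPowerSeries.X i : MvPowerSeries (Fin r) K)) j (C q⁻¹ * MvPowerSeries.X j))
    rw [← Tq_Vs, map_mul, map_mul, map_prod, map_prod] at hv
    simp only [Bq, Finset.prod_div_distrib]
    rw [← mul_div_assoc, div_eq_iff (hxne j), mul_assoc]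
    simp only [map_sub] at hv
    rw [hv]
    have e1 : ∏ i ∈ Finset.univ.erase j, (φ (C q) * φ (MvPowerSeries.X i) - φ (MvPowerSeries.X j))
      = φ (C (q ^ (r - 1))) * ∏ i ∈ Finset.univ.erase j, (φ (MvPowerSeries.X i) - φ (C q⁻¹ * MvPowerSeries.X j)) := by
      have : φ (C (q ^ (r - 1))) = ∏ i ∈ Finset.univ.erase j, φ (C q) := by simp
      rw [this, ← Finset.prod_mul_distrib]
      refine Finset.prod_congr rfl fun i _ => ?_
      have e0 : φ (C q) * φ (C q⁻¹) = 1 := by rw [← map_mul, ← map_mul, mul_inv_cancel₀ hq0]; simp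
      rw [map_mul, mul_sub, ← mul_assoc, e0, one_mul]
    rw [e1, Vs]; ring
  simp only [map_mul _ (C (1 - q⁻¹)), map_mul φ (Vs K r)]
  rw [key, map_mul φ (C (q ^ (r-1))), map_sum, Finset.mul_sum, Finset.mul_sum, Finset.mul_sum]
  refine Finset.sum_congr rfl fun j _ => ?_
  rw [← Ns_eq, map_mul, map_mul]
  linear_combination φ (C (1 - q⁻¹)) * φ (Ns q T τ k j) * hB j

lemma HRel.eig_ne (h : HRel q T N) (hq0 : q ≠ 0) (hq : ∀ k, 1 ≤ k → qi q k ≠ 0) (hk : k ≤ N)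
    (hτ : ∀ i, i + 1 < k → T i ∈ cyc τ) (ℓ : Fin r → ℕ) (hℓ : ∑ i, ℓ i = k + ∑ i : Fin r, (i : ℕ)) :
    (1 - q⁻¹) * ((q - 1) * DD (zI q T τ Finset.univ) ℓ + k * DD (gI q T τ) ℓ)
      = q ^ (r - 1) * ((∑ i : Fin r, q⁻¹ ^ (i : ℕ)) - ∑ i, q⁻¹ ^ (ℓ i)) * DD (gI q T τ) ℓ := by
  have hJ : ∑ j, Js q T τ k j = C (k : K) * Gs (ι := Fin r) q T τ k := by
    ext m
    rw [map_sum, coeff_C_mul, Gs, coeff_ps]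
    simp only [Js, coeff_ps]
    split_ifs with hm
    · rw [← Finset.sum_mul, ← hm]; push_cast; rfl
    · simp
  generalize hsum : ∑ i : Fin r, q⁻¹ ^ (i : ℕ) = S
  have key := congrArg (coeff (Finsupp.equivFunOnFinite.symm ℓ)) (h.Zt_eq (r := r) hq0 hq hk hτ)
  have hs : ∑ j : Fin r, Tq q⁻¹ j (Vs K r) * (Gs q T τ k - Tq q⁻¹ j (Gs q T τ k))
      = C S * (Vs K r * Gs q T τ k) - ∑ j, Tq q⁻¹ j (Vs K r * Gs q T τ k) := by
    simp only [mul_sub, Finset.sum_sub_distrib, ← Finset.sum_mul, sum_Tq_Vs, map_mul, hsum]; ring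
  rw [hJ, hs, mul_add] at key
  rw [show Vs K r * (C (q - 1) * Zz q T τ k Finset.univ) = C (q - 1) * (Vs K r * Zz q T τ k Finset.univ) by ring,
    show Vs K r * (C (k : K) * Gs q T τ k) = C (k : K) * (Vs K r * Gs q T τ k) by ring, coeff_C_mul, coeff_C_mul, map_add, coeff_C_mul, coeff_C_mul,
    map_sub (coeff (Finsupp.equivFunOnFinite.symm ℓ)), map_sum, coeff_C_mul] at key
  simp only [coeff_Tq] at key
  rw [← Finset.sum_mul, Zz, Gs, coeff_Vs_mul _ _ (by simpa using hℓ), coeff_Vs_mul _ _ (by simpa using hℓ)] at key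
  simp only [Finsupp.equivFunOnFinite_symm_apply_apply, Finsupp.coe_equivFunOnFinite_symm] at key
  rw [key]; ring

end HeckeB3
end HeckeTP

set_option linter.unusedSectionVars false
set_option linter.unusedSimpArgs false
set_option linter.unusedVariables false
namespace HeckeTP

section HeckeB4
variable {K : Type*} [Field K] {A : Type*} [Ring A] [Algebra K A]
variable {q : K} {T : ℕ → A} {N : ℕ}
variable {τ : A →ₗ[K] K}
variable {k r : ℕ}
open MvPowerSeries

noncomputable def Nop (j : Fin r) (φ : MvPowerSeries (Fin r) K) : MvPowerSeries (Fin r) K := fun m => (m j : K) * φ m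

lemma coeff_Nop (j : Fin r) (φ : MvPowerSeries (Fin r) K) (m) : coeff m (Nop j φ) = (m j : K) * coeff m φ := rfl

lemma Nop_mul (j : Fin r) (φ ψ : MvPowerSeries (Fin r) K) : Nop j (φ * ψ) = Nop j φ * ψ + φ * Nop j ψ := by
  ext m
  rw [coeff_Nop, map_add, coeff_mul, coeff_mul, coeff_mul, ← Finset.sum_add_distrib, Finset.mul_sum]
  refine Finset.sum_congr rfl fun x hx => ?_
  rw [coeff_Nop, coeff_Nop, ← Finset.HasAntidiagonal.mem_antidiagonal.1 hx]
  push_cast [Finsupp.add_apply]; ring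

lemma Nop_add (j : Fin r) (φ ψ : MvPowerSeries (Fin r) K) : Nop j (φ + ψ) = Nop j φ + Nop j ψ := by
  ext m; simp [coeff_Nop, mul_add]

lemma Nop_Vs (j : Fin r) : Nop j (Vs K r) = ∑ w : Equiv.Perm (Fin r), C (Equiv.Perm.sign w : K) * (C ((w j : ℕ) : K) * ∏ i, (MvPowerSeries.X i) ^ (w i : ℕ)) := by
  ext m
  rw [coeff_Nop, coeff_Vs, map_sum, Finset.mul_sum]
  refine Finset.sum_congr rfl fun w _ => ?_
  rw [coeff_C_mul, coeff_C_mul, prod_X_pow, coeff_monomial]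
  split_ifs with h
  · rw [h]; simp; ring
  · simp

lemma Ns_one (j : Fin r) : Ns (1 : K) T τ k j = Nop j (Gs 1 T τ k) := by
  ext m
  rw [coeff_Nop, Ns, Gs, coeff_ps, coeff_ps]
  simp [qi]

lemma Ms_one (j : Fin r) : C 2 * Ms (1 : K) T τ k j = Nop j (Nop j (Gs 1 T τ k)) - Nop j (Gs 1 T τ k) := by
  ext m
  rw [map_sub, coeff_C_mul, coeff_Nop, coeff_Nop, Ms, Gs, coeff_ps, coeff_ps]
  split_ifs with h
  · have : ∀ a : ℕ, 2 * (∑ i ∈ Finset.range a, (i : K)) = a * a - a := by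
      intro a
      induction a with
      | zero => simp
      | succ a ih => rw [Finset.sum_range_succ, mul_add, ih]; push_cast; ring
    simp only [qi, inv_one, one_pow, Finset.sum_const, Finset.card_range, nsmul_eq_mul, mul_one, one_mul]
    rw [← mul_assoc, this]; ring
  · simp

lemma HRel.Z1_eq (h : HRel (1 : K) T N) (hq : ∀ k, 1 ≤ k → qi (1 : K) k ≠ 0) (hk : k ≤ N)
    (hτ : ∀ i, i + 1 < k → T i ∈ cyc τ) :
    Vs K r * Zz 1 T τ k (Finset.univ : Finset (Fin r))
     = ∑ j : Fin r, ((C ((r : K) - 1) * Vs K r - Nop j (Vs K r)) * Nop j (Gs 1 T τ k) - Vs K r * Ms 1 T τ k j) := by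
  have inj : Function.Injective (algebraMap (MvPowerSeries (Fin r) K) (FractionRing (MvPowerSeries (Fin r) K))) :=
    IsFractionRing.injective _ _
  set φ := algebraMap (MvPowerSeries (Fin r) K) (FractionRing (MvPowerSeries (Fin r) K)) with hφ
  apply inj
  have hx : Function.Injective (fun i : Fin r => φ (MvPowerSeries.X i)) := fun a b hab => by
    have := inj hab; exact (MvPowerSeries.X_inj (R := K)).1 this
  have key := rec_Z1 (fun i => φ (MvPowerSeries.X i)) hx (fun I j => φ (Us 1 T τ k I j))
    (fun j => φ (Ns 1 T τ k j)) (fun j => φ (Ms 1 T τ k j)) (fun j => by simp [Us_empty]) (fun I i j hi hj hij => by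
      have := congrArg φ (h.Us_rec one_ne_zero hq hk hτ hi hj hij)
      simp only [map_sub, map_mul, map_add, map_one, sub_self, zero_mul, zero_add] at this ⊢
      simpa using this)
    (fun I => φ (Zz 1 T τ k I)) (by simp [Zz_empty]) (fun I j hj => by
      rw [h.Zz_insert one_ne_zero hq hk hτ hj, map_sub, map_add]) Finset.univ
  have hV : φ (Vs K r) = (Matrix.vandermonde (fun i => φ (MvPowerSeries.X i))).det := by
    rw [Vs, RingHom.map_det]; congr 1; ext a b
    simp [Matrix.vandermonde_apply]
  have hB : ∀ j : Fin r, φ (Vs K r) * ∑ i ∈ Finset.univ.erase j, (φ (MvPowerSeries.X i)) / (φ (MvPowerSeries.X i) - φ (MvPowerSeries.X j))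
      = φ (C ((r : K) - 1) * Vs K r - Nop j (Vs K r)) := by
    intro j
    have hv := vdm_deriv _ hx j
    rw [← hV] at hv
    have e1 : ∑ w : Equiv.Perm (Fin r), ((Equiv.Perm.sign w : ℤ) : FractionRing (MvPowerSeries (Fin r) K)) * (((w j : ℕ) : FractionRing (MvPowerSeries (Fin r) K)) * ∏ i, φ (MvPowerSeries.X i) ^ (w i : ℕ))
        = φ (Nop j (Vs K r)) := by
      rw [Nop_Vs, map_sum]
      refine Finset.sum_congr rfl fun w _ => ?_
      simp
    rw [e1, Finset.sum_sub_distrib, Finset.sum_const, Finset.card_erase_of_mem (Finset.mem_univ _)] at hv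
    have hr : 1 ≤ r := by have := j.2; omega
    rw [map_sub φ, hv]
    simp [Nat.cast_sub hr]; ring
  rw [map_mul, key, map_sum, Finset.mul_sum]
  refine Finset.sum_congr rfl fun j _ => ?_
  rw [map_sub φ, map_mul φ, map_mul φ, ← hB, ← Ns_one]
  ring

lemma HRel.eig_one (h : HRel (1 : K) T N) (hq : ∀ k, 1 ≤ k → qi (1 : K) k ≠ 0) (hk : k ≤ N)
    (hτ : ∀ i, i + 1 < k → T i ∈ cyc τ) (ℓ : Fin r → ℕ) (hℓ : ∑ i, ℓ i = k + ∑ i : Fin r, (i : ℕ)) :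
    2 * DD (zI 1 T τ Finset.univ) ℓ
      = ((2 * (r - 1) + 1) * k + ∑ i : Fin r, ((i : ℕ) : K) ^ 2 - ∑ i, (ℓ i : K) ^ 2) * DD (gI 1 T τ) ℓ := by
  have hJ : ∑ j, Nop j (Gs (ι := Fin r) 1 T τ k) = C (k : K) * Gs (ι := Fin r) 1 T τ k := by
    ext m
    rw [map_sum, coeff_C_mul]
    simp only [coeff_Nop, Gs, coeff_ps]
    split_ifs with hm
    · rw [← Finset.sum_mul, ← hm]; push_cast; rfl
    · simp
  have hV : ∑ j, Nop j (Nop j (Vs K r)) = C (∑ i : Fin r, ((i : ℕ) : K) ^ 2) * Vs K r := by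
    ext m
    rw [map_sum, coeff_C_mul, ← Vs_eig (fun m => ∑ i, (m i : K) ^ 2), Finset.sum_mul]
    · simp only [coeff_Nop]
      exact Finset.sum_congr rfl fun i _ => by ring
    · intro w; simp only [pm_apply]; exact Equiv.sum_comp w (fun i : Fin r => ((i : ℕ) : K) ^ 2)
  generalize hsum : ∑ i : Fin r, ((i : ℕ) : K) ^ 2 = S at hV ⊢
  have e : C 2 * (Vs K r * Zz 1 T τ k (Finset.univ : Finset (Fin r)))
     = C ((2 * (r - 1) + 1) * k + S) * (Vs K r * Gs 1 T τ k) - ∑ j, Nop j (Nop j (Vs K r * Gs 1 T τ k)) := by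
    rw [h.Z1_eq hq hk hτ, Finset.mul_sum]
    have e1 : ∀ j : Fin r, C 2 * ((C ((r : K) - 1) * Vs K r - Nop j (Vs K r)) * Nop j (Gs 1 T τ k) - Vs K r * Ms 1 T τ k j)
        = C (2 * ((r : K) - 1) + 1) * Vs K r * Nop j (Gs 1 T τ k) + Nop j (Nop j (Vs K r)) * Gs 1 T τ k
          - Nop j (Nop j (Vs K r * Gs 1 T τ k)) := by
      intro j
      rw [Nop_mul, Nop_add, Nop_mul, Nop_mul, map_add, map_mul]
      have h2 : (C (2 : K) : MvPowerSeries (Fin r) K) = 2 := by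
        rw [← one_add_one_eq_two, map_add, map_one, one_add_one_eq_two]
      have := Ms_one (T := T) (τ := τ) (k := k) j
      rw [h2, map_one] at *
      linear_combination - Vs K r * this
    rw [Finset.sum_congr rfl (fun j _ => e1 j), Finset.sum_sub_distrib, Finset.sum_add_distrib, ← Finset.mul_sum, ← Finset.sum_mul, hJ, hV]
    simp only [map_add, map_mul]; ring
  have key := congrArg (coeff (Finsupp.equivFunOnFinite.symm ℓ)) e
  rw [coeff_C_mul, map_sub (coeff (Finsupp.equivFunOnFinite.symm ℓ)), coeff_C_mul, map_sum] at key
  simp only [coeff_Nop] at key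
  simp only [← mul_assoc, ← Finset.sum_mul] at key
  rw [Zz, Gs, coeff_Vs_mul _ _ (by simpa using hℓ), coeff_Vs_mul _ _ (by simpa using hℓ)] at key
  simp only [Finsupp.equivFunOnFinite_symm_apply_apply, Finsupp.coe_equivFunOnFinite_symm] at key
  rw [key]; simp only [← sq]; ring

/-- the eigenvalue -/
noncomputable def ev (q : K) (ℓ : Fin r → ℕ) : K :=
  open Classical in
  if q = 1 then ((2 * (r - 1) + 1) * (∑ i, (ℓ i : K) - ∑ i : Fin r, ((i : ℕ) : K)) + ∑ i : Fin r, ((i : ℕ) : K) ^ 2 - ∑ i, (ℓ i : K) ^ 2) / 2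
  else (q ^ (r - 1) * ((∑ i : Fin r, q⁻¹ ^ (i : ℕ)) - ∑ i, q⁻¹ ^ (ℓ i)) / (1 - q⁻¹)
    - (∑ i, (ℓ i : K) - ∑ i : Fin r, ((i : ℕ) : K))) / (q - 1)

/-- content -/
noncomputable def ct (q : K) (r a : ℕ) : K :=
  open Classical in
  if q = 1 then (r : K) - 1 - a else (q ^ (r - 1) * q⁻¹ ^ a - 1) / (q - 1)

lemma sum_add_single' {β : Type*} [AddCommGroup β] (f : ℕ → β) (ℓ : Fin r → ℕ) (s : Fin r) :
    ∑ i, f ((ℓ + Pi.single s 1 : Fin r → ℕ) i) = ∑ i, f (ℓ i) + (f (ℓ s + 1) - f (ℓ s)) := by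
  rw [← Finset.add_sum_erase _ _ (Finset.mem_univ s), ← Finset.add_sum_erase _ (fun i => f (ℓ i)) (Finset.mem_univ s)]
  have : ∑ x ∈ Finset.univ.erase s, f ((ℓ + Pi.single s 1 : Fin r → ℕ) x) = ∑ x ∈ Finset.univ.erase s, f (ℓ x) :=
    Finset.sum_congr rfl fun x hx => by
      have : x ≠ s := (Finset.mem_erase.1 hx).1
      simp [this]
  rw [this]; simp; abel

lemma ev_add [CharZero K] (hq0 : q ≠ 0) (ℓ : Fin r → ℕ) (s : Fin r) :
    ev q (ℓ + Pi.single s 1) = ev q ℓ + ct q r (ℓ s) := by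
  unfold ev ct
  rw [sum_add_single' (fun a => (a : K)), sum_add_single' (fun a => (a : K) ^ 2), sum_add_single' (fun a => q⁻¹ ^ a)]
  split_ifs with h
  · field_simp; push_cast; ring
  · have h1 : q - 1 ≠ 0 := sub_ne_zero.2 h
    have h2 : 1 - q⁻¹ ≠ 0 := by
      intro h3; apply h; field_simp at h3; linear_combination h3
    have e : q⁻¹ ^ (ℓ s + 1) - q⁻¹ ^ ℓ s = - (1 - q⁻¹) * q⁻¹ ^ ℓ s := by ring
    rw [e]
    generalize q⁻¹ ^ ℓ s = y
    generalize (1 - q⁻¹) = z at *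
    push_cast
    field_simp
    ring

lemma ct_inj [CharZero K] (hq0 : q ≠ 0) (hq : ∀ k, 1 ≤ k → qi q k ≠ 0) (r : ℕ) : Function.Injective (ct q r) := by
  have key : ∀ a b, a < b → ct q r a ≠ ct q r b := by
    intro a b hab he
    unfold ct at he
    split_ifs at he with h
    · have : (a : K) = b := by linear_combination -he
      exact hab.ne (Nat.cast_injective this)
    · have h1 : q - 1 ≠ 0 := sub_ne_zero.2 h
      have h2 : q ^ (r - 1) * q⁻¹ ^ a = q ^ (r - 1) * q⁻¹ ^ b := by
        have := (div_left_inj' h1).1 he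
        linear_combination this
      have h3 := mul_left_cancel₀ (pow_ne_zero _ hq0) h2
      obtain ⟨c, rfl⟩ := Nat.exists_eq_add_of_lt hab
      have h4 : q ^ (c + 1) = 1 := by
        rw [add_assoc, pow_add] at h3
        have h5 : q⁻¹ ^ (c + 1) = 1 := by
          have : q⁻¹ ^ a ≠ 0 := pow_ne_zero _ (inv_ne_zero hq0)
          apply mul_left_cancel₀ this; rw [← h3, mul_one]
        rw [inv_pow, inv_eq_one] at h5; exact h5
      have := qi_mul q (c + 1)
      rw [h4, sub_self] at this
      exact (mul_ne_zero h1 (hq _ (by omega))) this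
  intro a b he
  rcases lt_trichotomy a b with h | h | h
  · exact absurd he (key a b h)
  · exact h
  · exact absurd he.symm (key b a h)

theorem HRel.eig [CharZero K] (h : HRel q T N) (hq0 : q ≠ 0) (hq : ∀ k, 1 ≤ k → qi q k ≠ 0) (hk : k ≤ N)
    (hτ : ∀ i, i + 1 < k → T i ∈ cyc τ) (ℓ : Fin r → ℕ) (hℓ : ∑ i, ℓ i = k + ∑ i : Fin r, (i : ℕ)) :
    DD (zI q T τ Finset.univ) ℓ = ev q ℓ * DD (gI q T τ) ℓ := by
  have hk' : (∑ i, (ℓ i : K) - ∑ i : Fin r, ((i : ℕ) : K)) = k := by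
    have := congrArg (fun n : ℕ => (n : K)) hℓ
    push_cast at this; rw [this]; ring
  unfold ev
  rw [hk']
  split_ifs with h1
  · subst h1
    have := h.eig_one hq hk hτ ℓ hℓ
    rw [div_mul_eq_mul_div, ← this]; field_simp
  · have := h.eig_ne hq0 hq hk hτ ℓ hℓ
    have h1 : q - 1 ≠ 0 := sub_ne_zero.2 h1
    have h2 : 1 - q⁻¹ ≠ 0 := by
      intro h3; apply h1; field_simp at h3; linear_combination h3
    generalize (1 - q⁻¹) = z at *
    generalize ∑ i : Fin r, q⁻¹ ^ (i : ℕ) = S1 at *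
    generalize ∑ i : Fin r, q⁻¹ ^ ℓ i = S2 at *
    field_simp
    linear_combination this

end HeckeB4
end HeckeTP

set_option linter.unusedSectionVars false
set_option linter.unusedSimpArgs false
set_option linter.unusedVariables false
namespace HeckeTP

section HeckeC
variable {K : Type*} [Field K] {W : Type*} [AddCommGroup W] [Module K W]
variable {q : K} {T : ℕ → Module.End K W} {N : ℕ}
variable {k r : ℕ}

noncomputable def tau (f : Module.End K W) : Module.End K W →ₗ[K] K :=
  (LinearMap.trace K W) ∘ₗ (LinearMap.mulLeft K f)

@[simp] lemma tau_apply (f x : Module.End K W) : tau f x = LinearMap.trace K W (f * x) := rfl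

lemma mem_cyc_tau {f y : Module.End K W} (h : Commute f y) : y ∈ cyc (tau f) := by
  rw [mem_cyc]
  intro x
  rw [tau_apply, tau_apply, ← mul_assoc, LinearMap.trace_mul_comm, ← mul_assoc, ← mul_assoc, h.eq]

/-- the determinantal element -/
noncomputable def XX (q : K) (T : ℕ → Module.End K W) (ℓ : Fin r → ℕ) : Module.End K W :=
  ∑ w : Equiv.Perm (Fin r), (Equiv.Perm.sign w : K) •
    (if ∀ i, (w i : ℕ) ≤ ℓ i then El q T (tl Finset.univ (fun i => ℓ i - w i)) else 0)

noncomputable def D (q : K) (T : ℕ → Module.End K W) (f : Module.End K W) (ℓ : Fin r → ℕ) : K :=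
  LinearMap.trace K W (f * XX q T ℓ)

lemma D_eq (f : Module.End K W) (ℓ : Fin r → ℕ) : D q T f ℓ = DD (gI q T (tau f)) ℓ := by
  rw [D, XX, DD, Finset.mul_sum, map_sum]
  refine Finset.sum_congr rfl fun w _ => ?_
  rw [mul_smul_comm, map_smul, smul_eq_mul]
  split_ifs with h
  · rfl
  · simp

lemma D_add (f g : Module.End K W) (ℓ : Fin r → ℕ) : D q T (f + g) ℓ = D q T f ℓ + D q T g ℓ := by
  simp [D, add_mul]
lemma D_sub (f g : Module.End K W) (ℓ : Fin r → ℕ) : D q T (f - g) ℓ = D q T f ℓ - D q T g ℓ := by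
  simp [D, sub_mul]
lemma D_smul (c : K) (f : Module.End K W) (ℓ : Fin r → ℕ) : D q T (c • f) ℓ = c * D q T f ℓ := by
  simp [D]

lemma DZ_eq (f : Module.End K W) (ℓ : Fin r → ℕ) (hℓ : ∑ i, ℓ i = k + ∑ i : Fin r, (i : ℕ)) :
    DD (zI q T (tau f) Finset.univ) ℓ = D q T (f * Zs q T k) ℓ := by
  rw [D, XX, DD, Finset.mul_sum, map_sum]
  refine Finset.sum_congr rfl fun w _ => ?_
  rw [mul_smul_comm, map_smul, smul_eq_mul]
  split_ifs with h
  · rw [zI_univ]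
    have : ∑ i, (ℓ i - (w i : ℕ)) = k := by
      have h2 : ∑ i, (ℓ i - (w i : ℕ)) + ∑ i, (w i : ℕ) = ∑ i, ℓ i := by
        rw [← Finset.sum_add_distrib]
        exact Finset.sum_congr rfl fun i _ => Nat.sub_add_cancel (h i)
      rw [sum_perm] at h2; omega
    rw [this, tau_apply, mul_assoc]
  · simp

lemma D_Zs [CharZero K] (h : HRel q T N) (hq0 : q ≠ 0) (hq : ∀ k, 1 ≤ k → qi q k ≠ 0) (hk : k ≤ N)
    {f : Module.End K W} (hf : ∀ i, i + 1 < k → Commute f (T i)) (ℓ : Fin r → ℕ)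
    (hℓ : ∑ i, ℓ i = k + ∑ i : Fin r, (i : ℕ)) : D q T (f * Zs q T k) ℓ = ev q ℓ * D q T f ℓ := by
  rw [← DZ_eq f ℓ hℓ, D_eq, h.eig hq0 hq hk (fun i hi => mem_cyc_tau (hf i hi)) ℓ hℓ]

/-- single term of the determinant -/
noncomputable def tm (φ : (Fin r → ℕ) → K) (w : Equiv.Perm (Fin r)) (ℓ : Fin r → ℕ) : K :=
  if ∀ i, (w i : ℕ) ≤ ℓ i then φ (fun i => ℓ i - w i) else 0

lemma DD_tm (φ : (Fin r → ℕ) → K) (ℓ : Fin r → ℕ) : DD φ ℓ = ∑ w : Equiv.Perm (Fin r), (Equiv.Perm.sign w : K) * tm φ w ℓ := rfl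

lemma tm_congr (φ : (Fin r → ℕ) → K) {w w' : Equiv.Perm (Fin r)} {ℓ ℓ' : Fin r → ℕ}
    (h : ∀ i, (w i : ℕ) + ℓ' i = w' i + ℓ i) : tm φ w ℓ = tm φ w' ℓ' := by
  unfold tm
  have h1 : (∀ i, (w i : ℕ) ≤ ℓ i) ↔ (∀ i, (w' i : ℕ) ≤ ℓ' i) := by
    apply forall_congr'; intro i; have := h i; omega
  have h2 : (fun i => ℓ i - (w i : ℕ)) = (fun i => ℓ' i - (w' i : ℕ)) := by
    funext i; have := h i; omega
  simp only [h1, h2]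

def prd (c : Fin (r + 1)) : Fin (r + 1) := ⟨c.val - 1, by omega⟩

lemma prd_ne {c : Fin (r + 1)} (hc : c ≠ 0) : prd c ≠ c := by
  intro h; have := congrArg Fin.val h
  have h2 : c.val ≠ 0 := fun h => hc (Fin.ext h)
  simp only [prd] at this; omega

lemma branch_cancel (φ : (Fin (r+1) → ℕ) → K) (ℓ : Fin (r+1) → ℕ) :
    ∑ p ∈ Finset.univ.filter (fun p : Equiv.Perm (Fin (r+1)) × Fin (r+1) => p.1 p.2 ≠ 0),
      (Equiv.Perm.sign p.1 : K) * tm φ p.1 (ℓ + Pi.single p.2 1) = 0 := by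
  refine Finset.sum_involution (fun p _ => (Equiv.swap (prd (p.1 p.2)) (p.1 p.2) * p.1, p.1.symm (prd (p.1 p.2)))) ?_ ?_ ?_ ?_
  · rintro ⟨w, s⟩ hp
    have hp : w s ≠ 0 := by simpa using hp
    have hne := prd_ne hp
    simp only
    rw [Equiv.Perm.sign_mul, Equiv.Perm.sign_swap hne]
    have hv : (w s : ℕ) ≠ 0 := fun h => hp (Fin.ext h)
    have : tm φ w (ℓ + Pi.single s 1) = tm φ (Equiv.swap (prd (w s)) (w s) * w) (ℓ + Pi.single (w.symm (prd (w s))) 1) := by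
      apply tm_congr
      intro i
      by_cases h1 : i = s
      · subst h1
        have : i ≠ w.symm (prd (w i)) := by
          intro h; apply hne; conv_rhs => rw [h]
          simp
        simp only [Pi.add_apply, Pi.single_apply, if_neg this, if_true, Equiv.Perm.mul_apply, Equiv.swap_apply_right]
        simp only [prd]; omega
      · by_cases h2 : i = w.symm (prd (w s))
        · have h3 : w i = prd (w s) := by rw [h2]; simp
          simp only [Pi.add_apply, Pi.single_apply, if_neg h1, if_pos h2, Equiv.Perm.mul_apply, h3, Equiv.swap_apply_left]
          simp [prd]; omega
        · have h3 : w i ≠ prd (w s) := fun h => h2 (by rw [← h]; simp)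
          have h4 : w i ≠ w s := fun h => h1 (w.injective h)
          simp [Pi.single_apply, h1, h2, Equiv.swap_apply_of_ne_of_ne h3 h4]
    rw [this]; push_cast; simp
  · rintro ⟨w, s⟩ hp _ he
    have hp : w s ≠ 0 := by simpa using hp
    have := congrArg Prod.snd he
    simp only at this
    apply prd_ne hp
    conv_rhs => rw [← this]
    simp
  · rintro ⟨w, s⟩ hp
    have hp : w s ≠ 0 := by simpa using hp
    simpa using hp
  · rintro ⟨w, s⟩ hp
    have hp : w s ≠ 0 := by simpa using hp
    simp [← mul_assoc, Equiv.symm_apply_eq]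

lemma gI_add_single {A : Type*} [Ring A] [Algebra K A] {T : ℕ → A} {τ : A →ₗ[K] K} {ι : Type*} [Fintype ι] [DecidableEq ι]
    (h : HRel q T N) (hq0 : q ≠ 0) (hk : k + 1 ≤ N)
    (hτ : ∀ i, i + 1 < k + 1 → T i ∈ cyc τ) {α β : ι → ℕ} {s : ι} (hα : ∑ i, α i = k) (hs : α s = 0) (hb : β s = 1)
    (hab : ∀ i, i ≠ s → α i = β i) :
    gI q T τ α = gI q T τ β := by
  have hi : s ∉ Finset.univ.erase s := by simp
  have hu : insert s (Finset.univ.erase s) = Finset.univ := Finset.insert_erase (Finset.mem_univ s)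
  have p1 := tl_insert' hi α
  have p2 := tl_insert' hi β
  rw [hu] at p1 p2
  have hβ : ∑ i, β i = k + 1 := by
    rw [← hα, ← Finset.add_sum_erase _ α (Finset.mem_univ s), ← Finset.add_sum_erase _ β (Finset.mem_univ s), hs, hb,
      Finset.sum_congr rfl (fun i hi => hab i (Finset.ne_of_mem_erase hi))]
    ring
  rw [gI, gI, h.gl_perm hq0 p1 (by rw [tl_sum, hα]; omega) (by rw [tl_sum, hα]; exact fun i hi => hτ i (by omega)),
    h.gl_perm hq0 p2 (by rw [tl_sum, hβ]; omega) (by rw [tl_sum, hβ]; exact fun i hi => hτ i (by omega)), hs, hb,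
    tl_congr (fun i hi => hab i (Finset.ne_of_mem_erase hi))]
  rw [gl, gl, El_append, El_append, El_cons, El_cons]
  rfl

lemma branch (h : HRel q T N) (hq0 : q ≠ 0) (hk : k + 1 ≤ N)
    {f : Module.End K W} (hf : ∀ i, i + 1 < k + 1 → Commute f (T i)) (ℓ : Fin (r+1) → ℕ) (h0 : ℓ 0 = 0)
    (hℓ : ∑ i, ℓ i = k + ∑ i : Fin (r+1), (i : ℕ)) : D q T f ℓ = ∑ s, D q T f (ℓ + Pi.single s 1) := by
  simp only [D_eq, DD_tm]
  set φ := gI (ι := Fin (r+1)) q T (tau f)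
  rw [Finset.sum_comm, ← Finset.sum_product', Finset.univ_product_univ,
    ← Finset.sum_filter_add_sum_filter_not Finset.univ (fun p : Equiv.Perm (Fin (r+1)) × Fin (r+1) => p.1 p.2 ≠ 0),
    branch_cancel, zero_add, Finset.sum_filter, ← Finset.univ_product_univ, Finset.sum_product]
  refine Finset.sum_congr rfl fun w _ => ?_
  rw [Finset.sum_eq_single (w.symm 0)]
  · simp only [Equiv.apply_symm_apply, ne_eq, not_true_eq_false, not_false_eq_true, if_true]
    congr 1
    by_cases hw : w 0 = 0
    · have hw' : w.symm 0 = 0 := by rw [Equiv.symm_apply_eq, hw]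
      rw [hw', tm, tm]
      have h1 : (∀ i, (w i : ℕ) ≤ ℓ i) ↔ (∀ i, (w i : ℕ) ≤ (ℓ + Pi.single 0 1 : Fin (r+1) → ℕ) i) := by
        apply forall_congr'; intro i
        by_cases hi : i = 0
        · subst hi; simp [hw]
        · simp [hi]
      rw [← if_congr h1 rfl rfl]
      split_ifs with h2
      · apply gI_add_single h hq0 hk (fun i hi => mem_cyc_tau (hf i hi)) (s := 0)
        · have h3 : ∑ i, (ℓ i - (w i : ℕ)) + ∑ i, (w i : ℕ) = ∑ i, ℓ i := by
            rw [← Finset.sum_add_distrib]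
            exact Finset.sum_congr rfl fun i _ => Nat.sub_add_cancel (h2 i)
          rw [sum_perm] at h3; omega
        · simp [h0]
        · simp [h0, hw]
        · intro i hi; simp [hi]
      · rfl
    · have hw2 : (w 0 : ℕ) ≠ 0 := fun h => hw (Fin.ext h)
      have hw' : (0 : Fin (r+1)) ≠ w.symm 0 := fun h => hw ((Equiv.eq_symm_apply w).1 h)
      rw [tm, tm, if_neg, if_neg]
      · intro h; have := h 0; simp [h0, Pi.single_apply, hw'] at this; exact hw this
      · intro h; have := h 0; omega
  · intro s _ hs
    rw [if_neg]
    intro h; apply hs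
    have h : w s = 0 := by simpa using h
    rw [← h]; simp
  · simp

lemma JM_mem {A : Type*} [Ring A] [Algebra K A] {T : ℕ → A} (S : Subalgebra K A) {k : ℕ} (hS : ∀ i, i < k → T i ∈ S) :
    JM q T k ∈ S := by
  induction k with
  | zero => exact S.zero_mem
  | succ k ih =>
    have h1 := hS k (by omega)
    exact S.smul_mem (S.add_mem h1 (S.mul_mem (S.mul_mem h1 (ih (fun i hi => hS i (by omega)))) h1)) _

lemma JM_comm {A : Type*} [Ring A] [Algebra K A] {T : ℕ → A} {k : ℕ} {y : A} (hS : ∀ i, i < k → Commute y (T i)) :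
    Commute y (JM q T k) := by
  have : JM q T k ∈ Subalgebra.centralizer K {y} := by
    apply JM_mem
    intro i hi
    rw [Subalgebra.mem_centralizer_iff]
    intro g hg; rw [Set.mem_singleton_iff.1 hg]; exact (hS i hi).eq
  rw [Subalgebra.mem_centralizer_iff] at this
  exact this y rfl

lemma JM_comm_T (h : HRel q T N) (hq0 : q ≠ 0) {k : ℕ} (hk : k < N) (i : ℕ) (hi : i + 1 < k) : Commute (JM q T k) (T i) :=
  (JM_commute_lo h hq0 (by omega) hk).symm

lemma D_JM_pow [CharZero K] (h : HRel q T N) (hq0 : q ≠ 0) (hq : ∀ k, 1 ≤ k → qi q k ≠ 0) (hk : k + 1 ≤ N)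
    (ℓ : Fin (r+1) → ℕ) (h0 : ℓ 0 = 0)
    (hℓ : ∑ i, ℓ i = k + ∑ i : Fin (r+1), (i : ℕ)) (m : ℕ) :
    ∀ f : Module.End K W, (∀ i, i + 1 < k + 1 → Commute f (T i)) →
    D q T (f * JM q T k ^ m) ℓ = ∑ s, ct q (r+1) (ℓ s) ^ m * D q T f (ℓ + Pi.single s 1) := by
  induction m with
  | zero => intro f hf; simp only [pow_zero, mul_one, one_mul]; exact branch h hq0 hk hf ℓ h0 hℓ
  | succ m ih =>
    intro f hf
    have hZ : Zs q T (k+1) = Zs q T k + JM q T k := Finset.sum_range_succ _ _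
    have hc : Commute (Zs q T (k+1)) (JM q T k) := JM_comm (fun i hi => (Zs_commute h hq0 (by omega) hk).symm)
    have e : f * JM q T k ^ (m+1) = (f * Zs q T (k+1)) * JM q T k ^ m - (f * JM q T k ^ m) * Zs q T k := by
      rw [mul_assoc f (Zs q T (k+1)), (hc.pow_right m).eq, hZ, pow_succ]
      noncomm_ring
    rw [e, D_sub, ih _ (fun i hi => (hf i hi).mul_left (Zs_commute h hq0 (by omega) hk).symm),
      D_Zs h hq0 hq (by omega) (fun i hi => (hf i (by omega)).mul_left ((JM_comm_T h hq0 (by omega) i hi).pow_left m)) ℓ hℓ, ih f hf,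
      Finset.mul_sum, ← Finset.sum_sub_distrib]
    refine Finset.sum_congr rfl fun s _ => ?_
    rw [D_Zs h hq0 hq hk hf, ev_add hq0]
    · ring
    · have := sum_add_single' (fun a => (a : ℤ)) ℓ s
      zify at hℓ ⊢
      rw [this]; push_cast; linarith

lemma D_JM_poly [CharZero K] (h : HRel q T N) (hq0 : q ≠ 0) (hq : ∀ k, 1 ≤ k → qi q k ≠ 0) (hk : k + 1 ≤ N)
    (ℓ : Fin (r+1) → ℕ) (h0 : ℓ 0 = 0)
    (hℓ : ∑ i, ℓ i = k + ∑ i : Fin (r+1), (i : ℕ)) (p : Polynomial K)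
    (f : Module.End K W) (hf : ∀ i, i + 1 < k + 1 → Commute f (T i)) :
    D q T (f * Polynomial.aeval (JM q T k) p) ℓ = ∑ s, p.eval (ct q (r+1) (ℓ s)) * D q T f (ℓ + Pi.single s 1) := by
  induction p using Polynomial.induction_on' with
  | add p1 p2 h1 h2 =>
    simp only [map_add, mul_add, D_add, h1, h2, Polynomial.eval_add, add_mul, Finset.sum_add_distrib]
  | monomial n a =>
    rw [Polynomial.aeval_monomial, ← Algebra.smul_def, mul_smul_comm, D_smul, D_JM_pow h hq0 hq hk ℓ h0 hℓ n f hf, Finset.mul_sum]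
    refine Finset.sum_congr rfl fun s _ => ?_
    rw [Polynomial.eval_monomial]; ring

lemma exists_idem_poly [FiniteDimensional K W] (J : Module.End K W) (d : K) (S : Finset K) (hd : d ∉ S) :
    ∃ p : Polynomial K, p.eval d = 1 ∧ (∀ c ∈ S, p.eval c = 0) ∧ IsIdempotentElem (Polynomial.aeval J p) := by
  set P : Polynomial K := minpoly K J * ((Polynomial.X - Polynomial.C d) * ∏ c ∈ S, (Polynomial.X - Polynomial.C c)) with hP
  have hJ : IsIntegral K J := Algebra.IsIntegral.isIntegral J
  have hP0 : P ≠ 0 := by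
    rw [hP]
    exact mul_ne_zero (minpoly.ne_zero hJ) (mul_ne_zero (Polynomial.X_sub_C_ne_zero d)
      (Finset.prod_ne_zero_iff.2 fun c _ => Polynomial.X_sub_C_ne_zero c))
  have hPJ : Polynomial.aeval J P = 0 := by rw [hP, map_mul, minpoly.aeval, zero_mul]
  have hn : 0 < P.rootMultiplicity d := by
    rw [Polynomial.rootMultiplicity_pos hP0, Polynomial.IsRoot, hP]; simp
  obtain ⟨Q, hQ, hQd⟩ := Polynomial.exists_eq_pow_rootMultiplicity_mul_and_not_dvd P hP0 d
  set n := P.rootMultiplicity d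
  have hcop : IsCoprime ((Polynomial.X - Polynomial.C d) ^ n) Q :=
    IsCoprime.pow_left ((Polynomial.irreducible_X_sub_C d).coprime_iff_not_dvd.2 hQd)
  obtain ⟨a, b, hab⟩ := hcop
  refine ⟨b * Q, ?_, ?_, ?_⟩
  · have := congrArg (Polynomial.eval d) hab
    simpa [hn.ne'] using this
  · intro c hc
    have h1 : P.eval c = 0 := by
      rw [hP, Polynomial.eval_mul, Polynomial.eval_mul, Polynomial.eval_prod, Finset.prod_eq_zero hc]
      · simp
      · simp
    rw [hQ] at h1
    have hcd : c - d ≠ 0 := sub_ne_zero.2 fun h => hd (h ▸ hc)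
    simp [hcd] at h1
    simp [h1]
  · rw [IsIdempotentElem, ← map_mul, ← sub_eq_zero, ← map_sub]
    have : b * Q * (b * Q) - b * Q = (- (a * b)) * P := by
      rw [hQ]; linear_combination (b * Q) * hab
    rw [this, map_mul, hPJ, mul_zero]

lemma D_rho (f : Module.End K W) : D q T f (fun i : Fin r => (i : ℕ)) = LinearMap.trace K W f := by
  rw [D, XX, Finset.sum_eq_single 1]
  · have : tl Finset.univ (fun i : Fin r => (i : ℕ) - ((1 : Equiv.Perm (Fin r)) i : ℕ)) = List.replicate r 0 := by
      rw [List.eq_replicate_iff]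
      constructor
      · simp [tl]
      · intro b hb; simp [tl] at hb; have h2 := hb.2; omega
    rw [this, if_pos (by simp)]
    have : ∀ (r : ℕ) (T : ℕ → Module.End K W), El q T (List.replicate r 0) = 1 := by
      intro r
      induction r with
      | zero => intro T; rfl
      | succ r ih => intro T; rw [List.replicate_succ, El_cons, ih]; show (1 : Module.End K W) * 1 = 1; simp
    rw [this]; simp
  · intro w _ hw
    rw [if_neg, smul_zero]
    intro h
    apply hw
    have hs : ∀ i ∈ Finset.univ, (w i : ℕ) = (i : ℕ) :=
      (Finset.sum_eq_sum_iff_of_le (fun i _ => h i)).1 (sum_perm w)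
    ext i; exact hs i (Finset.mem_univ i)
  · simp

lemma le_of_sm {ℓ : Fin r → ℕ} (hm : StrictMono ℓ) (i : Fin r) : (i : ℕ) ≤ ℓ i := by
  obtain ⟨i, hi⟩ := i
  induction i with
  | zero => simp
  | succ i ih =>
    have h1 := ih (by omega)
    have h2 : ℓ ⟨i, by omega⟩ < ℓ ⟨i+1, hi⟩ := hm (by simp)
    simp at *; omega

theorem D_nat [CharZero K] [FiniteDimensional K W] (h : HRel q T N) (hq0 : q ≠ 0) (hq : ∀ k, 1 ≤ k → qi q k ≠ 0) (k : ℕ) :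
    k ≤ N → ∀ (e : Module.End K W), IsIdempotentElem e → (∀ i, i + 1 < k → Commute e (T i)) →
    ∀ ℓ : Fin (r+1) → ℕ, StrictMono ℓ → ℓ 0 = 0 → ∑ i, ℓ i = k + ∑ i : Fin (r+1), (i : ℕ) →
    ∃ n : ℕ, D q T e ℓ = n := by
  induction k with
  | zero =>
    intro _ e he _ ℓ hm h0 hℓ
    have h1 : ∀ i ∈ (Finset.univ : Finset (Fin (r+1))), (i : ℕ) = ℓ i :=
      (Finset.sum_eq_sum_iff_of_le (fun i _ => le_of_sm hm i)).1 (by omega)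
    have : ℓ = fun i : Fin (r+1) => (i : ℕ) := by funext i; exact (h1 i (Finset.mem_univ i)).symm
    rw [this, D_rho]
    exact ⟨_, (LinearMap.IsIdempotentElem.isProj_range e he).trace⟩
  | succ k ih =>
    intro hk e he hc ℓ hm h0 hℓ
    classical
    have hex : ∃ s, ℓ s ≠ (s : ℕ) := by
      by_contra! hcon
      have h5 : ∑ i, ℓ i = ∑ i : Fin (r+1), (i : ℕ) := Finset.sum_congr rfl (fun i _ => hcon i)
      omega
    have hex2 : ∃ s, ℓ s ≠ (s : ℕ) ∧ ∀ i < s, ℓ i = (i : ℕ) := by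
      have hne : (Finset.univ.filter (fun s => ℓ s ≠ (s : ℕ))).Nonempty := by
        obtain ⟨s, hs⟩ := hex; exact ⟨s, by simpa using hs⟩
      refine ⟨_, (Finset.mem_filter.1 (Finset.min'_mem _ hne)).2, ?_⟩
      intro i hi
      by_contra hcon
      exact absurd (Finset.min'_le _ i (by simpa using hcon)) (not_le.2 hi)
    obtain ⟨s, hs, hsm⟩ := hex2
    have hs1 : (s : ℕ) < ℓ s := lt_of_le_of_ne (le_of_sm hm s) (Ne.symm hs)
    have hs0 : s ≠ 0 := by rintro rfl; simp [h0] at hs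
    set ℓ' : Fin (r+1) → ℕ := fun i => if i = s then ℓ s - 1 else ℓ i with hℓ'
    have hadd : ℓ = ℓ' + Pi.single s 1 := by
      funext i
      by_cases hi : i = s
      · subst hi; simp [hℓ']; omega
      · simp [hℓ', hi]
    have hm' : StrictMono ℓ' := by
      intro i j hij
      simp only [hℓ']
      have := hm hij
      split_ifs with h1 h2 h2
      · subst h1; subst h2; exact absurd hij (lt_irrefl _)
      · subst h1; omega
      · subst h2; rw [hsm i hij]; have : (i : ℕ) < j := hij
        omega
      · exact this
    have h0' : ℓ' 0 = 0 := by simp only [hℓ']; rw [if_neg hs0.symm, h0]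
    have hsum' : ∑ i, ℓ' i = k + ∑ i : Fin (r+1), (i : ℕ) := by
      have := sum_add_single' (fun a => (a : ℤ)) ℓ' s
      rw [← hadd] at this
      zify at hℓ ⊢
      push_cast at *; linarith
    obtain ⟨p, hp1, hp2, hp3⟩ := exists_idem_poly (JM q T k) (ct q (r+1) (ℓ' s))
      ((Finset.univ.erase s).image (fun t => ct q (r+1) (ℓ' t))) (by
        intro hmem
        obtain ⟨t, ht, hte⟩ := Finset.mem_image.1 hmem
        exact (Finset.ne_of_mem_erase ht) (hm'.injective (ct_inj hq0 hq _ hte)))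
    have hD : D q T e ℓ = D q T (e * Polynomial.aeval (JM q T k) p) ℓ' := by
      rw [D_JM_poly h hq0 hq hk ℓ' h0' hsum' p e hc, Finset.sum_eq_single s]
      · rw [hp1, one_mul, ← hadd]
      · intro t _ hts
        rw [hp2 _ (Finset.mem_image.2 ⟨t, Finset.mem_erase.2 ⟨hts, Finset.mem_univ _⟩, rfl⟩), zero_mul]
      · simp
    rw [hD]
    have hcomm : Commute e (Polynomial.aeval (JM q T k) p) := by
      have h1 : Commute (JM q T k) e := (JM_comm (fun i hi => hc i (by omega))).symm
      have := Polynomial.aeval_mem_adjoin_singleton K (JM q T k) (p := p)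
      have h2 : Algebra.adjoin K {JM q T k} ≤ Subalgebra.centralizer K {e} := by
        rw [Algebra.adjoin_le_iff]
        intro x hx
        rw [Set.mem_singleton_iff.1 hx, SetLike.mem_coe, Subalgebra.mem_centralizer_iff]
        intro g hg; rw [Set.mem_singleton_iff.1 hg]; exact h1.symm.eq
      exact (Subalgebra.mem_centralizer_iff K).1 (h2 this) e rfl
    refine ih (by omega) _ (he.mul_of_commute hcomm hp3) ?_ ℓ' hm' h0' hsum'
    intro i hi
    refine (hc i (by omega)).mul_left ?_
    have h1 : Commute (JM q T k) (T i) := JM_comm_T h hq0 (by omega) i hi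
    have := Polynomial.aeval_mem_adjoin_singleton K (JM q T k) (p := p)
    have h2 : Algebra.adjoin K {JM q T k} ≤ Subalgebra.centralizer K {T i} := by
      rw [Algebra.adjoin_le_iff]
      intro x hx
      rw [Set.mem_singleton_iff.1 hx, SetLike.mem_coe, Subalgebra.mem_centralizer_iff]
      intro g hg; rw [Set.mem_singleton_iff.1 hg]; exact h1.symm.eq
    exact ((Subalgebra.mem_centralizer_iff K).1 (h2 this) (T i) rfl).symm

end HeckeC
end HeckeTP

set_option linter.unusedSectionVars false
set_option linter.unusedSimpArgs false
set_option linter.unusedVariables false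
namespace HeckeTP
open TensorProduct

section HeckeD
variable {K : Type*} [Field K] {V : Type*} [AddCommGroup V] [Module K V]
variable {P : ℕ → Type*} [∀ n, AddCommGroup (P n)] [∀ n, Module K (P n)]
variable (c : ∀ n, V ⊗[K] P n ≃ₗ[K] P (n+1))

lemma E_map {A B : Type*} [Ring A] [Algebra K A] [Ring B] [Algebra K B] (φ : A →ₐ[K] B) {q : K} {T : ℕ → A} {T' : ℕ → B} (n : ℕ)
    (h : ∀ i, i + 1 < n → φ (T i) = T' i) : φ (E q T n) = E q T' n := by
  induction n with
  | zero => simp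
  | succ n ih =>
    obtain _ | n := n
    · simp
    have h1 := ih fun i hi => h i (by omega)
    rw [E_two, E_two, map_smul, map_sub, map_smul, map_smul, map_mul, map_mul, h1, h n (by omega)]

lemma El_map {A B : Type*} [Ring A] [Algebra K A] [Ring B] [Algebra K B] (φ : A →ₐ[K] B) {q : K} (l : List ℕ) :
    ∀ {T : ℕ → A} {T' : ℕ → B} (h : ∀ i, φ (T i) = T' i), φ (El q T l) = El q T' l := by
  induction l with
  | nil => intro T T' h; simp
  | cons a l ih =>
    intro T T' h
    rw [El_cons, El_cons, map_mul, E_map φ a (fun i _ => h i), ih (T := sh a T) (T' := sh a T') (fun i => h _)]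

/-- `1 ⊗ f` -/
noncomputable def J (n : ℕ) : Module.End K (P n) →ₐ[K] Module.End K (P (n+1)) :=
  ((c n).conjAlgEquiv K).toAlgHom.comp (Module.End.lTensorAlgHom K (P n) V)

/-- `y ⊗ 1` on the first two factors -/
noncomputable def c2 (n : ℕ) : (V ⊗[K] V) ⊗[K] P n ≃ₗ[K] P (n+2) :=
  (TensorProduct.assoc K V V (P n)).trans ((LinearEquiv.lTensor V (c n)).trans (c (n+1)))

noncomputable def H (n : ℕ) : Module.End K (V ⊗[K] V) →ₐ[K] Module.End K (P (n+2)) :=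
  ((c2 c n).conjAlgEquiv K).toAlgHom.comp (Module.End.rTensorAlgHom K (V ⊗[K] V) (P n))

lemma J_apply (n : ℕ) (f : Module.End K (P n)) (v : V) (x : P n) : J c n f (c n (v ⊗ₜ x)) = c n (v ⊗ₜ f x) := by
  simp [J, LinearEquiv.conjAlgEquiv_apply, Module.End.lTensorAlgHom]; rfl

lemma H_apply (n : ℕ) (f : Module.End K (V ⊗[K] V)) (z : V ⊗[K] V) (x : P n) : H c n f (c2 c n (z ⊗ₜ x)) = c2 c n (f z ⊗ₜ x) := by
  simp [H, LinearEquiv.conjAlgEquiv_apply, Module.End.rTensorAlgHom]; rfl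

lemma c2_apply (n : ℕ) (u v : V) (x : P n) : c2 c n ((u ⊗ₜ v) ⊗ₜ x) = c (n+1) (u ⊗ₜ c n (v ⊗ₜ x)) := by
  simp [c2]

lemma ext1 {n : ℕ} {Q : Type*} [AddCommGroup Q] [Module K Q] {f g : P (n+1) →ₗ[K] Q}
    (h : ∀ v x, f (c n (v ⊗ₜ x)) = g (c n (v ⊗ₜ x))) : f = g := by
  have : f ∘ₗ (c n).toLinearMap = g ∘ₗ (c n).toLinearMap := TensorProduct.ext' h
  ext y
  have := LinearMap.congr_fun this ((c n).symm y)
  simpa using this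

lemma ext2 {n : ℕ} {Q : Type*} [AddCommGroup Q] [Module K Q] {f g : P (n+2) →ₗ[K] Q}
    (h : ∀ z x, f (c2 c n (z ⊗ₜ x)) = g (c2 c n (z ⊗ₜ x))) : f = g := by
  have : f ∘ₗ (c2 c n).toLinearMap = g ∘ₗ (c2 c n).toLinearMap := TensorProduct.ext' h
  ext y
  have := LinearMap.congr_fun this ((c2 c n).symm y)
  simpa using this

lemma JJ_apply (n : ℕ) (f : Module.End K (P n)) (z : V ⊗[K] V) (x : P n) :
    J c (n+1) (J c n f) (c2 c n (z ⊗ₜ x)) = c2 c n (z ⊗ₜ f x) := by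
  induction z with
  | zero => simp
  | tmul u v => rw [c2_apply, c2_apply, J_apply, J_apply]
  | add a b ha hb => rw [TensorProduct.add_tmul, TensorProduct.add_tmul, map_add, map_add, ha, hb, map_add]

lemma H_JJ (n : ℕ) (y : Module.End K (V ⊗[K] V)) (f : Module.End K (P n)) : Commute (H c n y) (J c (n+1) (J c n f)) := by
  apply ext2 c
  intro z x
  simp only [Module.End.mul_apply, JJ_apply, H_apply]

variable (R : V ⊗[K] V →ₗ[K] V ⊗[K] V)

noncomputable def TT : (n : ℕ) → ℕ → Module.End K (P n)
  | 0, _ => -1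
  | 1, 0 => -1
  | n+2, 0 => H c n R
  | n+1, i+1 => J c n (TT n i)

lemma TT_succ (n i : ℕ) : TT c R (n+1) (i+1) = J c n (TT c R n i) := by
  cases n <;> rfl

noncomputable def c3 (n : ℕ) : ((V ⊗[K] V) ⊗[K] V) ⊗[K] P n ≃ₗ[K] P (n+3) :=
  (TensorProduct.assoc K (V ⊗[K] V) V (P n)).trans ((LinearEquiv.lTensor (V ⊗[K] V) (c n)).trans (c2 c (n+1)))

lemma c3_apply (n : ℕ) (z : V ⊗[K] V) (v : V) (x : P n) : c3 c n ((z ⊗ₜ v) ⊗ₜ x) = c2 c (n+1) (z ⊗ₜ c n (v ⊗ₜ x)) := by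
  simp [c3]

noncomputable def H3 (n : ℕ) : Module.End K ((V ⊗[K] V) ⊗[K] V) →ₐ[K] Module.End K (P (n+3)) :=
  ((c3 c n).conjAlgEquiv K).toAlgHom.comp (Module.End.rTensorAlgHom K ((V ⊗[K] V) ⊗[K] V) (P n))

lemma H3_apply (n : ℕ) (f : Module.End K ((V ⊗[K] V) ⊗[K] V)) (z : (V ⊗[K] V) ⊗[K] V) (x : P n) :
    H3 c n f (c3 c n (z ⊗ₜ x)) = c3 c n (f z ⊗ₜ x) := by
  simp [H3, LinearEquiv.conjAlgEquiv_apply, Module.End.rTensorAlgHom]; rfl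

lemma H3_left (n : ℕ) : H3 c n (LinearMap.rTensor V R) = H c (n+1) R := by
  apply ext2 c
  intro z y
  obtain ⟨y, rfl⟩ := (c n).surjective y
  induction y with
  | zero => simp
  | tmul v x => rw [← c3_apply, H3_apply, LinearMap.rTensor_tmul, c3_apply, c3_apply, H_apply]
  | add a b ha hb => simp only [map_add, TensorProduct.tmul_add] at *; rw [ha, hb]

lemma c3_assoc (n : ℕ) (u : V) (z : V ⊗[K] V) (x : P n) :
    c3 c n (((TensorProduct.assoc K V V V).symm (u ⊗ₜ z)) ⊗ₜ x) = c (n+2) (u ⊗ₜ c2 c n (z ⊗ₜ x)) := by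
  induction z with
  | zero => simp
  | tmul v w => rw [TensorProduct.assoc_symm_tmul, c3_apply, c2_apply, c2_apply]
  | add a b ha hb => simp only [map_add, TensorProduct.tmul_add, TensorProduct.add_tmul] at *; rw [ha, hb]

lemma H3_right (n : ℕ) : H3 c n ((TensorProduct.assoc K V V V).symm.toLinearMap ∘ₗ LinearMap.lTensor V R ∘ₗ
      (TensorProduct.assoc K V V V).toLinearMap) = J c (n+2) (H c n R) := by
  apply ext1 c
  intro u y
  obtain ⟨y, rfl⟩ := (c2 c n).surjective y
  induction y with
  | zero => simp
  | tmul z x =>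
    rw [← c3_assoc, H3_apply]
    simp only [LinearMap.comp_apply, LinearEquiv.coe_coe, LinearEquiv.apply_symm_apply, LinearMap.lTensor_tmul]
    rw [c3_assoc, c3_assoc, J_apply, H_apply]
  | add a b ha hb => simp only [map_add, TensorProduct.tmul_add] at *; rw [ha, hb]

lemma TT_HRel {q : K} (hR : IsHecke K V q R) (n : ℕ) : HRel q (TT c R n) n := by
  obtain ⟨hyb, hh⟩ := hR
  have hquad : (R : Module.End K (V ⊗[K] V)) * R = (q - 1) • R + q • (1 : Module.End K (V ⊗[K] V)) := by
    have h1 : ((R : Module.End K (V ⊗[K] V)) + 1) * (R - q • (1 : Module.End K (V ⊗[K] V))) = 0 := hh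
    have h2 : ((R : Module.End K (V ⊗[K] V)) + 1) * (R - q • (1 : Module.End K (V ⊗[K] V))) = R * R - (q - 1) • R - q • (1 : Module.End K (V ⊗[K] V)) := by
      rw [add_mul, mul_sub, mul_smul_comm, mul_one, one_mul]; module
    rw [h2] at h1
    rw [sub_sub, sub_eq_zero] at h1; exact h1
  have hneg : ∀ n, (-1 : Module.End K (P n)) * -1 = (q-1) • (-1) + q • 1 := by
    intro n; simp [sub_smul]
  induction n with
  | zero =>
    refine ⟨fun i => ?_, fun i j _ => rfl, fun i hi => by omega⟩
    rw [TT]; exact hneg 0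
  | succ n ih =>
    refine ⟨fun i => ?_, fun i j hij => ?_, fun i hi => ?_⟩
    · obtain _ | i := i
      · obtain _ | n := n
        · rw [TT]; exact hneg 1
        · rw [TT, ← map_mul, hquad]; simp
      · rw [TT_succ, ← map_mul, ih.quad]; simp
    · obtain ⟨j, rfl⟩ : ∃ j', j = j' + 1 := ⟨j - 1, by omega⟩
      obtain _ | i := i
      · obtain _ | n := n
        · rw [TT]; simp
        · obtain ⟨j, rfl⟩ : ∃ j', j = j' + 1 := ⟨j - 1, by omega⟩
          rw [TT_succ, TT_succ, TT]
          exact H_JJ c n R _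
      · rw [TT_succ, TT_succ, ← map_mul, ih.comm i j (by omega), map_mul]
    · obtain _ | i := i
      · obtain ⟨n, rfl⟩ : ∃ n', n = n' + 2 := ⟨n - 2, by omega⟩
        rw [TT_succ, TT, TT, ← H3_left, ← H3_right, ← map_mul, ← map_mul, ← map_mul, ← map_mul]
        congr 1
      · rw [TT_succ, TT_succ, ← map_mul, ← map_mul, ih.braid i (by omega), map_mul, map_mul]

variable (c0 : K ≃ₗ[K] P 0)

/-- splitting -/
noncomputable def spl (m : ℕ) : (a : ℕ) → P a ⊗[K] P m ≃ₗ[K] P (m + a)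
  | 0 => (LinearEquiv.rTensor (P m) c0.symm).trans (TensorProduct.lid K (P m))
  | a+1 => ((LinearEquiv.rTensor (P m) (c a).symm).trans (TensorProduct.assoc K V (P a) (P m))).trans
      ((LinearEquiv.lTensor V (spl m a)).trans (c (m + a)))

lemma spl_succ (m a : ℕ) (v : V) (x : P a) (y : P m) :
    spl c c0 m (a+1) (c a (v ⊗ₜ x) ⊗ₜ y) = c (m+a) (v ⊗ₜ spl c c0 m a (x ⊗ₜ y)) := by
  simp [spl]

noncomputable def sL (m a : ℕ) : Module.End K (P a) →ₐ[K] Module.End K (P (m + a)) :=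
  ((spl c c0 m a).conjAlgEquiv K).toAlgHom.comp (Module.End.rTensorAlgHom K (P a) (P m))
noncomputable def sR (m a : ℕ) : Module.End K (P m) →ₐ[K] Module.End K (P (m + a)) :=
  ((spl c c0 m a).conjAlgEquiv K).toAlgHom.comp (Module.End.lTensorAlgHom K (P m) (P a))

lemma sL_apply (m a : ℕ) (f : Module.End K (P a)) (x : P a) (y : P m) :
    sL c c0 m a f (spl c c0 m a (x ⊗ₜ y)) = spl c c0 m a (f x ⊗ₜ y) := by
  simp [sL, LinearEquiv.conjAlgEquiv_apply, Module.End.rTensorAlgHom]; rfl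
lemma sR_apply (m a : ℕ) (f : Module.End K (P m)) (x : P a) (y : P m) :
    sR c c0 m a f (spl c c0 m a (x ⊗ₜ y)) = spl c c0 m a (x ⊗ₜ f y) := by
  simp [sR, LinearEquiv.conjAlgEquiv_apply, Module.End.lTensorAlgHom]; rfl

lemma ext_spl {m a : ℕ} {Q : Type*} [AddCommGroup Q] [Module K Q] {f g : P (m+a) →ₗ[K] Q}
    (h : ∀ x y, f (spl c c0 m a (x ⊗ₜ y)) = g (spl c c0 m a (x ⊗ₜ y))) : f = g := by
  have : f ∘ₗ (spl c c0 m a).toLinearMap = g ∘ₗ (spl c c0 m a).toLinearMap := TensorProduct.ext' h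
  ext y
  have := LinearMap.congr_fun this ((spl c c0 m a).symm y)
  simpa using this

lemma sL_J (m a : ℕ) (f : Module.End K (P a)) : sL c c0 m (a+1) (J c a f) = J c (m+a) (sL c c0 m a f) := by
  apply ext_spl c c0 (m := m) (a := a+1)
  intro x y
  obtain ⟨x, rfl⟩ := (c a).surjective x
  induction x with
  | zero => simp
  | tmul v x =>
    rw [sL_apply, J_apply, spl_succ, spl_succ]
    erw [J_apply]
    rw [sL_apply]
  | add x1 x2 h1 h2 => simp only [map_add, TensorProduct.add_tmul] at *; rw [h1, h2]

lemma sR_J (m a : ℕ) (f : Module.End K (P m)) : sR c c0 m (a+1) f = J c (m+a) (sR c c0 m a f) := by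
  apply ext_spl c c0 (m := m) (a := a+1)
  intro x y
  obtain ⟨x, rfl⟩ := (c a).surjective x
  induction x with
  | zero => simp
  | tmul v x =>
    rw [sR_apply, spl_succ, spl_succ]
    erw [J_apply]
    rw [sR_apply]
  | add x1 x2 h1 h2 => simp only [map_add, TensorProduct.add_tmul] at *; rw [h1, h2]

lemma spl_c2 (m a : ℕ) (z : V ⊗[K] V) (x : P a) (y : P m) :
    spl c c0 m (a+2) (c2 c a (z ⊗ₜ x) ⊗ₜ y) = c2 c (m+a) (z ⊗ₜ spl c c0 m a (x ⊗ₜ y)) := by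
  induction z with
  | zero => simp
  | tmul u v => rw [c2_apply, c2_apply, spl_succ, spl_succ]; rfl
  | add a b ha hb => simp only [map_add, TensorProduct.tmul_add, TensorProduct.add_tmul] at *; rw [ha, hb]

lemma sL_H (m a : ℕ) (f : Module.End K (V ⊗[K] V)) : sL c c0 m (a+2) (H c a f) = H c (m+a) f := by
  apply ext_spl c c0 (m := m) (a := a+2)
  intro x y
  obtain ⟨x, rfl⟩ := (c2 c a).surjective x
  induction x with
  | zero => simp
  | tmul v x =>
    rw [sL_apply, H_apply, spl_c2, spl_c2]
    erw [H_apply]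
  | add x1 x2 h1 h2 => simp only [map_add, TensorProduct.add_tmul] at *; rw [h1, h2]

lemma sL_TT (m a : ℕ) : ∀ i, i + 1 < a → sL c c0 m a (TT c R a i) = TT c R (m + a) i := by
  induction a with
  | zero => intro i hi; omega
  | succ a ih =>
    intro i hi
    obtain _ | i := i
    · obtain ⟨a, rfl⟩ : ∃ a', a = a' + 1 := ⟨a - 1, by omega⟩
      rw [TT, sL_H]; rfl
    · rw [TT_succ, sL_J, ih i (by omega)]; exact (TT_succ c R (m+a) i).symm

lemma sR_TT (m a : ℕ) : ∀ i, sR c c0 m a (TT c R m i) = TT c R (m + a) (a + i) := by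
  induction a with
  | zero =>
    intro i
    apply ext_spl c c0 (m := m) (a := 0)
    intro x y
    rw [sR_apply]
    simp [spl]
  | succ a ih =>
    intro i
    rw [sR_J, ih, show a + 1 + i = (a + i) + 1 by ring]
    exact (TT_succ c R (m+a) (a+i)).symm

lemma trace_sL_sR (m a : ℕ) [FiniteDimensional K (P a)] [FiniteDimensional K (P m)] (f : Module.End K (P a)) (g : Module.End K (P m)) :
    LinearMap.trace K _ (sL c c0 m a f * sR c c0 m a g) = LinearMap.trace K _ f * LinearMap.trace K _ g := by
  have : sL c c0 m a f * sR c c0 m a g = (spl c c0 m a).conj (TensorProduct.map f g) := by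
    apply ext_spl c c0
    intro x y
    rw [Module.End.mul_apply, sR_apply, sL_apply]
    simp [LinearEquiv.conj_apply]
  rw [this, LinearMap.trace_conj', LinearMap.trace_tensorProduct']

lemma trace_El (c0 : K ≃ₗ[K] P 0) [∀ n, FiniteDimensional K (P n)] {q : K} (l : List ℕ) : ∀ n, n = l.sum →
    LinearMap.trace K _ (El q (TT c R n) l) = (l.map (fun a => LinearMap.trace K _ (E q (TT c R a) a))).prod := by
  induction l with
  | nil =>
    intro n hn
    simp at hn; subst hn
    rw [El_nil, LinearMap.trace_one, ← c0.finrank_eq]; simp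
  | cons a l ih =>
    intro n hn
    obtain ⟨m, rfl⟩ : ∃ m, n = m + a := ⟨l.sum, by rw [hn]; simp [add_comm]⟩
    have hm : m = l.sum := by simp at hn; omega
    rw [El_cons, ← E_map (sL c c0 m a) a (sL_TT c R c0 m a), ← El_map (sR c c0 m a) (T := TT c R m) (T' := sh a (TT c R (m+a))) l (fun i => (sR_TT c R c0 m a i).trans (by simp [sh])), trace_sL_sR, ih m hm]
    simp

end HeckeD
end HeckeTP

set_option linter.unusedSectionVars false
set_option linter.unusedSimpArgs false
set_option linter.unusedVariables false
namespace HeckeTP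
open TensorProduct

section HeckeD2
variable {K : Type*} [Field K] {V : Type*} [AddCommGroup V] [Module K V]
variable {P : ℕ → Type*} [∀ n, AddCommGroup (P n)] [∀ n, Module K (P n)]
variable (c : ∀ n, V ⊗[K] P n ≃ₗ[K] P (n+1)) (c0 : K ≃ₗ[K] P 0)
variable (R : V ⊗[K] V →ₗ[K] V ⊗[K] V)

noncomputable def jj : (n : ℕ) → P n →ₗ[K] TensorAlgebra K V
  | 0 => (Algebra.linearMap K (TensorAlgebra K V)) ∘ₗ c0.symm.toLinearMap
  | n+1 => (LinearMap.mul' K (TensorAlgebra K V) ∘ₗ TensorProduct.map (TensorAlgebra.ι K) (jj n)) ∘ₗ (c n).symm.toLinearMap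

lemma jj_succ (n : ℕ) (v : V) (x : P n) : jj c c0 (n+1) (c n (v ⊗ₜ x)) = TensorAlgebra.ι K v * jj c c0 n x := by
  simp [jj]

lemma range_jj (n : ℕ) : LinearMap.range (jj c c0 n) = LinearMap.range (TensorAlgebra.ι K (M := V)) ^ n := by
  induction n with
  | zero =>
    rw [pow_zero, jj, LinearMap.range_comp_of_range_eq_top _ (LinearEquiv.range _), Submodule.one_eq_range]
  | succ n ih =>
    rw [pow_succ', ← ih]
    apply le_antisymm
    · rintro _ ⟨x, rfl⟩
      obtain ⟨x, rfl⟩ := (c n).surjective x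
      induction x with
      | zero => simp
      | tmul v x =>
        rw [jj_succ]
        exact Submodule.mul_mem_mul ⟨v, rfl⟩ ⟨x, rfl⟩
      | add x y hx hy => rw [map_add, map_add]; exact add_mem hx hy
    · rw [Submodule.mul_le]
      rintro _ ⟨v, rfl⟩ _ ⟨x, rfl⟩
      exact ⟨_, jj_succ c c0 n v x⟩

lemma jj_c2 (n : ℕ) (z : V ⊗[K] V) (x : P n) : jj c c0 (n+2) (c2 c n (z ⊗ₜ x)) = quadMul K V z * jj c c0 n x := by
  induction z with
  | zero => simp
  | tmul u v => rw [c2_apply, jj_succ, jj_succ, ← mul_assoc]; simp [quadMul]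
  | add a b ha hb => rw [TensorProduct.add_tmul, map_add, map_add, ha, hb, map_add, add_mul]

noncomputable abbrev pi' : TensorAlgebra K V →ₐ[K] RingQuot (quadRel K V (LinearMap.range (R + LinearMap.id))) :=
  RingQuot.mkAlgHom K (quadRel K V (LinearMap.range (R + LinearMap.id)))

lemma pi'_quad (z : V ⊗[K] V) : pi' R (quadMul K V (R z + z)) = 0 := by
  have h : quadRel K V (LinearMap.range (R + LinearMap.id)) (quadMul K V (R z + z)) 0 :=
    ⟨rfl, _, ⟨z, rfl⟩, rfl⟩
  have := RingQuot.mkAlgHom_rel K h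
  rw [map_zero] at this
  exact this

lemma pij_TT (n : ℕ) : ∀ i, i + 1 < n → ∀ x, pi' R (jj c c0 n (TT c R n i x + x)) = 0 := by
  induction n with
  | zero => intro i hi; omega
  | succ n ih =>
    intro i hi x
    obtain _ | i := i
    · obtain ⟨n, rfl⟩ : ∃ n', n = n' + 1 := ⟨n - 1, by omega⟩
      rw [TT]
      obtain ⟨x, rfl⟩ := (c2 c n).surjective x
      induction x with
      | zero => simp
      | tmul z x => rw [H_apply, ← map_add, ← TensorProduct.add_tmul, jj_c2, map_mul, pi'_quad, zero_mul]
      | add x y hx hy =>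
        rw [map_add (c2 c n), map_add (H c n R), add_add_add_comm, map_add (jj c c0 _), map_add (pi' R), hx, hy, add_zero]
    · rw [TT_succ]
      obtain ⟨x, rfl⟩ := (c n).surjective x
      induction x with
      | zero => simp
      | tmul z x => rw [J_apply, ← map_add, ← TensorProduct.tmul_add, jj_succ, map_mul, ih i (by omega), mul_zero]
      | add x y hx hy =>
        rw [map_add (c n), map_add (J c n _), add_add_add_comm, map_add (jj c c0 _), map_add (pi' R), hx, hy, add_zero]

lemma ker1 {q : K} (hq : ∀ k, 1 ≤ k → qi q k ≠ 0) (n : ℕ) (x : P n) (hx : E q (TT c R n) n x = 0) :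
    pi' R (jj c c0 n x) = 0 := by
  let F := (pi' R).toLinearMap ∘ₗ jj c c0 n
  obtain ⟨s, hs⟩ := (LinearMap.ker F).mkQ.exists_rightInverse_of_surjective (LinearMap.range_eq_top.2 (Submodule.mkQ_surjective _))
  let G : Module.End K (P n) := s ∘ₗ (LinearMap.ker F).mkQ
  have hG : ∀ i, i + 1 < n → G * TT c R n i = - G := by
    intro i hi
    ext y
    have : (LinearMap.ker F).mkQ (TT c R n i y) = (LinearMap.ker F).mkQ (-y) := by
      rw [Submodule.mkQ_apply, Submodule.mkQ_apply, Submodule.Quotient.eq, LinearMap.mem_ker]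
      rw [sub_neg_eq_add]
      exact pij_TT c c0 R n i hi y
    simp only [G, Module.End.mul_apply, LinearMap.comp_apply, LinearMap.neg_apply, this, map_neg]
  have h1 := mul_E_of hq n G hG
  have h2 : G x = 0 := by rw [← h1, Module.End.mul_apply, hx, map_zero]
  have h3 : (LinearMap.ker F).mkQ x = 0 := by
    have := LinearMap.congr_fun hs ((LinearMap.ker F).mkQ x)
    rw [← LinearMap.id_apply (R := K) ((LinearMap.ker F).mkQ x), ← this]
    change (LinearMap.ker F).mkQ (G x) = 0
    rw [h2, map_zero]
  rw [Submodule.mkQ_apply, Submodule.Quotient.mk_eq_zero] at h3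
  exact h3

/-- action of `V` on the sum of the `P n` -/
noncomputable def actAux (q : K) (v : V) : (∀ n, P n) →ₗ[K] (∀ n, P n) :=
  LinearMap.pi fun n => match n with
  | 0 => 0
  | n+1 => (E q (TT c R (n+1)) (n+1)) ∘ₗ (c n).toLinearMap ∘ₗ (TensorProduct.mk K V (P n) v) ∘ₗ LinearMap.proj n

noncomputable def act (q : K) : V →ₗ[K] Module.End K (∀ n, P n) where
  toFun v := actAux c R q v
  map_add' u v := by
    apply LinearMap.ext; intro y; funext n
    cases n <;> simp [actAux]
  map_smul' a v := by
    apply LinearMap.ext; intro y; funext n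
    cases n <;> simp [actAux]

lemma act_zero (q : K) (v : V) (y : ∀ n, P n) : act c R q v y 0 = 0 := by
  simp [act, actAux]
lemma act_succ (q : K) (v : V) (y : ∀ n, P n) (n : ℕ) :
    act c R q v y (n+1) = E q (TT c R (n+1)) (n+1) (c n (v ⊗ₜ y n)) := by
  simp [act, actAux]

lemma J_E {q : K} (n : ℕ) : J c n (E q (TT c R n) n) = E q (sh 1 (TT c R (n+1))) n :=
  E_map _ _ fun i _ => by rw [sh, add_comm 1 i, TT_succ]

lemma E_JE {q : K} (hR : IsHecke K V q R) (hq : ∀ k, 1 ≤ k → qi q k ≠ 0) (n : ℕ) :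
    E q (TT c R (n+1)) (n+1) * J c n (E q (TT c R n) n) = E q (TT c R (n+1)) (n+1) := by
  rw [J_E]
  apply mul_E_of hq
  intro i hi
  exact (TT_HRel c R hR (n+1)).E_T hq le_rfl (by omega)

lemma lift_quad {q : K} (hR : IsHecke K V q R) (hq : ∀ k, 1 ≤ k → qi q k ≠ 0) (z : V ⊗[K] V) (y : ∀ n, P n) (n : ℕ) :
    TensorAlgebra.lift K (act c R q) (quadMul K V z) y (n+2) = E q (TT c R (n+2)) (n+2) (c2 c n (z ⊗ₜ y n)) := by
  induction z with
  | zero => simp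
  | tmul u v =>
    simp only [quadMul, LinearMap.comp_apply, TensorProduct.map_tmul, LinearMap.mul'_apply, map_mul, TensorAlgebra.lift_ι_apply, Module.End.mul_apply]
    rw [act_succ, act_succ, c2_apply, ← J_apply, ← Module.End.mul_apply, E_JE c R hR hq]
  | add a b ha hb =>
    rw [map_add, map_add, LinearMap.add_apply, Pi.add_apply, ha, hb, TensorProduct.add_tmul, map_add, map_add]

lemma lift_quad' {q : K} (z : V ⊗[K] V) (y : ∀ n, P n) :
    TensorAlgebra.lift K (act c R q) (quadMul K V z) y 0 = 0 ∧ TensorAlgebra.lift K (act c R q) (quadMul K V z) y 1 = 0 := by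
  induction z with
  | zero => simp
  | tmul u v =>
    simp only [quadMul, LinearMap.comp_apply, TensorProduct.map_tmul, LinearMap.mul'_apply, map_mul, TensorAlgebra.lift_ι_apply, Module.End.mul_apply]
    rw [act_zero, act_succ, act_zero]; simp
  | add a b ha hb =>
    rw [map_add, map_add, LinearMap.add_apply, Pi.add_apply, Pi.add_apply, ha.1, ha.2, hb.1, hb.2]; simp

lemma lift_rel {q : K} (hR : IsHecke K V q R) (hq : ∀ k, 1 ≤ k → qi q k ≠ 0) ⦃a b : TensorAlgebra K V⦄
    (h : quadRel K V (LinearMap.range (R + LinearMap.id)) a b) :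
    TensorAlgebra.lift K (act c R q) a = TensorAlgebra.lift K (act c R q) b := by
  obtain ⟨rfl, _, ⟨z, rfl⟩, rfl⟩ := h
  rw [map_zero]
  apply LinearMap.ext; intro y; funext n
  obtain _ | _ | n := n
  · exact (lift_quad' c R _ y).1
  · exact (lift_quad' c R _ y).2
  · rw [lift_quad c R hR hq]
    have h1 := (TT_HRel c R hR (n+2)).E_T (j := 0) hq le_rfl (by omega)
    have h2 := LinearMap.congr_fun h1 (c2 c n (z ⊗ₜ y n))
    rw [Module.End.mul_apply, TT, H_apply] at h2
    rw [LinearMap.add_apply, TensorProduct.add_tmul, map_add, map_add, h2]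
    simp

lemma lift_jj {q : K} (hR : IsHecke K V q R) (hq : ∀ k, 1 ≤ k → qi q k ≠ 0) (n : ℕ) (x : P n) :
    TensorAlgebra.lift K (act c R q) (jj c c0 n x) (Pi.single 0 (c0 1)) n = E q (TT c R n) n x := by
  induction n with
  | zero =>
    simp only [jj, LinearMap.comp_apply, Algebra.linearMap_apply, AlgHom.commutes, E_zero, Module.algebraMap_end_apply, Pi.smul_apply, Pi.single_eq_same]
    rw [← map_smul]; simp
  | succ n ih =>
    obtain ⟨x, rfl⟩ := (c n).surjective x
    induction x with
    | zero => simp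
    | tmul v x =>
      rw [jj_succ, map_mul, TensorAlgebra.lift_ι_apply, Module.End.mul_apply, act_succ, ih, ← J_apply, ← Module.End.mul_apply, E_JE c R hR hq]
    | add x y hx hy => simp only [map_add, LinearMap.add_apply, Pi.add_apply] at *; rw [hx, hy]

lemma ker2 {q : K} (hR : IsHecke K V q R) (hq : ∀ k, 1 ≤ k → qi q k ≠ 0) (n : ℕ) (x : P n)
    (hx : pi' R (jj c c0 n x) = 0) : E q (TT c R n) n x = 0 := by
  rw [← lift_jj c c0 R hR hq]
  let Φ := RingQuot.liftAlgHom K ⟨TensorAlgebra.lift K (act c R q), lift_rel c R hR hq⟩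
  have : Φ (pi' R (jj c c0 n x)) = TensorAlgebra.lift K (act c R q) (jj c c0 n x) :=
    RingQuot.liftAlgHom_mkAlgHom_apply ..
  rw [← this, hx, map_zero]; rfl

lemma lambda_eq_trace (c0 : K ≃ₗ[K] P 0) [∀ n, FiniteDimensional K (P n)] {q : K} (hR : IsHecke K V q R) (hq : ∀ k, 1 ≤ k → qi q k ≠ 0) (n : ℕ) :
    LinearMap.trace K _ (E q (TT c R n) n) = (lambdaDim K V R n : K) := by
  have hid : IsIdempotentElem (E q (TT c R n) n) := (TT_HRel c R hR n).E_idem hq le_rfl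
  rw [(LinearMap.IsIdempotentElem.isProj_range _ hid).trace]
  congr 1
  rw [lambdaDim, quadDim, ← range_jj c c0, ← LinearMap.range_comp]
  have h1 := LinearMap.finrank_range_add_finrank_ker (E q (TT c R n) n)
  have h2 := LinearMap.finrank_range_add_finrank_ker ((pi' R).toLinearMap ∘ₗ jj c c0 n)
  have h3 : LinearMap.ker (E q (TT c R n) n) = LinearMap.ker ((pi' R).toLinearMap ∘ₗ jj c c0 n) := by
    ext x
    exact ⟨ker1 c c0 R hq n x, ker2 c c0 R hR hq n x⟩
  rw [h3] at h1
  have := h1.trans h2.symm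
  exact Nat.add_right_cancel this

end HeckeD2
end HeckeTP

set_option linter.unusedSectionVars false
set_option linter.unusedSimpArgs false
set_option linter.unusedVariables false
namespace HeckeTP
open TensorProduct

/-- Toeplitz matrix entry -/
noncomputable def tp (a : ℕ → ℝ) (i j : ℕ) : ℝ := if j ≤ i then a (i - j) else 0

section HeckeD3
variable {K : Type*} [Field K] {V : Type*} [AddCommGroup V] [Module K V]

lemma straight_core [CharZero K] {P : ℕ → Type*} [∀ n, AddCommGroup (P n)] [∀ n, Module K (P n)] [∀ n, FiniteDimensional K (P n)]
    (c : ∀ n, V ⊗[K] P n ≃ₗ[K] P (n+1)) (c0 : K ≃ₗ[K] P 0)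
    (R : V ⊗[K] V →ₗ[K] V ⊗[K] V) {q : K} (hR : IsHecke K V q R) (hq0 : q ≠ 0) (hq : ∀ k, 1 ≤ k → qi q k ≠ 0)
    {r : ℕ} (ℓ : Fin (r+1) → ℕ) (hm : StrictMono ℓ) (h0 : ℓ 0 = 0) :
    0 ≤ (Matrix.of fun s t : Fin (r+1) => tp (fun n => (lambdaDim K V R n : ℝ)) (ℓ s) t).det := by
  let M : Matrix (Fin (r+1)) (Fin (r+1)) ℤ := Matrix.of fun s t => if (t : ℕ) ≤ ℓ s then (lambdaDim K V R (ℓ s - t) : ℤ) else 0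
  obtain ⟨k, hk⟩ : ∃ k, ∑ i, ℓ i = k + ∑ i : Fin (r+1), (i : ℕ) := by
    refine ⟨∑ i, ℓ i - ∑ i : Fin (r+1), (i : ℕ), (Nat.sub_add_cancel ?_).symm⟩
    exact Finset.sum_le_sum fun i _ => le_of_sm hm i
  obtain ⟨n, hn⟩ := D_nat (TT_HRel c R hR k) hq0 hq k le_rfl 1 (IsIdempotentElem.one) (fun i _ => Commute.one_left _) ℓ hm h0 hk
  have hdet : ((M.det : ℤ) : K) = n := by
    rw [← hn, D, one_mul, XX, map_sum, ← Matrix.det_transpose, Matrix.det_apply, Int.cast_sum]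
    refine Finset.sum_congr rfl fun w _ => ?_
    rw [map_smul, Units.smul_def, smul_eq_mul, smul_eq_mul, Int.cast_mul]
    congr 1
    split_ifs with h
    · rw [trace_El c R c0 _ k, tl, List.map_map, Finset.prod_map_toList, Int.cast_prod]
      · refine Finset.prod_congr rfl fun i _ => ?_
        simp only [M, Matrix.transpose_apply, Matrix.of_apply, if_pos (h i), Function.comp_apply]
        rw [lambda_eq_trace c R c0 hR hq]; simp
      · rw [tl_sum]
        have h2 : ∑ i, (ℓ i - (w i : ℕ)) + ∑ i, (w i : ℕ) = ∑ i, ℓ i := by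
          rw [← Finset.sum_add_distrib]
          exact Finset.sum_congr rfl fun i _ => Nat.sub_add_cancel (h i)
        rw [sum_perm] at h2; omega
    · push Not at h
      obtain ⟨i, hi⟩ := h
      rw [map_zero, Int.cast_eq_zero]
      apply Finset.prod_eq_zero (Finset.mem_univ i)
      simp only [M, Matrix.transpose_apply, Matrix.of_apply, if_neg (not_le.2 hi)]
  have h2 : M.det = n := by exact_mod_cast hdet
  have h3 : (Matrix.of fun s t : Fin (r+1) => tp (fun n => (lambdaDim K V R n : ℝ)) (ℓ s) t) = M.map (Int.cast : ℤ → ℝ) := by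
    ext s t
    simp only [M, Matrix.of_apply, Matrix.map_apply, tp]
    split_ifs <;> simp
  rw [h3]
  have h4 := (Int.castRingHom ℝ).map_det M
  simp only [RingHom.mapMatrix_apply, Int.coe_castRingHom] at h4
  rw [← h4, h2]
  simp

theorem straight [CharZero K] [FiniteDimensional K V]
    (R : V ⊗[K] V →ₗ[K] V ⊗[K] V) {q : K} (hR : IsHecke K V q R) (hq0 : q ≠ 0) (hq : ∀ k, 1 ≤ k → qi q k ≠ 0) :
    lambdaDim K V R 0 = 1 ∧ ∀ {r : ℕ} (ℓ : Fin r → ℕ) (hm : StrictMono ℓ),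
    0 ≤ (Matrix.of fun s t : Fin r => tp (fun n => (lambdaDim K V R n : ℝ)) (ℓ s) t).det := by
  let P : ℕ → Type _ := fun n => Fin (Module.finrank K V ^ n) → K
  have c : ∀ n, V ⊗[K] P n ≃ₗ[K] P (n+1) := fun n => LinearEquiv.ofFinrankEq _ _ (by
    simp [P, Module.finrank_tensorProduct, pow_succ'])
  have hP0 : Module.finrank K (P 0) = 1 := by
    change Module.finrank K (Fin (Module.finrank K V ^ 0) → K) = 1
    rw [Module.finrank_fin_fun, pow_zero]
  have c0 : K ≃ₗ[K] P 0 := LinearEquiv.ofFinrankEq _ _ (by rw [hP0, Module.finrank_self])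
  have hl0 : lambdaDim K V R 0 = 1 := by
    have := lambda_eq_trace c R c0 hR hq 0
    rw [E_zero, LinearMap.trace_one, hP0] at this
    exact_mod_cast this.symm
  refine ⟨hl0, ?_⟩
  intro r ℓ hm
  let ℓ' : Fin (r+1) → ℕ := Fin.cons 0 (fun i => ℓ i + 1)
  have hm' : StrictMono ℓ' := by
    rw [Fin.strictMono_iff_lt_succ]
    intro i
    obtain _ | r := r
    · exact i.elim0
    refine Fin.cases ?_ (fun i => ?_) i
    · simp [ℓ']
    · simp only [ℓ', Fin.cons_succ, ← Fin.succ_castSucc]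
      have := hm (Fin.castSucc_lt_succ (i := i))
      omega
  have key := straight_core c c0 R hR hq0 hq ℓ' hm' (by simp [ℓ'])
  rw [Matrix.det_succ_row_zero, Fin.sum_univ_succ, Finset.sum_eq_zero] at key
  · simp only [ℓ', Matrix.of_apply, Fin.cons_zero, Fin.val_zero, tp, le_refl, if_true, hl0, pow_zero, one_mul, add_zero, Nat.sub_self, Nat.cast_one] at key
    convert key using 2
    ext s t
    simp [tp]
  · intro t _
    simp [ℓ', tp]

end HeckeD3
end HeckeTP

set_option linter.unusedSectionVars false
set_option linter.unusedSimpArgs false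
set_option linter.unusedVariables false
namespace HeckeTP
open Finset

/-- geometric row smoothing -/
noncomputable def GG (ε : ℝ) (d : ℕ → ℕ → ℝ) (i j : ℕ) : ℝ := ∑ k ∈ Finset.Ico 0 (i+1), ε ^ (i - k) * d k j

/-- minors -/
noncomputable def mn (d : ℕ → ℕ → ℝ) {r : ℕ} (I J : Fin r → ℕ) : ℝ := (Matrix.of fun s t : Fin r => d (I s) (J t)).det

lemma GG_split (ε : ℝ) (d : ℕ → ℕ → ℝ) (i i' j : ℕ) (h : i < i') :
    GG ε d i' j = (∑ k ∈ Finset.Ico (i+1) (i'+1), ε ^ (i' - k) * d k j) + ε ^ (i' - i) * GG ε d i j := by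
  rw [GG, ← Finset.sum_Ico_consecutive _ (Nat.zero_le (i+1)) (by omega : i+1 ≤ i'+1), add_comm, GG, Finset.mul_sum]
  congr 1
  refine Finset.sum_congr rfl fun k hk => ?_
  rw [Finset.mem_Ico] at hk
  rw [← mul_assoc, ← pow_add]
  congr 2; omega

def pre {n : ℕ} (I : Fin (n+1) → ℕ) : Fin (n+1) → ℕ := Fin.cons 0 (fun s : Fin n => I s.castSucc + 1)

/-- index sets -/
def kap {n : ℕ} (I : Fin (n+1) → ℕ) : Finset (Fin (n+1) → ℕ) := Fintype.piFinset fun s => Finset.Ico (pre I s) (I s + 1)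

lemma kap_sm {n : ℕ} {I κ : Fin (n+1) → ℕ} (h : κ ∈ kap I) : StrictMono κ := by
  rw [Fin.strictMono_iff_lt_succ]
  intro i
  rw [kap, Fintype.mem_piFinset] at h
  have h1 := h i.castSucc
  have h2 := h i.succ
  rw [Finset.mem_Ico] at h1 h2
  simp only [pre, Fin.cons_succ] at h2
  omega

lemma mn_GG (ε : ℝ) (d : ℕ → ℕ → ℝ) {n : ℕ} {I : Fin (n+1) → ℕ} (hI : StrictMono I) (J : Fin (n+1) → ℕ) :
    mn (GG ε d) I J = ∑ κ ∈ kap I, (∏ s, ε ^ (I s - κ s)) * mn d κ J := by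
  have h1 : mn (GG ε d) I J = (Matrix.of fun s t : Fin (n+1) => ∑ k ∈ Finset.Ico (pre I s) (I s + 1), ε ^ (I s - k) * d k (J t)).det := by
    apply Matrix.det_eq_of_forall_row_eq_smul_add_pred (fun i => ε ^ (I i.succ - I i.castSucc))
    · intro j; simp [GG, pre]
    · intro i j
      simp only [Matrix.of_apply, pre, Fin.cons_succ]
      exact GG_split ε d _ _ _ (hI Fin.castSucc_lt_succ)
  rw [h1]
  have h2 := (Matrix.detRowAlternating (n := Fin (n+1)) (R := ℝ)).toMultilinearMap.map_sum_finset
    (fun s k => fun t => ε ^ (I s - k) * d k (J t)) (fun s => Finset.Ico (pre I s) (I s + 1))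
  have h3 : (Matrix.of fun s t : Fin (n+1) => ∑ k ∈ Finset.Ico (pre I s) (I s + 1), ε ^ (I s - k) * d k (J t)) =
      fun s => ∑ k ∈ Finset.Ico (pre I s) (I s + 1), fun t => ε ^ (I s - k) * d k (J t) := by
    funext s t; simp
  rw [h3]
  refine Eq.trans h2 ?_
  refine Finset.sum_congr rfl fun κ _ => ?_
  exact Matrix.det_mul_column (fun s => ε ^ (I s - κ s)) (Matrix.of fun s t => d (κ s) (J t))

lemma mn_zero (d : ℕ → ℕ → ℝ) (I J : Fin 0 → ℕ) : mn d I J = 1 := by simp [mn]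

/-- straight minors nonneg, and positive if the first rows are initial -/
def SS (m : ℕ) (L : ℕ → ℕ → ℝ) : Prop :=
  (∀ i j, i < j → L i j = 0) ∧
  ∀ (r : ℕ) (I : Fin r → ℕ), StrictMono I → 0 ≤ mn L I (fun t => t) ∧
    ((∀ s : Fin r, s + m < r → I s = s) → 0 < mn L I (fun t => t))

lemma SS_step {m : ℕ} {L : ℕ → ℕ → ℝ} (h : SS m L) {ε : ℝ} (hε : 0 < ε) : SS (m+1) (GG ε L) := by
  refine ⟨fun i j hij => ?_, fun r I hI => ?_⟩
  · apply Finset.sum_eq_zero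
    intro k hk
    rw [Finset.mem_Ico] at hk
    rw [h.1 k j (by omega), mul_zero]
  obtain _ | n := r
  · simp [mn_zero]
  have hnn : ∀ κ ∈ kap I, 0 ≤ (∏ s, ε ^ (I s - κ s)) * mn L κ (fun t => t) := fun κ hκ =>
    mul_nonneg (Finset.prod_nonneg fun s _ => by positivity) (h.2 _ κ (kap_sm hκ)).1
  rw [mn_GG ε L hI]
  refine ⟨Finset.sum_nonneg hnn, fun hs => ?_⟩
  let κ : Fin (n+1) → ℕ := fun s => if (s : ℕ) + m < n + 1 then s else I s
  have hle := le_of_sm hI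
  have hκ : κ ∈ kap I := by
    rw [kap, Fintype.mem_piFinset]
    intro s
    rw [Finset.mem_Ico]
    refine Fin.cases ?_ (fun s => ?_) s
    · have := hle 0
      simp only [pre, Fin.cons_zero, κ]
      split_ifs <;> simp
    · have h1 := hle s.succ
      have h2 : I s.castSucc < I s.succ := hI Fin.castSucc_lt_succ
      have h3 := hs s.castSucc
      simp only [pre, Fin.cons_succ, κ, Fin.val_succ, Fin.val_castSucc] at *
      split_ifs with h4
      · have := h3 (by omega); omega
      · omega
  refine Finset.sum_pos' hnn ⟨κ, hκ, ?_⟩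
  refine mul_pos (Finset.prod_pos fun s _ => by positivity) ((h.2 _ κ (kap_sm hκ)).2 fun s hs => ?_)
  simp only [κ, if_pos hs]

lemma SS_iter {L : ℕ → ℕ → ℝ} (h : SS 0 L) {ε : ℝ} (hε : 0 < ε) (m : ℕ) : SS m ((GG ε)^[m] L) := by
  induction m with
  | zero => exact h
  | succ m ih => rw [Function.iterate_succ_apply']; exact SS_step ih hε

lemma iter_cont (L : ℕ → ℕ → ℝ) (m : ℕ) : ∀ i j, Continuous fun ε => ((GG ε)^[m] L) i j := by
  induction m with
  | zero => intro i j; exact continuous_const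
  | succ m ih =>
    intro i j
    simp only [Function.iterate_succ_apply']
    unfold GG
    exact continuous_finsetSum _ fun k _ => (continuous_id.pow _).mul (ih k j)

lemma GG_zero (L : ℕ → ℕ → ℝ) : GG 0 L = L := by
  funext i j
  rw [GG, Finset.sum_eq_single i]
  · simp
  · intro k hk hki
    rw [Finset.mem_Ico] at hk
    rw [zero_pow (by omega), zero_mul]
  · intro h; exact absurd (by simp) h

def WW (N : ℕ) (L : ℕ → ℕ → ℝ) : Prop :=
  (∀ i j, i < j → L i j = 0) ∧ ∀ (r : ℕ), r ≤ N → ∀ i, 0 < mn L (fun s : Fin r => i + s) (fun t => t)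

lemma mn_col (d : ℕ → ℕ → ℝ) {n : ℕ} (I J : Fin (n+1) → ℕ) (h0 : d (I 0) (J 0) = 1) (h : ∀ s : Fin n, d (I s.succ) (J 0) = 0) :
    mn d I J = mn d (fun s => I s.succ) (fun t => J t.succ) := by
  rw [mn, Matrix.det_succ_column_zero, Fin.sum_univ_succ, Finset.sum_eq_zero]
  · simp [h0, mn]; rfl
  · intro s _; simp [h]

section Whitney
variable {N : ℕ} {L : ℕ → ℕ → ℝ}

noncomputable def uu (L : ℕ → ℕ → ℝ) (i j : ℕ) : ℝ := L i j / L i 0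
noncomputable def dd (L : ℕ → ℕ → ℝ) : ℕ → ℕ → ℝ
  | 0, j => uu L 0 j
  | k+1, j => uu L (k+1) j - uu L k j

lemma GG_dd : GG 1 (dd L) = uu L := by
  funext i j
  simp only [GG, one_pow, one_mul, Nat.Ico_zero_eq_range]
  induction i with
  | zero => simp [dd]
  | succ i ih => rw [Finset.sum_range_succ, ih, dd]; ring

lemma WW.pos (h : WW (N+1) L) (i : ℕ) : 0 < L i 0 := by
  simpa [mn] using h.2 1 (by omega) i

lemma mn_uu (h : WW (N+1) L) {r : ℕ} (I J : Fin r → ℕ) : mn L I J = (∏ s, L (I s) 0) * mn (uu L) I J := by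
  rw [mn, mn, ← Matrix.det_mul_column]
  congr 1
  ext s t
  simp only [Matrix.of_apply, uu]
  rw [mul_div_cancel₀ _ (h.pos _).ne']

lemma dd_col (h : WW (N+1) L) (k : ℕ) : dd L (k+1) 0 = 0 := by
  rw [dd, uu, uu, div_self (h.pos _).ne', div_self (h.pos _).ne', sub_self]
lemma dd_00 (h : WW (N+1) L) : dd L 0 0 = 1 := by
  rw [dd, uu, div_self (h.pos _).ne']
lemma dd_row (h : WW (N+1) L) (j : ℕ) : dd L 0 (j+1) = 0 := by
  rw [dd, uu, h.1 0 (j+1) (by omega), zero_div]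

lemma WW_dd (h : WW (N+1) L) : WW N (fun i j => dd L (i+1) (j+1)) := by
  refine ⟨fun i j hij => ?_, fun r hr i => ?_⟩
  · simp only [dd, uu]
    rw [h.1 (i+1) (j+1) (by omega), h.1 i (j+1) (by omega)]; simp
  · have h1 := h.2 (r+1) (by omega) i
    rw [mn_uu h] at h1
    have h2 : 0 < mn (uu L) (fun s : Fin (r+1) => i + s) (fun t => t) :=
      (mul_pos_iff_of_pos_left (Finset.prod_pos fun s _ => h.pos _)).1 h1
    let B : Matrix (Fin (r+1)) (Fin (r+1)) ℝ := Matrix.of fun s t => (Fin.cons (fun t => uu L i t) (fun s : Fin r => fun t => dd L (i + s + 1) t) : Fin (r+1) → ℕ → ℝ) s t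
    have h3 : mn (uu L) (fun s : Fin (r+1) => i + s) (fun t => t) = B.det := by
      apply Matrix.det_eq_of_forall_row_eq_smul_add_pred (fun i => 1)
      · intro j; simp [B]
      · intro s j
        simp only [B, Matrix.of_apply, Fin.cons_succ, dd, Fin.val_succ, Fin.val_castSucc, ← add_assoc]; ring
    rw [h3, Matrix.det_succ_column_zero, Fin.sum_univ_succ, Finset.sum_eq_zero] at h2
    · simp only [B, Matrix.of_apply, Fin.cons_zero, Fin.val_zero, pow_zero, one_mul, add_zero, uu, div_self (h.pos i).ne'] at h2
      refine h2.trans_eq ?_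
      rw [mn]
      congr 1
    · intro s _; simp [B, dd_col h]

theorem whitney (N : ℕ) : ∀ (L : ℕ → ℕ → ℝ), WW N L → ∀ (r : ℕ) (I J : Fin r → ℕ), StrictMono I → StrictMono J → (∀ s, J s < N) →
    0 ≤ mn L I J := by
  induction N with
  | zero =>
    intro L _ r I J _ _ h
    obtain _ | r := r
    · simp [mn_zero]
    · exact absurd (h 0) (by omega)
  | succ N ih =>
    intro L h r I J hI hJ hJN
    obtain _ | r := r
    · simp [mn_zero]
    rw [mn_uu h, ← GG_dd, mn_GG 1 _ hI]
    refine mul_nonneg (Finset.prod_nonneg fun s _ => (h.pos _).le) (Finset.sum_nonneg fun κ hκ => ?_)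
    simp only [one_pow, Finset.prod_const_one, one_mul]
    have hκ := kap_sm hκ
    have key := ih _ (WW_dd h)
    by_cases h1 : κ 0 = 0
    · by_cases h2 : J 0 = 0
      · have hs : ∀ s : Fin r, 0 < κ s.succ := fun s => by have := hκ (Fin.succ_pos s); omega
        have ht : ∀ s : Fin r, 0 < J s.succ := fun s => by have := hJ (Fin.succ_pos s); omega
        rw [mn_col _ _ _ (by rw [h1, h2, dd_00 h])]
        · have := key r (fun s => κ s.succ - 1) (fun s => J s.succ - 1)
            (fun a b hab => by have := hκ (Fin.succ_lt_succ_iff.2 hab); have := hs a; have := hs b; simp only; omega)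
            (fun a b hab => by have := hJ (Fin.succ_lt_succ_iff.2 hab); have := ht a; have := ht b; simp only; omega)
            (fun s => by have := hJN s.succ; have := ht s; omega)
          refine this.trans_eq ?_
          rw [mn, mn]
          congr 1
          ext s t
          simp only [Matrix.of_apply]
          rw [Nat.sub_add_cancel (hs s), Nat.sub_add_cancel (ht t)]
        · intro s
          rw [h2, ← Nat.sub_add_cancel (hs s), dd_col h]
      · have ht : ∀ s, 0 < J s := fun s => by have := hJ.monotone (Fin.zero_le s); omega
        apply le_of_eq; symm
        apply Matrix.det_eq_zero_of_row_eq_zero 0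
        intro t
        simp only [Matrix.of_apply]
        rw [h1, ← Nat.sub_add_cancel (ht t), dd_row h]
    · have hs : ∀ s, 0 < κ s := fun s => by have := hκ.monotone (Fin.zero_le s); omega
      by_cases h2 : J 0 = 0
      · apply le_of_eq; symm
        apply Matrix.det_eq_zero_of_column_eq_zero 0
        intro t
        simp only [Matrix.of_apply]
        rw [h2, ← Nat.sub_add_cancel (hs t), dd_col h]
      · have ht : ∀ s, 0 < J s := fun s => by have := hJ.monotone (Fin.zero_le s); omega
        have := key (r+1) (fun s => κ s - 1) (fun s => J s - 1)
            (fun a b hab => by have := hκ hab; have := hs a; have := hs b; simp only; omega)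
            (fun a b hab => by have := hJ hab; have := ht a; have := ht b; simp only; omega)
            (fun s => by have := hJN s; have := ht s; omega)
        refine this.trans_eq ?_
        rw [mn, mn]
        congr 1
        ext s t
        simp only [Matrix.of_apply]
        rw [Nat.sub_add_cancel (hs s), Nat.sub_add_cancel (ht t)]

end Whitney

theorem TN_of_SS {L : ℕ → ℕ → ℝ} (h : SS 0 L) {r : ℕ} (I J : Fin r → ℕ) (hI : StrictMono I) (hJ : StrictMono J) :
    0 ≤ mn L I J := by
  obtain ⟨N, hN⟩ : ∃ N, ∀ s, J s < N := ⟨∑ s, J s + 1, fun s => Nat.lt_succ_of_le (Finset.single_le_sum (fun _ _ => Nat.zero_le _) (Finset.mem_univ s))⟩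
  have hpos : ∀ ε : ℝ, 0 < ε → 0 ≤ mn ((GG ε)^[N] L) I J := by
    intro ε hε
    have h1 := SS_iter h hε N
    refine whitney N _ ⟨h1.1, fun r hr i => (h1.2 r _ ?_).2 fun s hs => ?_⟩ r I J hI hJ hN
    · intro a b hab; simpa using hab
    · omega
  have hc : Continuous fun ε => mn ((GG ε)^[N] L) I J := by
    unfold mn
    apply Continuous.matrix_det
    exact continuous_matrix fun s t => iter_cont L N _ _
  have h0 : mn ((GG 0)^[N] L) I J = mn L I J := by
    congr 1
    exact Function.iterate_fixed (GG_zero L) N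
  rw [← h0]
  have ht : Filter.Tendsto (fun ε => mn ((GG ε)^[N] L) I J) (nhdsWithin 0 (Set.Ioi 0)) (nhds (mn ((GG 0)^[N] L) I J)) :=
    (hc.tendsto 0).mono_left nhdsWithin_le_nhds
  exact ge_of_tendsto ht (by filter_upwards [self_mem_nhdsWithin] with ε hε using hpos ε hε)

lemma SS_tp {a : ℕ → ℝ} (ha : a 0 = 1) (h : ∀ {r : ℕ} (ℓ : Fin r → ℕ), StrictMono ℓ → 0 ≤ (Matrix.of fun s t : Fin r => tp a (ℓ s) t).det) :
    SS 0 (tp a) := by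
  refine ⟨fun i j hij => by simp [tp, not_le.2 hij], fun r I hI => ⟨h I hI, fun hs => ?_⟩⟩
  have : mn (tp a) I (fun t => t) = 1 := by
    rw [mn, Matrix.det_of_isLowerTriangular]
    · apply Finset.prod_eq_one
      intro s _
      simp [hs s (by omega), tp, ha]
    · intro s t hst
      have : (s : ℕ) < t := hst
      simp [hs s (by omega), tp]; omega
  rw [this]; exact one_pos

lemma TP_of_straight {a : ℕ → ℝ} (ha : a 0 = 1) (h : ∀ {r : ℕ} (ℓ : Fin r → ℕ), StrictMono ℓ → 0 ≤ (Matrix.of fun s t : Fin r => tp a (ℓ s) t).det) :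
    IsTotallyPositive a := by
  intro r _ i j hi hj
  convert TN_of_SS (SS_tp ha h) i j hi hj using 1
  rw [mn]
  congr 2
  funext s t
  rw [seqExt, tp]
  by_cases hst : j t ≤ i s
  · rw [if_pos (by omega), if_pos hst]; congr 1; omega
  · rw [if_neg (by omega), if_neg hst]

end HeckeTP

/-- Lemma 2.3: for a Hecke operator `R` on `V` (with all quantum integers nonzero),
the dimension sequence `(λ_n)` of `Λ` is totally positive. -/
theorem lambda_isTotallyPositive
    (K : Type*) [Field K] [CharZero K] (V : Type*) [AddCommGroup V] [Module K V]
    [FiniteDimensional K V] (q : K) (hq : q ≠ 0)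
    (R : V ⊗[K] V →ₗ[K] V ⊗[K] V) (hR : IsHecke K V q R)
    (hqint : ∀ k : ℕ, 1 ≤ k → (∑ i ∈ Finset.range k, q ^ i) ≠ 0) :
    IsTotallyPositive (fun n => (lambdaDim K V R n : ℝ)) := by
  have h := HeckeTP.straight R hR hq hqint
  exact HeckeTP.TP_of_straight (by simp [h.1]) h.2
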